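/- Let K be an algebraically closed field and Γ₂ the bound quiver algebra of the quiver with arrow μ: 1→2 and loop β at vertex 2, with relation β³ = 0. Then Γ₂ is τ-tilting finite; it has exactly 8 isomorphism classes of basic two-term silting complexes in K^b(proj Γ₂), equivalently exactly 8 isomorphism classes of basic support τ-tilting modules, and the Hasse quiver of sτ-tilt Γ₂ is of type H_{1,5}. -/

import Mathlib

/-!
Core definitions for τ-tilting theory of finite dimensional algebras.

Throughout, for an algebra `Λ`, *right* `Λ`-modules are formalized as left modules
over the opposite ring `Λᵐᵒᵖ` (the category `RMod Λ := ModuleCat Λᵐᵒᵖ`).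

τ-rigidity is formalized via the standard projective-presentation criterion of
Auslander–Smalø/Adachi–Iyama–Reiten: a finitely generated module `M` is τ-rigid iff it admits
a (finite) projective presentation `P₁ → P₀ → M → 0` such that
`Hom(P₀, M) → Hom(P₁, M)` is surjective.
-/

noncomputable section

namespace TwoPoint

/-- A module is indecomposable if it is nonzero and admits no nontrivial direct sum
decomposition. -/
def IsIndecModule (R : Type) [Ring R] (M : Type) [AddCommGroup M] [Module R M] : Prop :=
  Nontrivial M ∧ ∀ N₁ N₂ : Submodule R M, IsCompl N₁ N₂ → N₁ = ⊥ ∨ N₂ = ⊥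

/-- `M` decomposes as a finite direct sum of indecomposable submodules having exactly `n`
isomorphism classes. -/
def HasIndecClassCount (R : Type) [Ring R] (M : ModuleCat.{0} R) (n : ℕ) : Prop :=
  ∃ (k : ℕ) (N : Fin k → Submodule R M),
    DirectSum.IsInternal N ∧ (∀ i, IsIndecModule R (N i)) ∧
    ∃ c : Fin k → Fin n, Function.Surjective c ∧
      ∀ i j, (c i = c j ↔ Nonempty ((N i) ≃ₗ[R] (N j)))

/-- `M` is basic: it decomposes as a finite direct sum of pairwise nonisomorphic
indecomposable submodules. -/
def IsBasicModuleCat (R : Type) [Ring R] (M : ModuleCat.{0} R) : Prop :=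
  ∃ (k : ℕ) (N : Fin k → Submodule R M),
    DirectSum.IsInternal N ∧ (∀ i, IsIndecModule R (N i)) ∧
    ∀ i j, i ≠ j → IsEmpty ((N i) ≃ₗ[R] (N j))

/-- τ-rigidity, via the projective presentation criterion: there is a finite projective
presentation `P₁ —f→ P₀ —g→ M → 0` such that `Hom(—, M)` applied to `f` is surjective,
i.e. `Hom_Λ(M, τM) = 0`. -/
def IsTauRigidCat (R : Type) [Ring R] (M : ModuleCat.{0} R) : Prop :=
  Module.Finite R M ∧
  ∃ (P₁ P₀ : ModuleCat.{0} R) (f : P₁ →ₗ[R] P₀) (g : P₀ →ₗ[R] M),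
    Module.Finite R P₁ ∧ Module.Projective R P₁ ∧
    Module.Finite R P₀ ∧ Module.Projective R P₀ ∧
    Function.Surjective g ∧ LinearMap.range f = LinearMap.ker g ∧
    ∀ h : P₁ →ₗ[R] M, ∃ h' : P₀ →ₗ[R] M, h = h'.comp f

/-- Support τ-tilting module, via support τ-tilting pairs `(M, P)` (Adachi–Iyama–Reiten):
`M` is τ-rigid, `P` is finitely generated projective with `Hom(P, M) = 0`, and
`|M| + |P| = |R|` where `|X|` is the number of isomorphism classes of indecomposable
direct summands. -/
def IsSupportTauTiltingCat (R : Type) [Ring R] (M : ModuleCat.{0} R) : Prop :=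
  IsTauRigidCat R M ∧
  ∃ (P : ModuleCat.{0} R) (p q r : ℕ),
    Module.Finite R P ∧ Module.Projective R P ∧
    (∀ f : P →ₗ[R] M, f = 0) ∧
    HasIndecClassCount R M p ∧ HasIndecClassCount R P q ∧
    HasIndecClassCount R (ModuleCat.of R R) r ∧ p + q = r

/-- The category of (finitely generated) right `Λ`-modules, as left `Λᵐᵒᵖ`-modules. -/
abbrev RMod (Λ : Type) [Ring Λ] := ModuleCat.{0} Λᵐᵒᵖ

/-- Basic support τ-tilting right `Λ`-module. -/
def IsBasicSupportTauTilting (Λ : Type) [Ring Λ] (M : RMod Λ) : Prop :=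
  IsSupportTauTiltingCat Λᵐᵒᵖ M ∧ IsBasicModuleCat Λᵐᵒᵖ M

/-- `Λ` is τ-tilting finite: there are only finitely many isomorphism classes of basic
support τ-tilting right `Λ`-modules. -/
def IsTauTiltingFinite (Λ : Type) [Ring Λ] : Prop :=
  ∃ (n : ℕ) (L : Fin n → RMod Λ),
    ∀ M : RMod Λ, IsBasicSupportTauTilting Λ M → ∃ i, Nonempty (M ≃ₗ[Λᵐᵒᵖ] L i)

/-- `Λ` has exactly `n` isomorphism classes of basic support τ-tilting modules. -/
def SupportTauTiltingCount (Λ : Type) [Ring Λ] (n : ℕ) : Prop :=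
  ∃ L : Fin n → RMod Λ,
    (∀ i, IsBasicSupportTauTilting Λ (L i)) ∧
    (∀ i j, Nonempty ((L i) ≃ₗ[Λᵐᵒᵖ] (L j)) → i = j) ∧
    ∀ M : RMod Λ, IsBasicSupportTauTilting Λ M → ∃ i, Nonempty (M ≃ₗ[Λᵐᵒᵖ] L i)

/-- `Fac M ⊆ Fac N`: every factor module of a finite direct sum of copies of `M` is also a
factor module of a finite direct sum of copies of `N`.  This is the partial order on
support τ-tilting modules. -/
def FacLE (Λ : Type) [Ring Λ] (M N : RMod Λ) : Prop :=
  ∀ X : RMod Λ,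
    (∃ (k : ℕ) (f : (Fin k → M) →ₗ[Λᵐᵒᵖ] X), Function.Surjective f) →
    (∃ (k : ℕ) (f : (Fin k → N) →ₗ[Λᵐᵒᵖ] X), Function.Surjective f)

/-- The Hasse quiver of the poset `sτ-tilt Λ` is of type `H_{m,n}`: the poset of
isomorphism classes of basic support τ-tilting modules is isomorphic to the poset
consisting of a greatest element, a least element, and two incomparable chains with `m`
resp. `n` elements in between (hence two directed paths from `Λ` to `0` with `m` resp. `n`
intermediate vertices). -/
def HasseType (Λ : Type) [Ring Λ] (m n : ℕ) : Prop :=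
  ∃ T : WithTop (WithBot (Fin m ⊕ Fin n)) → RMod Λ,
    (∀ x, IsBasicSupportTauTilting Λ (T x)) ∧
    (∀ x y, Nonempty ((T x) ≃ₗ[Λᵐᵒᵖ] (T y)) → x = y) ∧
    (∀ M : RMod Λ, IsBasicSupportTauTilting Λ M → ∃ x, Nonempty (M ≃ₗ[Λᵐᵒᵖ] T x)) ∧
    ∀ x y, x ≤ y ↔ FacLE Λ (T x) (T y)

/-- `Λ` is τ-tilting finite with exactly `N` basic support τ-tilting modules and Hasse
quiver of type `H_{m,n}`. -/
def TauTiltingData (Λ : Type) [Ring Λ] (N m n : ℕ) : Prop :=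
  IsTauTiltingFinite Λ ∧ SupportTauTiltingCount Λ N ∧ HasseType Λ m n

/-- `B` is a factor algebra of `Λ`: there is a surjective `K`-algebra homomorphism
`Λ → B`. -/
def IsFactorAlgebra (K : Type) [CommRing K] (B Λ : Type) [Ring B] [Ring Λ]
    [Algebra K B] [Algebra K Λ] : Prop :=
  ∃ φ : Λ →ₐ[K] B, Function.Surjective φ

/-- `Λ` is a basic algebra: the regular right module decomposes into pairwise
nonisomorphic indecomposables. -/
def IsBasicAlgebra (Λ : Type) [Ring Λ] : Prop :=
  IsBasicModuleCat Λᵐᵒᵖ (ModuleCat.of Λᵐᵒᵖ Λᵐᵒᵖ)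

/-- `Λ` is representation-finite: finitely many isomorphism classes of indecomposable
finitely generated right modules. -/
def IsRepFinite (Λ : Type) [Ring Λ] : Prop :=
  ∃ (n : ℕ) (L : Fin n → RMod Λ), ∀ M : RMod Λ,
    Module.Finite Λᵐᵒᵖ M → IsIndecModule Λᵐᵒᵖ M → ∃ i, Nonempty (M ≃ₗ[Λᵐᵒᵖ] L i)

end TwoPoint

namespace TwoPoint

/-! ### Bound quiver algebras on two-point quivers

A two-point quiver is given by an arrow type `σ` together with source and target functions
`s t : σ → Fin 2`.  The corresponding bound quiver algebra `KQ/I` is presented as the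
quotient of the free algebra on the two vertex idempotents and the arrows, by the path
algebra relations together with the defining relations of `I` (paths are composed from
left to right, so a relation like `αμβ` is the product `α * μ * β`). -/

/-- Generators for the path algebra of a two-point quiver: two vertex idempotents and the
arrows. -/
inductive TPGen (σ : Type) : Type
  | v : Fin 2 → TPGen σ
  | ar : σ → TPGen σ

/-- The vertex idempotent generator. -/
def vtx (K : Type) [Field K] {σ : Type} (i : Fin 2) : FreeAlgebra K (TPGen σ) :=
  FreeAlgebra.ι K (TPGen.v i)

/-- The arrow generator. -/
def arr (K : Type) [Field K] {σ : Type} (a : σ) : FreeAlgebra K (TPGen σ) :=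
  FreeAlgebra.ι K (TPGen.ar a)

/-- The defining relations of a bound quiver algebra on a two-point quiver:
`e_i e_j = δ_{ij} e_i`, `e_1 + e_2 = 1`, `e_{s(a)} a = a = a e_{t(a)}`, together with the
prescribed relations `rels` (each pair `(x, y) ∈ rels` imposes `x = y`). -/
inductive QuivRel (K : Type) [Field K] (σ : Type) (s t : σ → Fin 2)
    (rels : Set (FreeAlgebra K (TPGen σ) × FreeAlgebra K (TPGen σ))) :
    FreeAlgebra K (TPGen σ) → FreeAlgebra K (TPGen σ) → Prop
  | idem (i : Fin 2) : QuivRel K σ s t rels (vtx K i * vtx K i) (vtx K i)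
  | orth (i j : Fin 2) : i ≠ j → QuivRel K σ s t rels (vtx K i * vtx K j) 0
  | vsum : QuivRel K σ s t rels (vtx K 0 + vtx K 1) 1
  | src (a : σ) : QuivRel K σ s t rels (vtx K (s a) * arr K a) (arr K a)
  | tgt (a : σ) : QuivRel K σ s t rels (arr K a * vtx K (t a)) (arr K a)
  | rel (p : FreeAlgebra K (TPGen σ) × FreeAlgebra K (TPGen σ)) :
      p ∈ rels → QuivRel K σ s t rels p.1 p.2

/-- The bound quiver algebra of a two-point quiver with relations `rels`. -/
abbrev BoundQuiverAlgebra (K : Type) [Field K] (σ : Type) (s t : σ → Fin 2)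
    (rels : Set (FreeAlgebra K (TPGen σ) × FreeAlgebra K (TPGen σ))) : Type :=
  RingQuot (QuivRel K σ s t rels)

/-! Concrete two-point quivers used below.  Vertices are `0` ("1") and `1` ("2"). -/

/- Quiver `μ : 1 → 2`, loop `β` at `2`. -/
namespace QA
def s : Fin 2 → Fin 2 := ![0, 1]
def t : Fin 2 → Fin 2 := ![1, 1]
def mu (K : Type) [Field K] : FreeAlgebra K (TPGen (Fin 2)) := arr K (0 : Fin 2)
def be (K : Type) [Field K] : FreeAlgebra K (TPGen (Fin 2)) := arr K (1 : Fin 2)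
end QA

/- Quiver: loop `α` at `1`, `μ : 1 → 2`, loop `β` at `2`. -/
namespace QB
def s : Fin 3 → Fin 2 := ![0, 0, 1]
def t : Fin 3 → Fin 2 := ![0, 1, 1]
def al (K : Type) [Field K] : FreeAlgebra K (TPGen (Fin 3)) := arr K (0 : Fin 3)
def mu (K : Type) [Field K] : FreeAlgebra K (TPGen (Fin 3)) := arr K (1 : Fin 3)
def be (K : Type) [Field K] : FreeAlgebra K (TPGen (Fin 3)) := arr K (2 : Fin 3)
end QB

/- Quiver: `μ : 1 → 2`, loops `β₁, β₂` at `2`. -/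
namespace QC
def s : Fin 3 → Fin 2 := ![0, 1, 1]
def t : Fin 3 → Fin 2 := ![1, 1, 1]
def mu (K : Type) [Field K] : FreeAlgebra K (TPGen (Fin 3)) := arr K (0 : Fin 3)
def b1 (K : Type) [Field K] : FreeAlgebra K (TPGen (Fin 3)) := arr K (1 : Fin 3)
def b2 (K : Type) [Field K] : FreeAlgebra K (TPGen (Fin 3)) := arr K (2 : Fin 3)
end QC

/- Quiver: loop `α` at `1`, `μ : 1 → 2`, `ν : 2 → 1`. -/
namespace QD
def s : Fin 3 → Fin 2 := ![0, 0, 1]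
def t : Fin 3 → Fin 2 := ![0, 1, 0]
def al (K : Type) [Field K] : FreeAlgebra K (TPGen (Fin 3)) := arr K (0 : Fin 3)
def mu (K : Type) [Field K] : FreeAlgebra K (TPGen (Fin 3)) := arr K (1 : Fin 3)
def nu (K : Type) [Field K] : FreeAlgebra K (TPGen (Fin 3)) := arr K (2 : Fin 3)
end QD

/- Quiver: loops `α` at `1` and `β` at `2`, `μ : 1 → 2`, `ν : 2 → 1`. -/
namespace QE
def s : Fin 4 → Fin 2 := ![0, 1, 0, 1]
def t : Fin 4 → Fin 2 := ![0, 1, 1, 0]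
def al (K : Type) [Field K] : FreeAlgebra K (TPGen (Fin 4)) := arr K (0 : Fin 4)
def be (K : Type) [Field K] : FreeAlgebra K (TPGen (Fin 4)) := arr K (1 : Fin 4)
def mu (K : Type) [Field K] : FreeAlgebra K (TPGen (Fin 4)) := arr K (2 : Fin 4)
def nu (K : Type) [Field K] : FreeAlgebra K (TPGen (Fin 4)) := arr K (3 : Fin 4)
end QE

/- Quiver: `μ : 1 → 2`, `ν : 2 → 1`. -/
namespace QF
def s : Fin 2 → Fin 2 := ![0, 1]
def t : Fin 2 → Fin 2 := ![1, 0]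
def mu (K : Type) [Field K] : FreeAlgebra K (TPGen (Fin 2)) := arr K (0 : Fin 2)
def nu (K : Type) [Field K] : FreeAlgebra K (TPGen (Fin 2)) := arr K (1 : Fin 2)
end QF

/- The Kronecker quiver: `μ₁, μ₂ : 1 → 2`. -/
namespace QG
def s : Fin 2 → Fin 2 := ![0, 0]
def t : Fin 2 → Fin 2 := ![1, 1]
end QG

/- Quiver: `μ₁, μ₂ : 1 → 2`, `ν₁, ν₂ : 2 → 1`. -/
namespace QH
def s : Fin 4 → Fin 2 := ![0, 0, 1, 1]
def t : Fin 4 → Fin 2 := ![1, 1, 0, 0]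
def mu1 (K : Type) [Field K] : FreeAlgebra K (TPGen (Fin 4)) := arr K (0 : Fin 4)
def mu2 (K : Type) [Field K] : FreeAlgebra K (TPGen (Fin 4)) := arr K (1 : Fin 4)
def nu1 (K : Type) [Field K] : FreeAlgebra K (TPGen (Fin 4)) := arr K (2 : Fin 4)
def nu2 (K : Type) [Field K] : FreeAlgebra K (TPGen (Fin 4)) := arr K (3 : Fin 4)
end QH

/- Quiver: loop `α` at `1`, `μ : 1 → 2`. -/
namespace QI
def s : Fin 2 → Fin 2 := ![0, 0]
def t : Fin 2 → Fin 2 := ![0, 1]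
def al (K : Type) [Field K] : FreeAlgebra K (TPGen (Fin 2)) := arr K (0 : Fin 2)
def mu (K : Type) [Field K] : FreeAlgebra K (TPGen (Fin 2)) := arr K (1 : Fin 2)
end QI

/- Quiver: loops `α₁, α₂` at `1`, `μ : 1 → 2`. -/
namespace QJ
def s : Fin 3 → Fin 2 := ![0, 0, 0]
def t : Fin 3 → Fin 2 := ![0, 0, 1]
def a1 (K : Type) [Field K] : FreeAlgebra K (TPGen (Fin 3)) := arr K (0 : Fin 3)
def a2 (K : Type) [Field K] : FreeAlgebra K (TPGen (Fin 3)) := arr K (1 : Fin 3)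
def mu (K : Type) [Field K] : FreeAlgebra K (TPGen (Fin 3)) := arr K (2 : Fin 3)
end QJ

/- Quiver: `μ₁, μ₂ : 1 → 2`, `ν : 2 → 1`. -/
namespace QK
def s : Fin 3 → Fin 2 := ![0, 0, 1]
def t : Fin 3 → Fin 2 := ![1, 1, 0]
def mu1 (K : Type) [Field K] : FreeAlgebra K (TPGen (Fin 3)) := arr K (0 : Fin 3)
def mu2 (K : Type) [Field K] : FreeAlgebra K (TPGen (Fin 3)) := arr K (1 : Fin 3)
def nu (K : Type) [Field K] : FreeAlgebra K (TPGen (Fin 3)) := arr K (2 : Fin 3)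
end QK

/- Quiver: `μ₁, μ₂, μ₃ : 1 → 2`. -/
namespace QL
def s : Fin 3 → Fin 2 := ![0, 0, 0]
def t : Fin 3 → Fin 2 := ![1, 1, 1]
end QL

/- Quiver: loop `α` at `1`, `μ₁, μ₂ : 1 → 2`. -/
namespace QM
def s : Fin 3 → Fin 2 := ![0, 0, 0]
def t : Fin 3 → Fin 2 := ![0, 1, 1]
def al (K : Type) [Field K] : FreeAlgebra K (TPGen (Fin 3)) := arr K (0 : Fin 3)
def mu1 (K : Type) [Field K] : FreeAlgebra K (TPGen (Fin 3)) := arr K (1 : Fin 3)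
def mu2 (K : Type) [Field K] : FreeAlgebra K (TPGen (Fin 3)) := arr K (2 : Fin 3)
end QM

end TwoPoint

namespace TwoPoint

/-! ### The algebras of Table Γ -/

/-- `Γ₁`: the Kronecker algebra. -/
abbrev Gamma1 (K : Type) [Field K] : Type :=
  BoundQuiverAlgebra K (Fin 2) QG.s QG.t ∅

/-- `Γ₂`: `μ : 1 → 2`, loop `β` at `2`, `β³ = 0`. -/
abbrev Gamma2 (K : Type) [Field K] : Type :=
  BoundQuiverAlgebra K (Fin 2) QA.s QA.t {(QA.be K ^ 3, 0)}

/-- `Γ₃`: `μ : 1 → 2`, loop `β` at `2`, `β⁴ = 0`. -/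
abbrev Gamma3 (K : Type) [Field K] : Type :=
  BoundQuiverAlgebra K (Fin 2) QA.s QA.t {(QA.be K ^ 4, 0)}

/-- `Γ₄`: `α² = β² = 0`. -/
abbrev Gamma4 (K : Type) [Field K] : Type :=
  BoundQuiverAlgebra K (Fin 3) QB.s QB.t {(QB.al K ^ 2, 0), (QB.be K ^ 2, 0)}

/-- `Γ₅`: `α² = β³ = 0`, `αμβ = μβ²`. -/
abbrev Gamma5 (K : Type) [Field K] : Type :=
  BoundQuiverAlgebra K (Fin 3) QB.s QB.t
    {(QB.al K ^ 2, 0), (QB.be K ^ 3, 0), (QB.al K * QB.mu K * QB.be K, QB.mu K * QB.be K ^ 2)}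

/-- `Γ₆`: `α² = β⁴ = 0`, `αμβ = μβ³`. -/
abbrev Gamma6 (K : Type) [Field K] : Type :=
  BoundQuiverAlgebra K (Fin 3) QB.s QB.t
    {(QB.al K ^ 2, 0), (QB.be K ^ 4, 0), (QB.al K * QB.mu K * QB.be K, QB.mu K * QB.be K ^ 3)}

/-- `Γ₇`: `β₁² = β₂² = β₁β₂ = β₂β₁ = 0`. -/
abbrev Gamma7 (K : Type) [Field K] : Type :=
  BoundQuiverAlgebra K (Fin 3) QC.s QC.t
    {(QC.b1 K ^ 2, 0), (QC.b2 K ^ 2, 0), (QC.b1 K * QC.b2 K, 0), (QC.b2 K * QC.b1 K, 0)}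

/-- `Γ₈`: `α² = μν = νμ = να = 0`. -/
abbrev Gamma8 (K : Type) [Field K] : Type :=
  BoundQuiverAlgebra K (Fin 3) QD.s QD.t
    {(QD.al K ^ 2, 0), (QD.mu K * QD.nu K, 0), (QD.nu K * QD.mu K, 0), (QD.nu K * QD.al K, 0)}

/-- `Γ₉`: `α³ = μν = νμ = να = 0`. -/
abbrev Gamma9 (K : Type) [Field K] : Type :=
  BoundQuiverAlgebra K (Fin 3) QD.s QD.t
    {(QD.al K ^ 3, 0), (QD.mu K * QD.nu K, 0), (QD.nu K * QD.mu K, 0), (QD.nu K * QD.al K, 0)}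

/-- `Γ₁₀`: `α² = μν = νμ = ναμ = 0`. -/
abbrev Gamma10 (K : Type) [Field K] : Type :=
  BoundQuiverAlgebra K (Fin 3) QD.s QD.t
    {(QD.al K ^ 2, 0), (QD.mu K * QD.nu K, 0), (QD.nu K * QD.mu K, 0),
     (QD.nu K * QD.al K * QD.mu K, 0)}

/-- `Γ₁₁` (`n ≥ 2`): `αⁿ = μν = να³ = α³μ = 0`. -/
abbrev Gamma11 (K : Type) [Field K] (n : ℕ) : Type :=
  BoundQuiverAlgebra K (Fin 3) QD.s QD.t
    {(QD.al K ^ n, 0), (QD.mu K * QD.nu K, 0), (QD.nu K * QD.al K ^ 3, 0),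
     (QD.al K ^ 3 * QD.mu K, 0)}

/-- `Γ₁₂` (`m ≥ 2`, `n ≥ 1`): `αᵐ = να = αμν = α³μ = (μν)ⁿ = 0`. -/
abbrev Gamma12 (K : Type) [Field K] (m n : ℕ) : Type :=
  BoundQuiverAlgebra K (Fin 3) QD.s QD.t
    {(QD.al K ^ m, 0), (QD.nu K * QD.al K, 0), (QD.al K * QD.mu K * QD.nu K, 0),
     (QD.al K ^ 3 * QD.mu K, 0), ((QD.mu K * QD.nu K) ^ n, 0)}

/-- `Γ₁₃` (`m ≥ 2`, `n ≥ 1`): `αᵐ = μνμ = νμν = να² = α²μ = (ναμ)ⁿ = 0`. -/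
abbrev Gamma13 (K : Type) [Field K] (m n : ℕ) : Type :=
  BoundQuiverAlgebra K (Fin 3) QD.s QD.t
    {(QD.al K ^ m, 0), (QD.mu K * QD.nu K * QD.mu K, 0), (QD.nu K * QD.mu K * QD.nu K, 0),
     (QD.nu K * QD.al K ^ 2, 0), (QD.al K ^ 2 * QD.mu K, 0),
     ((QD.nu K * QD.al K * QD.mu K) ^ n, 0)}

/-- `Γ₁₄` (`n ≥ 1`): `α² = μν`, `ναⁿμ = 0`. -/
abbrev Gamma14 (K : Type) [Field K] (n : ℕ) : Type :=
  BoundQuiverAlgebra K (Fin 3) QD.s QD.t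
    {(QD.al K ^ 2, QD.mu K * QD.nu K), (QD.nu K * QD.al K ^ n * QD.mu K, 0)}

/-- `Γ₁₅` (`n ≥ 1`): `α³ = μν`, `ναⁿμ = 0`. -/
abbrev Gamma15 (K : Type) [Field K] (n : ℕ) : Type :=
  BoundQuiverAlgebra K (Fin 3) QD.s QD.t
    {(QD.al K ^ 3, QD.mu K * QD.nu K), (QD.nu K * QD.al K ^ n * QD.mu K, 0)}

/-- `Γ₁₆` (`n ≥ 4`): `αⁿ = μν`, `να³ = α³μ = 0`. -/
abbrev Gamma16 (K : Type) [Field K] (n : ℕ) : Type :=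
  BoundQuiverAlgebra K (Fin 3) QD.s QD.t
    {(QD.al K ^ n, QD.mu K * QD.nu K), (QD.nu K * QD.al K ^ 3, 0), (QD.al K ^ 3 * QD.mu K, 0)}

/-- `Γ₁₇` (`m, n ≥ 2`, `r ≥ 1`): `αᵐ = βⁿ = νμ = βν = μβ = να² = α²μ = (ναμ)ʳ = 0`. -/
abbrev Gamma17 (K : Type) [Field K] (m n r : ℕ) : Type :=
  BoundQuiverAlgebra K (Fin 4) QE.s QE.t
    {(QE.al K ^ m, 0), (QE.be K ^ n, 0), (QE.nu K * QE.mu K, 0), (QE.be K * QE.nu K, 0),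
     (QE.mu K * QE.be K, 0), (QE.nu K * QE.al K ^ 2, 0), (QE.al K ^ 2 * QE.mu K, 0),
     ((QE.nu K * QE.al K * QE.mu K) ^ r, 0)}

/-- `Γ₁₈` (`m, n ≥ 2`): `αᵐ = βⁿ = νμ = βν = να = α²μ = μβ² = αμβ = 0`. -/
abbrev Gamma18 (K : Type) [Field K] (m n : ℕ) : Type :=
  BoundQuiverAlgebra K (Fin 4) QE.s QE.t
    {(QE.al K ^ m, 0), (QE.be K ^ n, 0), (QE.nu K * QE.mu K, 0), (QE.be K * QE.nu K, 0),
     (QE.nu K * QE.al K, 0), (QE.al K ^ 2 * QE.mu K, 0), (QE.mu K * QE.be K ^ 2, 0),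
     (QE.al K * QE.mu K * QE.be K, 0)}

/-- `Γ₁₉`: `α² = μν`, `β² = νμ`, `αμβ = βνα = 0`. -/
abbrev Gamma19 (K : Type) [Field K] : Type :=
  BoundQuiverAlgebra K (Fin 4) QE.s QE.t
    {(QE.al K ^ 2, QE.mu K * QE.nu K), (QE.be K ^ 2, QE.nu K * QE.mu K),
     (QE.al K * QE.mu K * QE.be K, 0), (QE.be K * QE.nu K * QE.al K, 0)}

/-- `Γ₂₀` (`m, n ≥ 2`, `r ≥ 1`): `αμ = μβ`, `βν = να`, `αᵐ = βⁿ = (νμ)ʳ = 0`. -/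
abbrev Gamma20 (K : Type) [Field K] (m n r : ℕ) : Type :=
  BoundQuiverAlgebra K (Fin 4) QE.s QE.t
    {(QE.al K * QE.mu K, QE.mu K * QE.be K), (QE.be K * QE.nu K, QE.nu K * QE.al K),
     (QE.al K ^ m, 0), (QE.be K ^ n, 0), ((QE.nu K * QE.mu K) ^ r, 0)}

end TwoPoint

namespace TwoPoint

/-! ### Two-term complexes of projectives and two-term silting complexes

A two-term complex in `K^b(proj Λ)` is a complex `P₁ —d→ P₀` of finitely generated
projective right `Λ`-modules concentrated in degrees `−1` and `0`.  Isomorphism in the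
homotopy category, direct sums, indecomposability and the presilting condition
`Hom_{K^b}(T, T[1]) = 0` are all spelled out explicitly.  Following
Adachi–Iyama–Reiten, a two-term presilting complex is *silting* precisely when the
number of pairwise nonisomorphic indecomposable direct summands equals the number `|Λ|`
of indecomposable summands of the regular module; we use this characterization. -/

/-- A two-term complex `P₁ —d→ P₀` of right `Λ`-modules. -/
structure TwoTerm (Λ : Type) [Ring Λ] where
  P₁ : RMod Λ
  P₀ : RMod Λ
  d : P₁ →ₗ[Λᵐᵒᵖ] P₀

namespace TwoTerm

variable {Λ : Type} [Ring Λ]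

/-- Both terms are finitely generated projective. -/
def IsProj (T : TwoTerm Λ) : Prop :=
  Module.Finite Λᵐᵒᵖ T.P₁ ∧ Module.Projective Λᵐᵒᵖ T.P₁ ∧
  Module.Finite Λᵐᵒᵖ T.P₀ ∧ Module.Projective Λᵐᵒᵖ T.P₀

/-- `T` and `S` are isomorphic in the homotopy category: there are chain maps in both
directions whose composites are homotopic to the identity. -/
def HIso (T S : TwoTerm Λ) : Prop :=
  ∃ (u₁ : T.P₁ →ₗ[Λᵐᵒᵖ] S.P₁) (u₀ : T.P₀ →ₗ[Λᵐᵒᵖ] S.P₀)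
    (v₁ : S.P₁ →ₗ[Λᵐᵒᵖ] T.P₁) (v₀ : S.P₀ →ₗ[Λᵐᵒᵖ] T.P₀),
    u₀.comp T.d = S.d.comp u₁ ∧ v₀.comp S.d = T.d.comp v₁ ∧
    (∃ h : T.P₀ →ₗ[Λᵐᵒᵖ] T.P₁,
      (v₁.comp u₁) - LinearMap.id = h.comp T.d ∧
      (v₀.comp u₀) - LinearMap.id = T.d.comp h) ∧
    (∃ h : S.P₀ →ₗ[Λᵐᵒᵖ] S.P₁,
      (u₁.comp v₁) - LinearMap.id = h.comp S.d ∧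
      (u₀.comp v₀) - LinearMap.id = S.d.comp h)

/-- Direct sum of two-term complexes. -/
def dsum (T S : TwoTerm Λ) : TwoTerm Λ where
  P₁ := ModuleCat.of Λᵐᵒᵖ (T.P₁ × S.P₁)
  P₀ := ModuleCat.of Λᵐᵒᵖ (T.P₀ × S.P₀)
  d := T.d.prodMap S.d

/-- The zero two-term complex. -/
def zero (Λ : Type) [Ring Λ] : TwoTerm Λ where
  P₁ := ModuleCat.of Λᵐᵒᵖ PUnit
  P₀ := ModuleCat.of Λᵐᵒᵖ PUnit
  d := 0

/-- Direct sum of a finite list of two-term complexes. -/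
def sumList : List (TwoTerm Λ) → TwoTerm Λ
  | [] => zero Λ
  | x :: xs => dsum x (sumList xs)

/-- `T` is indecomposable in the homotopy category. -/
def IsIndec (T : TwoTerm Λ) : Prop :=
  ¬ HIso T (zero Λ) ∧
  ∀ U V : TwoTerm Λ, HIso T (dsum U V) → HIso U (zero Λ) ∨ HIso V (zero Λ)

/-- `T` is presilting: `Hom_{K^b(proj Λ)}(T, T[1]) = 0`, i.e. every map
`w : P₁ → P₀` is null-homotopic as a map of complexes `T → T[1]`. -/
def IsPresilting (T : TwoTerm Λ) : Prop :=
  ∀ w : T.P₁ →ₗ[Λᵐᵒᵖ] T.P₀, ∃ (h : T.P₀ →ₗ[Λᵐᵒᵖ] T.P₀) (h' : T.P₁ →ₗ[Λᵐᵒᵖ] T.P₁),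
    w = h.comp T.d + T.d.comp h'

/-- `T` is a basic two-term silting complex: a two-term presilting complex of finitely
generated projectives which is (up to homotopy equivalence) a direct sum of pairwise
nonisomorphic indecomposable two-term complexes whose number equals `|Λ|`, the number of
indecomposable direct summands of the regular representation.  (For two-term presilting
complexes this maximality characterizes silting, by Adachi–Iyama–Reiten.) -/
def IsBasicSilting (T : TwoTerm Λ) : Prop :=
  IsProj T ∧ IsPresilting T ∧
  ∃ (k : ℕ) (L : Fin k → TwoTerm Λ),
    (∀ i, IsIndec (L i) ∧ IsProj (L i)) ∧
    HIso T (sumList (List.ofFn L)) ∧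
    (∀ i j, i ≠ j → ¬ HIso (L i) (L j)) ∧
    HasIndecClassCount Λᵐᵒᵖ (ModuleCat.of Λᵐᵒᵖ Λᵐᵒᵖ) k

end TwoTerm

/-- `Λ` has exactly `n` basic two-term silting complexes up to isomorphism in
`K^b(proj Λ)`. -/
def TwoTermSiltingCount (Λ : Type) [Ring Λ] (n : ℕ) : Prop :=
  ∃ L : Fin n → TwoTerm Λ,
    (∀ i, TwoTerm.IsBasicSilting (L i)) ∧
    (∀ i j, TwoTerm.HIso (L i) (L j) → i = j) ∧
    ∀ T : TwoTerm Λ, TwoTerm.IsBasicSilting T → ∃ i, TwoTerm.HIso T (L i)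

/-- `Λ` has infinitely many basic two-term silting complexes up to isomorphism. -/
def TwoTermSiltingInfinite (Λ : Type) [Ring Λ] : Prop :=
  ¬ ∃ (n : ℕ) (L : Fin n → TwoTerm Λ),
    ∀ T : TwoTerm Λ, TwoTerm.IsBasicSilting T → ∃ i, TwoTerm.HIso T (L i)

end TwoPoint

namespace TwoPoint

/-! ### Krull–Schmidt for modules of finite length -/

section KrullSchmidt

variable {R : Type} [Ring R]

/-- `N` is isomorphic to a direct summand of `M`. -/
def IsRetract (R : Type) [Ring R] (N M : Type) [AddCommGroup N] [Module R N]
    [AddCommGroup M] [Module R M] : Prop :=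
  ∃ (i : N →ₗ[R] M) (p : M →ₗ[R] N), p.comp i = LinearMap.id

variable {M N L : Type} [AddCommGroup M] [Module R M] [AddCommGroup N] [Module R N]
  [AddCommGroup L] [Module R L]

lemma IsRetract.trans (h₁ : IsRetract R N M) (h₂ : IsRetract R M L) : IsRetract R N L := by
  obtain ⟨i, p, h⟩ := h₁
  obtain ⟨j, q, h'⟩ := h₂
  refine ⟨j.comp i, p.comp q, ?_⟩
  rw [LinearMap.comp_assoc, ← LinearMap.comp_assoc i j q, h', LinearMap.id_comp, h]

lemma IsRetract.of_equiv (e : N ≃ₗ[R] M) : IsRetract R N M :=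
  ⟨e, e.symm, by ext; simp⟩

lemma IsIndecModule.of_equiv (e : N ≃ₗ[R] M) (h : IsIndecModule R N) : IsIndecModule R M := by
  obtain ⟨h₁, h₂⟩ := h
  refine ⟨e.symm.toEquiv.nontrivial, fun N₁ N₂ hc => ?_⟩
  have key : IsCompl (N₁.map e.symm.toLinearMap) (N₂.map e.symm.toLinearMap) :=
    (Submodule.orderIsoMapComap e.symm).isCompl hc
  rcases h₂ _ _ key with h | h
  · left; exact (Submodule.map_eq_bot_iff (e := e.symm)).mp h
  · right; exact (Submodule.map_eq_bot_iff (e := e.symm)).mp h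

/-- A module is indecomposable as soon as every endomorphism is nilpotent or bijective. -/
lemma isIndecModule_of_end [Nontrivial N]
    (h : ∀ f : N →ₗ[R] N, f.comp f = f → f = 0 ∨ f = LinearMap.id) : IsIndecModule R N := by
  refine ⟨inferInstance, fun N₁ N₂ hc => ?_⟩
  have hid : (N₁.subtype.comp (N₁.projectionOnto N₂ hc)).comp
      (N₁.subtype.comp (N₁.projectionOnto N₂ hc)) =
      N₁.subtype.comp (N₁.projectionOnto N₂ hc) := by
    ext x; simp
  rcases h _ hid with h | h
  · left
    rw [eq_bot_iff]
    intro x hx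
    have := LinearMap.congr_fun h x
    simpa [Submodule.projectionOnto_apply_left hc ⟨x, hx⟩] using this
  · right
    rw [eq_bot_iff]
    intro x hx
    have := LinearMap.congr_fun h x
    simpa [Submodule.projectionOnto_apply_right hc ⟨x, hx⟩] using this.symm

lemma isRetract_of_isUnit (i : N →ₗ[R] M) (p : M →ₗ[R] N)
    (h : IsUnit (p.comp i : Module.End R N)) : IsRetract R N M := by
  obtain ⟨u, hu⟩ := h
  refine ⟨i, (↑u⁻¹ : Module.End R N).comp p, ?_⟩
  rw [LinearMap.comp_assoc, ← hu]
  exact Units.inv_mul u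

section Local

variable [IsNoetherian R N] [IsArtinian R N]

lemma IsIndecModule.isNilpotent_or_isUnit (h : IsIndecModule R N) (f : Module.End R N) :
    IsNilpotent f ∨ IsUnit f := by
  obtain ⟨k, hk⟩ := Filter.eventually_atTop.mp f.eventually_isCompl_ker_pow_range_pow
  rcases h.2 _ _ (hk (k + 1) (by omega)) with h | h
  · right
    rw [← isUnit_pow_iff (Nat.succ_ne_zero k), Module.End.isUnit_iff]
    exact IsArtinian.bijective_of_injective_endomorphism _ (LinearMap.ker_eq_bot.mp h)
  · left
    exact ⟨k + 1, LinearMap.range_eq_bot.mp h⟩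

lemma IsIndecModule.isUnit_or_isUnit (h : IsIndecModule R N) {f g : Module.End R N}
    (hu : IsUnit (f + g)) : IsUnit f ∨ IsUnit g := by
  obtain ⟨u, hu⟩ := hu
  have hs : (↑u⁻¹ : Module.End R N) * f + ↑u⁻¹ * g = 1 := by
    rw [← mul_add, ← hu, Units.inv_mul]
  rcases h.isNilpotent_or_isUnit ((↑u⁻¹ : Module.End R N) * f) with h | h
  · right
    have := h.isUnit_one_sub
    rw [← hs, add_sub_cancel_left] at this
    simpa using this
  · left
    simpa using h

lemma IsIndecModule.exists_isUnit {ι : Type} (h : IsIndecModule R N) (s : Finset ι)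
    (f : ι → Module.End R N) (hu : IsUnit (∑ i ∈ s, f i)) : ∃ i ∈ s, IsUnit (f i) := by
  classical
  have := h.1
  induction s using Finset.induction_on with
  | empty => simp at hu
  | insert a s ha ih =>
    rw [Finset.sum_insert ha] at hu
    rcases h.isUnit_or_isUnit hu with h | h
    · exact ⟨a, by simp, h⟩
    · obtain ⟨i, hi, h⟩ := ih h
      exact ⟨i, by simp [hi], h⟩

lemma IsIndecModule.isRetract_pi {ι : Type} [Fintype ι] {A : ι → Type}
    [∀ i, AddCommGroup (A i)] [∀ i, Module R (A i)] (h : IsIndecModule R N)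
    (hr : IsRetract R N (∀ i, A i)) : ∃ i, IsRetract R N (A i) := by
  classical
  obtain ⟨i, p, hip⟩ := hr
  have hsum : ∑ j, ((p.comp (LinearMap.single R A j)).comp ((LinearMap.proj j).comp i) :
      Module.End R N) = 1 := by
    ext x
    rw [LinearMap.sum_apply]
    simp only [LinearMap.comp_apply, LinearMap.proj_apply]
    rw [← map_sum]
    have : ∑ j, (LinearMap.single R A j) (i x j) = i x := by
      simpa using Finset.univ_sum_single (i x)
    rw [this]
    exact LinearMap.congr_fun hip x
  obtain ⟨j, -, hj⟩ := h.exists_isUnit Finset.univ _ (hsum ▸ isUnit_one)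
  exact ⟨j, isRetract_of_isUnit _ _ hj⟩

lemma IsIndecModule.isRetract_prod (h : IsIndecModule R N)
    (hr : IsRetract R N (M × L)) : IsRetract R N M ∨ IsRetract R N L := by
  obtain ⟨i, p, hip⟩ := hr
  have hsum : ((p.comp (LinearMap.inl R M L)).comp ((LinearMap.fst R M L).comp i) +
      (p.comp (LinearMap.inr R M L)).comp ((LinearMap.snd R M L).comp i) :
      Module.End R N) = 1 := by
    ext x
    have : ∀ y : M × L, p (y.1, 0) + p (0, y.2) = p y := fun y => by
      rw [← map_add]; simp
    simpa [this] using LinearMap.congr_fun hip x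
  rcases h.isUnit_or_isUnit (hsum ▸ isUnit_one) with h | h
  · exact Or.inl (isRetract_of_isUnit _ _ h)
  · exact Or.inr (isRetract_of_isUnit _ _ h)

end Local

lemma IsRetract.nonempty_equiv [Nontrivial N] (hM : IsIndecModule R M) (h : IsRetract R N M) :
    Nonempty (N ≃ₗ[R] M) := by
  obtain ⟨i, p, hip⟩ := h
  have hi : ∀ x, p (i x) = x := LinearMap.congr_fun hip
  have hinj : Function.Injective i := Function.LeftInverse.injective hi
  have hc : IsCompl (LinearMap.range i) (LinearMap.ker p) := by
    constructor
    · rw [Submodule.disjoint_def]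
      rintro _ ⟨y, rfl⟩ hy
      rw [LinearMap.mem_ker, hi] at hy
      simp [hy]
    · rw [codisjoint_iff, eq_top_iff]
      intro x _
      rw [Submodule.mem_sup]
      exact ⟨i (p x), ⟨_, rfl⟩, x - i (p x), by simp [hi], by simp⟩
  rcases hM.2 _ _ hc with h | h
  · rw [LinearMap.range_eq_bot] at h
    exfalso
    obtain ⟨x, y, hxy⟩ := exists_pair_ne N
    exact hxy (hinj (by simp [h]))
  · refine ⟨(LinearEquiv.ofBijective p ⟨LinearMap.ker_eq_bot.mp h, fun x => ⟨i x, hi x⟩⟩).symm⟩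

/-- The linear equivalence between a module and the product of the members of an internal
direct sum decomposition. -/
def internalEquiv {k : ℕ} {A : Fin k → Submodule R M} (h : DirectSum.IsInternal A) :
    M ≃ₗ[R] (∀ i, A i) :=
  (LinearEquiv.ofBijective (DirectSum.coeLinearMap A) h).symm.trans
    (DirectSum.linearEquivFunOnFintype R (Fin k) (fun i => A i))

/-- Transport of a product decomposition to an internal one. -/
lemma exists_internal_of_equiv {k : ℕ} {A : Fin k → Type} [∀ i, AddCommGroup (A i)]
    [∀ i, Module R (A i)] (e : M ≃ₗ[R] (∀ i, A i)) :
    ∃ B : Fin k → Submodule R M, DirectSum.IsInternal B ∧ ∀ i, Nonempty (A i ≃ₗ[R] B i) := by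
  let j : ∀ i, A i →ₗ[R] M := fun i => e.symm.toLinearMap.comp (LinearMap.single R A i)
  have hj : ∀ i, Function.Injective (j i) := fun i =>
    e.symm.injective.comp (Pi.single_injective i)
  refine ⟨fun i => LinearMap.range (j i), ?_, fun i => ⟨LinearEquiv.ofInjective (j i) (hj i)⟩⟩
  let g : (DirectSum (Fin k) fun i => LinearMap.range (j i)) ≃ₗ[R] M :=
    (DirectSum.linearEquivFunOnFintype R (Fin k) _).trans
      ((LinearEquiv.piCongrRight fun i => (LinearEquiv.ofInjective (j i) (hj i)).symm).trans e.symm)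
  have hg : (DirectSum.coeLinearMap fun i => LinearMap.range (j i)) = g.toLinearMap := by
    refine DirectSum.linearMap_ext _ fun i => ?_
    ext ⟨_, x, rfl⟩
    have h1 : (LinearEquiv.piCongrRight fun i => (LinearEquiv.ofInjective (j i) (hj i)).symm)
        (Pi.single i ⟨j i x, x, rfl⟩) = Pi.single i x := by
      funext l
      by_cases hl : l = i
      · subst hl
        simp only [LinearEquiv.piCongrRight_apply, Pi.single_eq_same]
        rw [LinearEquiv.symm_apply_eq]; rfl
      · simp [Pi.single_eq_of_ne hl]
    simp only [LinearMap.comp_apply, DirectSum.coeLinearMap_lof, LinearEquiv.coe_coe, g,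
      LinearEquiv.trans_apply, DirectSum.linearEquivFunOnFintype_lof, h1]
    rfl
  show Function.Bijective (DirectSum.coeLinearMap fun i => LinearMap.range (j i))
  rw [hg]
  exact g.bijective

/-- `M` is a direct sum of `k` pairwise nonisomorphic indecomposable submodules. -/
def HasBasicDecomp (R : Type) [Ring R] (M : Type) [AddCommGroup M] [Module R M] (k : ℕ) : Prop :=
  ∃ N : Fin k → Submodule R M,
    DirectSum.IsInternal N ∧ (∀ i, IsIndecModule R (N i)) ∧
    ∀ i j, i ≠ j → IsEmpty ((N i) ≃ₗ[R] (N j))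

lemma HasBasicDecomp.isBasic {M : ModuleCat.{0} R} {k : ℕ} (h : HasBasicDecomp R M k) :
    IsBasicModuleCat R M := ⟨k, h⟩

lemma HasBasicDecomp.count {M : ModuleCat.{0} R} {k : ℕ} (h : HasBasicDecomp R M k) :
    HasIndecClassCount R M k := by
  obtain ⟨N, h₁, h₂, h₃⟩ := h
  refine ⟨k, N, h₁, h₂, id, Function.surjective_id, fun i j => ⟨?_, ?_⟩⟩
  · rintro (rfl : i = j)
    exact ⟨LinearEquiv.refl _ _⟩
  · rintro ⟨e⟩
    by_contra hij
    exact (h₃ i j hij).false e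

lemma hasBasicDecomp_of_equiv {k : ℕ} {A : Fin k → Type} [∀ i, AddCommGroup (A i)]
    [∀ i, Module R (A i)] (e : M ≃ₗ[R] (∀ i, A i)) (hA : ∀ i, IsIndecModule R (A i))
    (hne : ∀ i j, i ≠ j → IsEmpty (A i ≃ₗ[R] A j)) : HasBasicDecomp R M k := by
  obtain ⟨B, hB, hi⟩ := exists_internal_of_equiv e
  refine ⟨B, hB, fun i => (hA i).of_equiv (hi i).some, fun i j hij => ⟨fun f => ?_⟩⟩
  exact (hne i j hij).false (((hi i).some.trans f).trans (hi j).some.symm)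

lemma hasBasicDecomp_zero [Subsingleton M] : HasBasicDecomp R M 0 :=
  hasBasicDecomp_of_equiv (A := fun _ : Fin 0 => PUnit)
    { toFun := fun _ => 0, invFun := fun _ => 0, map_add' := fun _ _ => by simp,
      map_smul' := fun _ _ => by simp, left_inv := fun _ => Subsingleton.elim _ _,
      right_inv := fun _ => Subsingleton.elim _ _ }
    (fun i => i.elim0) (fun i => i.elim0)

lemma hasBasicDecomp_one (h : IsIndecModule R M) : HasBasicDecomp R M 1 :=
  hasBasicDecomp_of_equiv (A := fun _ : Fin 1 => M) (LinearEquiv.funUnique (Fin 1) R M).symm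
    (fun _ => h) (fun i j hij => absurd (Subsingleton.elim i j) hij)

lemma hasBasicDecomp_two (e : M ≃ₗ[R] N × L) (hN : IsIndecModule R N) (hL : IsIndecModule R L)
    (hne : IsEmpty (N ≃ₗ[R] L)) : HasBasicDecomp R M 2 := by
  obtain ⟨B, hB, hi⟩ := exists_internal_of_equiv (k := 2) (M := N × L)
    (A := fun i => (![ModuleCat.of R N, ModuleCat.of R L] i : ModuleCat.{0} R))
    ({toFun := fun x => Fin.cons x.1 (Fin.cons x.2 finZeroElim)
      invFun := fun f => (f 0, f 1)
      map_add' := fun x y => by funext i; fin_cases i <;> rfl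
      map_smul' := fun x y => by funext i; fin_cases i <;> rfl
      left_inv := fun x => rfl
      right_inv := fun f => by funext i; fin_cases i <;> rfl } :
      (N × L) ≃ₗ[R] (∀ i, (![ModuleCat.of R N, ModuleCat.of R L] i : ModuleCat.{0} R)))
  refine hasBasicDecomp_of_equiv (e.trans (internalEquiv hB)) (fun i => ?_) (fun i j hij => ?_)
  · fin_cases i
    · exact hN.of_equiv (hi 0).some
    · exact hL.of_equiv (hi 1).some
  · refine ⟨fun f => ?_⟩
    fin_cases i <;> fin_cases j
    · exact hij rfl
    · exact hne.false (((hi 0).some.trans f).trans (hi 1).some.symm)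
    · exact hne.false (((hi 0).some.trans f.symm).trans (hi 1).some.symm)
    · exact hij rfl

lemma isRetract_of_internal {k : ℕ} {A : Fin k → Submodule R M} (h : DirectSum.IsInternal A)
    (i : Fin k) : IsRetract R (A i) M := by
  refine IsRetract.trans ⟨LinearMap.single R (fun i => A i) i, LinearMap.proj i, ?_⟩
    (IsRetract.of_equiv (internalEquiv h).symm)
  ext x
  simp

lemma exists_equiv_of_internal [IsNoetherian R M] [IsArtinian R M] {k l : ℕ}
    {A : Fin k → Submodule R M} {B : Fin l → Submodule R M} (hA : DirectSum.IsInternal A)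
    (hB : DirectSum.IsInternal B) (hA' : ∀ i, IsIndecModule R (A i))
    (hB' : ∀ i, IsIndecModule R (B i)) (i : Fin k) : ∃ j, Nonempty (A i ≃ₗ[R] B j) := by
  have hr : IsRetract R (A i) (∀ j, B j) :=
    (isRetract_of_internal hA i).trans (IsRetract.of_equiv (internalEquiv hB))
  obtain ⟨j, hj⟩ := (hA' i).isRetract_pi hr
  have := (hA' i).1
  exact ⟨j, hj.nonempty_equiv (hB' j)⟩

lemma HasBasicDecomp.count_unique {M : ModuleCat.{0} R} [IsNoetherian R M] [IsArtinian R M]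
    {k p : ℕ} (h : HasBasicDecomp R M k) (h' : HasIndecClassCount R M p) : k = p := by
  obtain ⟨A, hA, hA', hne⟩ := h
  obtain ⟨l, B, hB, hB', c, hc, hcc⟩ := h'
  choose f hf using exists_equiv_of_internal hA hB hA' hB'
  choose g hg using exists_equiv_of_internal hB hA hB' hA'
  have hbij : Function.Bijective (fun i => c (f i)) := by
    constructor
    · intro i j hij
      by_contra hne'
      exact (hne i j hne').false
        (((hf i).some.trans ((hcc _ _).mp hij).some).trans (hf j).some.symm)
    · intro z
      obtain ⟨j, rfl⟩ := hc z
      exact ⟨g j, (hcc _ _).mpr ⟨(hf (g j)).some.symm.trans (hg j).some.symm⟩⟩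
  simpa using Fintype.card_of_bijective hbij

end KrullSchmidt

end TwoPoint

namespace TwoPoint

/-! ### Deforming a linear equation with invertible solution -/

section Generic

open Polynomial

variable {K : Type} [Field K] {A : Type} [Ring A] [Algebra K A] [FiniteDimensional K A]

lemma exists_finset_isUnit_aux {n : ℕ} (f g : A →ₗ[K] (Fin n → K))
    (hf : Function.Surjective f) (h1 : f 1 = 0) :
    ∃ Z : Finset K, ∀ t ∉ Z, ∃ h : A, IsUnit h ∧ f h = t • g h := by
  classical
  obtain ⟨s, hs⟩ := f.exists_rightInverse_of_surjective (LinearMap.range_eq_top.mpr hf)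
  have hs' : ∀ y, f (s y) = y := LinearMap.congr_fun hs
  let B : Matrix (Fin n) (Fin n) K := LinearMap.toMatrix' (g.comp s)
  have hB : ∀ y, g (s y) = B.mulVec y := fun y => by
    simp [B, LinearMap.toMatrix'_mulVec]
  let P : Matrix (Fin n) (Fin n) K[X] := 1 - (X : K[X]) • B.map C
  have hP : ∀ t : K, (evalRingHom t).mapMatrix P = 1 - t • B := fun t => by
    ext i j
    by_cases hij : i = j <;> simp [P, hij] <;> exact mul_comm _ _
  let v : Fin n → K := g 1
  let y : Fin n → K[X] := fun i => X * (P.adjugate.mulVec (fun j => C (v j))) i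
  let yt : K → Fin n → K := fun t => t • ((1 - t • B).adjugate.mulVec v)
  have hy : ∀ t i, (y i).eval t = yt t i := fun t i => by
    have : (evalRingHom t).mapMatrix P.adjugate = (1 - t • B).adjugate := by
      rw [RingHom.map_adjugate, hP]
    simp only [y, yt, eval_mul, eval_X, Pi.smul_apply, smul_eq_mul, Matrix.mulVec, dotProduct,
      eval_finsetSum, eval_C, ← this, RingHom.mapMatrix_apply, Matrix.map_apply, coe_evalRingHom]
  let h : K → A := fun t => (1 - t • B).det • (1 : A) + s (yt t)
  let b := Module.finBasis K A
  let H : Matrix _ _ K[X] := P.det • 1 +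
    ∑ i, y i • (Algebra.leftMulMatrix b (s (Pi.single i 1))).map C
  have hdet : ∀ t, P.det.eval t = (1 - t • B).det := fun t => by
    rw [← hP, ← RingHom.map_det, coe_evalRingHom]
  have hH : ∀ t, (evalRingHom t).mapMatrix H = Algebra.leftMulMatrix b (h t) := fun t => by
    have : s (yt t) = ∑ i, yt t i • s (Pi.single i 1) := by
      conv_lhs => rw [pi_eq_sum_univ' (yt t)]
      rw [map_sum]
      refine Finset.sum_congr rfl fun i _ => ?_
      rw [map_smul]
    simp only [h, this, map_add, map_smul, map_sum, map_one, H]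
    congr 1
    · ext i j
      by_cases hij : i = j <;> simp [hij, hdet]
    · refine Finset.sum_congr rfl fun i _ => ?_
      ext k l
      simp [hy]
  have hHd : ∀ t, H.det.eval t = (Algebra.leftMulMatrix b (h t)).det := fun t => by
    rw [← hH, ← RingHom.map_det, coe_evalRingHom]
  have hne : H.det ≠ 0 := fun h0 => by
    have := hHd 0
    simp [h0, h, yt] at this
  refine ⟨H.det.roots.toFinset, fun t ht => ⟨h t, ?_, ?_⟩⟩
  · rw [Multiset.mem_toFinset, mem_roots hne, IsRoot.def, hHd] at ht
    have hu : IsUnit (Algebra.leftMulMatrix b (h t)) :=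
      (Matrix.isUnit_iff_isUnit_det _).mpr (Ne.isUnit ht)
    have hbij : Function.Surjective (LinearMap.mulLeft K (h t)) := by
      have : IsUnit (LinearMap.mulLeft K (h t)) := by
        have h2 := hu.map (LinearMap.toMatrixAlgEquiv b).symm
        have h3 : Algebra.leftMulMatrix b (h t) =
            LinearMap.toMatrixAlgEquiv b (LinearMap.mulLeft K (h t)) := rfl
        rwa [h3, AlgEquiv.symm_apply_apply] at h2
      exact ((Module.End.isUnit_iff _).mp this).2
    obtain ⟨z, hz⟩ := hbij 1
    have := IsArtinianRing.of_finite K A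
    exact IsUnit.of_mul_eq_one z hz
  · have e : (1 - t • B).mulVec (yt t) = t • ((1 - t • B).det • v) := by
      simp only [yt, Matrix.mulVec_smul, Matrix.mulVec_mulVec, Matrix.mul_adjugate,
        Matrix.smul_mulVec, Matrix.one_mulVec]
    rw [Matrix.sub_mulVec, Matrix.one_mulVec, Matrix.smul_mulVec, sub_eq_iff_eq_add] at e
    simp only [h, map_add, map_smul, h1, hs', hB, smul_zero, zero_add]
    rw [smul_add]
    exact e

lemma exists_finset_isUnit {F : Type} [AddCommGroup F] [Module K F] [FiniteDimensional K F]
    (f g : A →ₗ[K] F) (hf : Function.Surjective f) (h1 : f 1 = 0) :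
    ∃ Z : Finset K, ∀ t ∉ Z, ∃ h : A, IsUnit h ∧ f h = t • g h := by
  let e := (Module.finBasis K F).equivFun
  obtain ⟨Z, hZ⟩ := exists_finset_isUnit_aux (e.toLinearMap.comp f) (e.toLinearMap.comp g)
    (e.surjective.comp hf) (by simp [h1])
  refine ⟨Z, fun t ht => ?_⟩
  obtain ⟨h, hu, he⟩ := hZ t ht
  refine ⟨h, hu, e.injective ?_⟩
  simpa using he

end Generic

end TwoPoint

namespace TwoPoint

/-! ### Two-term complexes up to homotopy -/

namespace TwoTerm

section Homotopy

variable {Λ : Type} [Ring Λ] {T S T' S' U : TwoTerm Λ}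

/-- `Hom(T, S[1]) = 0` in the homotopy category. -/
def Orth (T S : TwoTerm Λ) : Prop :=
  ∀ w : T.P₁ →ₗ[Λᵐᵒᵖ] S.P₀, ∃ (h : T.P₀ →ₗ[Λᵐᵒᵖ] S.P₀) (h' : T.P₁ →ₗ[Λᵐᵒᵖ] S.P₁),
    w = h.comp T.d + S.d.comp h'

lemma HIso.refl (T : TwoTerm Λ) : HIso T T :=
  ⟨LinearMap.id, LinearMap.id, LinearMap.id, LinearMap.id, rfl, rfl,
    ⟨0, by ext; simp, by ext; simp⟩, ⟨0, by ext; simp, by ext; simp⟩⟩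

lemma HIso.symm (h : HIso T S) : HIso S T := by
  obtain ⟨u₁, u₀, v₁, v₀, a, b, c, d⟩ := h
  exact ⟨v₁, v₀, u₁, u₀, b, a, d, c⟩

lemma homotopy_comp {u₁ : T.P₁ →ₗ[Λᵐᵒᵖ] S.P₁} {u₀ : T.P₀ →ₗ[Λᵐᵒᵖ] S.P₀}
    {v₁ : S.P₁ →ₗ[Λᵐᵒᵖ] T.P₁} {v₀ : S.P₀ →ₗ[Λᵐᵒᵖ] T.P₀}
    {u₁' : S.P₁ →ₗ[Λᵐᵒᵖ] U.P₁} {u₀' : S.P₀ →ₗ[Λᵐᵒᵖ] U.P₀}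
    {v₁' : U.P₁ →ₗ[Λᵐᵒᵖ] S.P₁} {v₀' : U.P₀ →ₗ[Λᵐᵒᵖ] S.P₀}
    (hu : u₀.comp T.d = S.d.comp u₁) (hv : v₀.comp S.d = T.d.comp v₁)
    (h₁ : ∃ h : T.P₀ →ₗ[Λᵐᵒᵖ] T.P₁, (v₁.comp u₁) - LinearMap.id = h.comp T.d ∧
      (v₀.comp u₀) - LinearMap.id = T.d.comp h)
    (h₂ : ∃ h : S.P₀ →ₗ[Λᵐᵒᵖ] S.P₁, (v₁'.comp u₁') - LinearMap.id = h.comp S.d ∧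
      (v₀'.comp u₀') - LinearMap.id = S.d.comp h) :
    ∃ h : T.P₀ →ₗ[Λᵐᵒᵖ] T.P₁,
      ((v₁.comp v₁').comp (u₁'.comp u₁)) - LinearMap.id = h.comp T.d ∧
      ((v₀.comp v₀').comp (u₀'.comp u₀)) - LinearMap.id = T.d.comp h := by
  obtain ⟨h, h1, h0⟩ := h₁
  obtain ⟨k, k1, k0⟩ := h₂
  refine ⟨h + v₁.comp (k.comp u₀), ?_, ?_⟩
  · ext x
    have a := LinearMap.congr_fun h1 x
    have b := congrArg v₁ (LinearMap.congr_fun k1 (u₁ x))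
    have c := LinearMap.congr_fun hu x
    simp only [LinearMap.sub_apply, LinearMap.comp_apply, LinearMap.id_apply, map_sub,
      LinearMap.add_apply] at a b c ⊢
    rw [c, ← b, ← a]
    abel
  · ext x
    have a := LinearMap.congr_fun h0 x
    have b := congrArg v₀ (LinearMap.congr_fun k0 (u₀ x))
    have c := LinearMap.congr_fun hv (k (u₀ x))
    simp only [LinearMap.sub_apply, LinearMap.comp_apply, LinearMap.id_apply, map_sub, map_add,
      LinearMap.add_apply] at a b c ⊢
    rw [← c, ← b, ← a]
    abel

lemma HIso.trans (h : HIso T S) (h' : HIso S U) : HIso T U := by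
  obtain ⟨u₁, u₀, v₁, v₀, a, b, c, d⟩ := h
  obtain ⟨u₁', u₀', v₁', v₀', a', b', c', d'⟩ := h'
  refine ⟨u₁'.comp u₁, u₀'.comp u₀, v₁.comp v₁', v₀.comp v₀', ?_, ?_,
    homotopy_comp a b c c', homotopy_comp b' a' d' d⟩
  · rw [LinearMap.comp_assoc, a, ← LinearMap.comp_assoc, a', LinearMap.comp_assoc]
  · rw [LinearMap.comp_assoc, b', ← LinearMap.comp_assoc, b, LinearMap.comp_assoc]

lemma HIso.of_equiv (e₁ : T.P₁ ≃ₗ[Λᵐᵒᵖ] S.P₁) (e₀ : T.P₀ ≃ₗ[Λᵐᵒᵖ] S.P₀)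
    (h : ∀ x, e₀ (T.d x) = S.d (e₁ x)) : HIso T S := by
  refine ⟨e₁, e₀, e₁.symm, e₀.symm, LinearMap.ext h, LinearMap.ext fun x => ?_,
    ⟨0, by ext; simp, by ext; simp⟩, ⟨0, by ext; simp, by ext; simp⟩⟩
  apply e₀.injective
  simp [h]

lemma hIso_zero_iff : HIso T (zero Λ) ↔ Function.Bijective T.d := by
  constructor
  · rintro ⟨u₁, u₀, v₁, v₀, -, -, ⟨h, h1, h0⟩, -⟩
    have hv₁ : v₁ = 0 := LinearMap.ext fun x => by
      rw [Subsingleton.elim (α := PUnit) x 0]; exact map_zero v₁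
    have hv₀ : v₀ = 0 := LinearMap.ext fun x => by
      rw [Subsingleton.elim (α := PUnit) x 0]; exact map_zero v₀
    subst hv₁ hv₀
    constructor
    · rw [injective_iff_map_eq_zero]
      intro x hx
      have := LinearMap.congr_fun h1 x
      simpa [hx] using this
    · intro y
      refine ⟨-h y, ?_⟩
      have := LinearMap.congr_fun h0 y
      simp only [LinearMap.zero_comp, zero_sub, LinearMap.neg_apply, LinearMap.id_apply,
        LinearMap.comp_apply] at this
      rw [map_neg, ← this, neg_neg]
  · intro hb
    let e := LinearEquiv.ofBijective T.d hb
    refine ⟨0, 0, 0, 0, by ext; rfl, by simp, ⟨-e.symm.toLinearMap, ?_, ?_⟩, ⟨0, ?_, ?_⟩⟩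
    · ext x
      have : e.symm (T.d x) = x := e.symm_apply_apply x
      simp [this]
    · ext x
      have : T.d (e.symm x) = x := e.apply_symm_apply x
      simp [this]
    · exact LinearMap.ext fun _ => Subsingleton.elim (α := PUnit) _ _
    · exact LinearMap.ext fun _ => Subsingleton.elim (α := PUnit) _ _

lemma HIso.dsum_congr (h : HIso T T') (h' : HIso S S') : HIso (dsum T S) (dsum T' S') := by
  obtain ⟨u₁, u₀, v₁, v₀, a, b, ⟨c, c1, c0⟩, ⟨d, d1, d0⟩⟩ := h
  obtain ⟨u₁', u₀', v₁', v₀', a', b', ⟨c', c1', c0'⟩, ⟨d', d1', d0'⟩⟩ := h'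
  refine ⟨u₁.prodMap u₁', u₀.prodMap u₀', v₁.prodMap v₁', v₀.prodMap v₀', ?_, ?_,
    ⟨c.prodMap c', ?_, ?_⟩, ⟨d.prodMap d', ?_, ?_⟩⟩
  · exact LinearMap.ext fun x => Prod.ext (LinearMap.congr_fun a x.1) (LinearMap.congr_fun a' x.2)
  · exact LinearMap.ext fun x => Prod.ext (LinearMap.congr_fun b x.1) (LinearMap.congr_fun b' x.2)
  · exact LinearMap.ext fun x =>
      Prod.ext (LinearMap.congr_fun c1 x.1) (LinearMap.congr_fun c1' x.2)
  · exact LinearMap.ext fun x =>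
      Prod.ext (LinearMap.congr_fun c0 x.1) (LinearMap.congr_fun c0' x.2)
  · exact LinearMap.ext fun x =>
      Prod.ext (LinearMap.congr_fun d1 x.1) (LinearMap.congr_fun d1' x.2)
  · exact LinearMap.ext fun x =>
      Prod.ext (LinearMap.congr_fun d0 x.1) (LinearMap.congr_fun d0' x.2)

lemma dsum_comm (T S : TwoTerm Λ) : HIso (dsum T S) (dsum S T) :=
  HIso.of_equiv (LinearEquiv.prodComm Λᵐᵒᵖ T.P₁ S.P₁) (LinearEquiv.prodComm Λᵐᵒᵖ T.P₀ S.P₀)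
    fun _ => rfl

lemma dsum_zero (T : TwoTerm Λ) : HIso (dsum T (zero Λ)) T :=
  HIso.of_equiv (LinearEquiv.prodUnique : (T.P₁ × PUnit) ≃ₗ[Λᵐᵒᵖ] T.P₁)
    (LinearEquiv.prodUnique : (T.P₀ × PUnit) ≃ₗ[Λᵐᵒᵖ] T.P₀) fun _ => rfl

lemma zero_dsum (T : TwoTerm Λ) : HIso (dsum (zero Λ) T) T :=
  (dsum_comm _ _).trans (dsum_zero T)

lemma IsIndec.exists_mem_hIso (hT : IsIndec T) (l : List (TwoTerm Λ)) (h : HIso T (sumList l)) :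
    ∃ x ∈ l, HIso T x := by
  induction l with
  | nil => exact absurd h hT.1
  | cons x xs ih =>
    rcases hT.2 _ _ h with h' | h'
    · obtain ⟨y, hy, hy'⟩ := ih (h.trans ((h'.dsum_congr (HIso.refl _)).trans (zero_dsum _)))
      exact ⟨y, List.mem_cons_of_mem _ hy, hy'⟩
    · exact ⟨x, List.mem_cons_self, h.trans (((HIso.refl _).dsum_congr h').trans (dsum_zero _))⟩

lemma Orth.congr_left (hi : HIso T T') (h : Orth T S) : Orth T' S := by
  obtain ⟨u₁, u₀, v₁, v₀, -, b, -, ⟨k, k1, k0⟩⟩ := hi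
  intro w
  obtain ⟨g, g', hg⟩ := h (w.comp u₁)
  refine ⟨g.comp v₀ - w.comp k, g'.comp v₁, ?_⟩
  ext x
  have h1 := LinearMap.congr_fun hg (v₁ x)
  have h2 := congrArg w (LinearMap.congr_fun k1 x)
  have h3 := LinearMap.congr_fun b x
  simp only [LinearMap.sub_apply, LinearMap.comp_apply, LinearMap.id_apply, map_sub,
    LinearMap.add_apply] at h1 h2 h3 ⊢
  rw [h3, ← h2, h1]
  abel

lemma Orth.congr_right (hi : HIso S S') (h : Orth T S) : Orth T S' := by
  obtain ⟨u₁, u₀, v₁, v₀, a, -, -, ⟨k, k1, k0⟩⟩ := hi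
  intro w
  obtain ⟨g, g', hg⟩ := h (v₀.comp w)
  refine ⟨u₀.comp g, u₁.comp g' - k.comp w, ?_⟩
  ext x
  have h1 := congrArg u₀ (LinearMap.congr_fun hg x)
  have h2 := LinearMap.congr_fun k0 (w x)
  have h3 := LinearMap.congr_fun a (g' x)
  simp only [LinearMap.sub_apply, LinearMap.comp_apply, LinearMap.id_apply, map_sub, map_add,
    LinearMap.add_apply] at h1 h2 h3 ⊢
  rw [← h3, ← h2, h1]
  abel

lemma orth_dsum_left_iff : Orth (dsum T T') S ↔ ∀ w : (T.P₁ × T'.P₁) →ₗ[Λᵐᵒᵖ] S.P₀,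
    ∃ (h : (T.P₀ × T'.P₀) →ₗ[Λᵐᵒᵖ] S.P₀) (h' : (T.P₁ × T'.P₁) →ₗ[Λᵐᵒᵖ] S.P₁),
      w = h.comp (T.d.prodMap T'.d) + S.d.comp h' := Iff.rfl

lemma orth_dsum_left : Orth (dsum T T') S ↔ Orth T S ∧ Orth T' S := by
  rw [orth_dsum_left_iff]
  constructor
  · intro h
    constructor
    · intro w
      obtain ⟨g, g', hg⟩ := h (w.comp (LinearMap.fst _ _ _))
      refine ⟨g.comp (LinearMap.inl _ _ _), g'.comp (LinearMap.inl _ _ _), ?_⟩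
      ext x
      simpa using LinearMap.congr_fun hg (x, 0)
    · intro w
      obtain ⟨g, g', hg⟩ := h (w.comp (LinearMap.snd _ _ _))
      refine ⟨g.comp (LinearMap.inr _ _ _), g'.comp (LinearMap.inr _ _ _), ?_⟩
      ext x
      simpa using LinearMap.congr_fun hg (0, x)
  · rintro ⟨h₁, h₂⟩ w
    obtain ⟨g, g', hg⟩ := h₁ (w.comp (LinearMap.inl _ _ _))
    obtain ⟨k, k', hk⟩ := h₂ (w.comp (LinearMap.inr _ _ _))
    refine ⟨g.coprod k, g'.coprod k', LinearMap.prod_ext ?_ ?_⟩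
    · rw [hg]
      ext x
      simp
    · rw [hk]
      ext x
      simp

lemma orth_dsum_right : Orth T (dsum S S') ↔ Orth T S ∧ Orth T S' := by
  constructor
  · intro h
    constructor
    · intro w
      obtain ⟨g, g', hg⟩ := h ((LinearMap.inl _ _ _).comp w)
      refine ⟨(LinearMap.fst _ _ _).comp g, (LinearMap.fst _ _ _).comp g', ?_⟩
      ext x
      exact congrArg Prod.fst (LinearMap.congr_fun hg x)
    · intro w
      obtain ⟨g, g', hg⟩ := h ((LinearMap.inr _ _ _).comp w)
      refine ⟨(LinearMap.snd _ _ _).comp g, (LinearMap.snd _ _ _).comp g', ?_⟩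
      ext x
      exact congrArg Prod.snd (LinearMap.congr_fun hg x)
  · rintro ⟨h₁, h₂⟩ w
    obtain ⟨g, g', hg⟩ := h₁ ((LinearMap.fst _ _ _).comp w)
    obtain ⟨k, k', hk⟩ := h₂ ((LinearMap.snd _ _ _).comp w)
    refine ⟨g.prod k, g'.prod k', ?_⟩
    exact LinearMap.ext fun x => Prod.ext (LinearMap.congr_fun hg x) (LinearMap.congr_fun hk x)

lemma orth_of_subsingleton_left (h : Subsingleton T.P₁) : Orth T S := fun w =>
  ⟨0, 0, LinearMap.ext fun x => by rw [Subsingleton.elim x 0]; simp⟩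

lemma orth_of_subsingleton_right (h : Subsingleton S.P₀) : Orth T S := fun _ =>
  ⟨0, 0, LinearMap.ext fun _ => Subsingleton.elim _ _⟩

lemma orth_sumList_left {l : List (TwoTerm Λ)} : Orth (sumList l) S ↔ ∀ x ∈ l, Orth x S := by
  induction l with
  | nil => simpa using orth_of_subsingleton_left (inferInstanceAs (Subsingleton PUnit))
  | cons x xs ih => simp [sumList, orth_dsum_left, ih]

lemma orth_sumList_right {l : List (TwoTerm Λ)} : Orth T (sumList l) ↔ ∀ x ∈ l, Orth T x := by
  induction l with
  | nil => simpa using orth_of_subsingleton_right (inferInstanceAs (Subsingleton PUnit))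
  | cons x xs ih => simp [sumList, orth_dsum_right, ih]

lemma isPresilting_iff : IsPresilting T ↔ Orth T T := Iff.rfl

/-- The cokernel of a two-term complex. -/
def ck (T : TwoTerm Λ) : RMod Λ := ModuleCat.of Λᵐᵒᵖ (T.P₀ ⧸ LinearMap.range T.d)

/-- The projection to the cokernel. -/
def toCk (T : TwoTerm Λ) : T.P₀ →ₗ[Λᵐᵒᵖ] ck T := (LinearMap.range T.d).mkQ

lemma toCk_surjective (T : TwoTerm Λ) : Function.Surjective (toCk T) :=
  Submodule.mkQ_surjective _

lemma ker_toCk (T : TwoTerm Λ) : LinearMap.ker (toCk T) = LinearMap.range T.d :=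
  Submodule.ker_mkQ _

lemma toCk_eq_zero {x : T.P₀} : toCk T x = 0 ↔ ∃ y, T.d y = x := by
  rw [← LinearMap.mem_ker, ker_toCk, LinearMap.mem_range]

@[simp] lemma toCk_d (x : T.P₁) : toCk T (T.d x) = 0 := toCk_eq_zero.mpr ⟨x, rfl⟩

/-- The map on cokernels induced by a chain map. -/
def ckMap (u₁ : T.P₁ →ₗ[Λᵐᵒᵖ] S.P₁) (u₀ : T.P₀ →ₗ[Λᵐᵒᵖ] S.P₀)
    (h : u₀.comp T.d = S.d.comp u₁) : ck T →ₗ[Λᵐᵒᵖ] ck S :=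
  (LinearMap.range T.d).liftQ ((toCk S).comp u₀) (by
    rintro _ ⟨x, rfl⟩
    have := LinearMap.congr_fun h x
    simp only [LinearMap.comp_apply] at this
    simp [this])

lemma ckMap_toCk (u₁ : T.P₁ →ₗ[Λᵐᵒᵖ] S.P₁) (u₀ : T.P₀ →ₗ[Λᵐᵒᵖ] S.P₀)
    (h : u₀.comp T.d = S.d.comp u₁) (x : T.P₀) : ckMap u₁ u₀ h (toCk T x) = toCk S (u₀ x) := rfl

lemma ckMap_surjective (u₁ : T.P₁ →ₗ[Λᵐᵒᵖ] S.P₁) (u₀ : T.P₀ →ₗ[Λᵐᵒᵖ] S.P₀)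
    (h : u₀.comp T.d = S.d.comp u₁) (hs : Function.Surjective u₀) :
    Function.Surjective (ckMap u₁ u₀ h) := by
  intro y
  obtain ⟨y, rfl⟩ := toCk_surjective S y
  obtain ⟨x, rfl⟩ := hs y
  exact ⟨toCk T x, rfl⟩

lemma HIso.ck_equiv (h : HIso T S) : Nonempty (ck T ≃ₗ[Λᵐᵒᵖ] ck S) := by
  obtain ⟨u₁, u₀, v₁, v₀, a, b, ⟨k, k1, k0⟩, ⟨l, l1, l0⟩⟩ := h
  refine ⟨LinearEquiv.ofLinearMap (ckMap u₁ u₀ a) (ckMap v₁ v₀ b) ?_ ?_⟩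
  · refine LinearMap.ext fun x => ?_
    obtain ⟨x, rfl⟩ := toCk_surjective _ x
    have := congrArg (toCk S) (LinearMap.congr_fun l0 x)
    simp only [LinearMap.sub_apply, LinearMap.comp_apply, LinearMap.id_apply, map_sub, toCk_d,
      sub_eq_zero] at this
    simpa [ckMap_toCk] using this
  · refine LinearMap.ext fun x => ?_
    obtain ⟨x, rfl⟩ := toCk_surjective _ x
    have := congrArg (toCk T) (LinearMap.congr_fun k0 x)
    simp only [LinearMap.sub_apply, LinearMap.comp_apply, LinearMap.id_apply, map_sub, toCk_d,
      sub_eq_zero] at this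
    simpa [ckMap_toCk] using this

/-- The cokernel of a direct sum. -/
def ckDsum (T S : TwoTerm Λ) : ck (dsum T S) ≃ₗ[Λᵐᵒᵖ] ck T × ck S :=
  LinearEquiv.ofBijective
    ((ckMap (T := dsum T S) (S := T) (LinearMap.fst _ _ _) (LinearMap.fst _ _ _) rfl).prod
      (ckMap (T := dsum T S) (S := S) (LinearMap.snd _ _ _) (LinearMap.snd _ _ _) rfl)) (by
    constructor
    · rw [injective_iff_map_eq_zero]
      intro x hx
      obtain ⟨⟨x, y⟩, rfl⟩ := toCk_surjective _ x
      have h1 : toCk T x = 0 := congrArg Prod.fst hx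
      have h2 : toCk S y = 0 := congrArg Prod.snd hx
      obtain ⟨x', rfl⟩ := toCk_eq_zero.mp h1
      obtain ⟨y', rfl⟩ := toCk_eq_zero.mp h2
      exact toCk_eq_zero.mpr ⟨(x', y'), rfl⟩
    · rintro ⟨x, y⟩
      obtain ⟨x, rfl⟩ := toCk_surjective _ x
      obtain ⟨y, rfl⟩ := toCk_surjective _ y
      exact ⟨toCk (dsum T S) (x, y), rfl⟩)

lemma orth_iff_ck (hT : IsProj T) : Orth T S ↔
    ∀ f : T.P₁ →ₗ[Λᵐᵒᵖ] ck S, ∃ g : T.P₀ →ₗ[Λᵐᵒᵖ] ck S, f = g.comp T.d := by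
  have p1 := hT.2.1
  have p0 := hT.2.2.2
  constructor
  · intro h f
    obtain ⟨w, hw⟩ := Module.projective_lifting_property (toCk S) f (toCk_surjective S)
    obtain ⟨g, g', hg⟩ := h w
    refine ⟨(toCk S).comp g, ?_⟩
    rw [← hw, hg]
    ext x
    simp
  · intro h w
    obtain ⟨g, hg⟩ := h ((toCk S).comp w)
    obtain ⟨k, hk⟩ := Module.projective_lifting_property (toCk S) g (toCk_surjective S)
    have hr : ∀ x, (w - k.comp T.d) x ∈ LinearMap.range S.d := by
      intro x
      rw [← ker_toCk, LinearMap.mem_ker]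
      have h1 := LinearMap.congr_fun hg x
      have h2 := LinearMap.congr_fun hk (T.d x)
      simp only [LinearMap.comp_apply] at h1 h2
      simp [h1, h2]
    obtain ⟨l, hl⟩ := Module.projective_lifting_property S.d.rangeRestrict
      ((w - k.comp T.d).codRestrict _ hr) S.d.surjective_rangeRestrict
    refine ⟨k, l, ?_⟩
    ext x
    have := congrArg Subtype.val (LinearMap.congr_fun hl x)
    change S.d (l x) = w x - k (T.d x) at this
    simp [this]

end Homotopy

end TwoTerm

end TwoPoint

namespace TwoPoint

/-! ### Dimension counts for spaces of homotopies -/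

section Dimension

variable {K A : Type} [Field K] [Ring A] [Algebra K A]
  {X₁ X₀ Y₁ Y₀ : Type}
  [AddCommGroup X₁] [Module A X₁] [Module K X₁] [IsScalarTower K A X₁]
  [AddCommGroup X₀] [Module A X₀] [Module K X₀] [IsScalarTower K A X₀]
  [AddCommGroup Y₁] [Module A Y₁] [Module K Y₁] [IsScalarTower K A Y₁]
  [AddCommGroup Y₀] [Module A Y₀] [Module K Y₀] [IsScalarTower K A Y₀]

lemma finite_hom [Module.Finite K X₁] [Module.Finite K Y₁] :
    Module.Finite K (X₁ →ₗ[A] Y₁) :=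
  Module.Finite.of_injective (LinearMap.restrictScalarsₗ K A X₁ Y₁ K)
    (LinearMap.restrictScalars_injective K)

/-- The null-homotopic maps, as the image of a linear map. -/
def homotopyMap (K : Type) {A : Type} [Field K] [Ring A] [Algebra K A]
    {X₁ X₀ Y₁ Y₀ : Type}
    [AddCommGroup X₁] [Module A X₁]
    [AddCommGroup X₀] [Module A X₀]
    [AddCommGroup Y₁] [Module A Y₁] [Module K Y₁] [IsScalarTower K A Y₁]
    [AddCommGroup Y₀] [Module A Y₀] [Module K Y₀] [IsScalarTower K A Y₀]
    (d : X₁ →ₗ[A] X₀) (d' : Y₁ →ₗ[A] Y₀) :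
    ((X₁ →ₗ[A] Y₁) × (X₀ →ₗ[A] Y₀)) →ₗ[K] (X₁ →ₗ[A] Y₀) where
  toFun h := h.2.comp d - d'.comp h.1
  map_add' h k := by
    ext x
    simp only [Prod.fst_add, Prod.snd_add, LinearMap.sub_apply, LinearMap.comp_apply,
      LinearMap.add_apply, map_add]
    abel
  map_smul' c h := by
    ext x
    have : d' (c • h.1 x) = c • d' (h.1 x) := d'.map_smul_of_tower c (h.1 x)
    simp [this, smul_sub]

omit [Module K X₁] [IsScalarTower K A X₁] [Module K X₀] [IsScalarTower K A X₀] in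
lemma homotopyMap_surjective {d : X₁ →ₗ[A] X₀} {d' : Y₁ →ₗ[A] Y₀}
    (h : ∀ w : X₁ →ₗ[A] Y₀, ∃ (g : X₀ →ₗ[A] Y₀) (g' : X₁ →ₗ[A] Y₁), w = g.comp d + d'.comp g') :
    Function.Surjective (homotopyMap K d d') := fun w => by
  obtain ⟨g, g', rfl⟩ := h w
  refine ⟨(-g', g), ?_⟩
  ext x
  simp [homotopyMap]

lemma finrank_hom_le [Module.Finite K X₁] [Module.Finite K X₀] [Module.Finite K Y₁]
    [Module.Finite K Y₀] {d : X₁ →ₗ[A] X₀} {d' : Y₁ →ₗ[A] Y₀}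
    (h : ∀ w : X₁ →ₗ[A] Y₀, ∃ (g : X₀ →ₗ[A] Y₀) (g' : X₁ →ₗ[A] Y₁), w = g.comp d + d'.comp g') :
    Module.finrank K (X₁ →ₗ[A] Y₀) ≤
      Module.finrank K (X₁ →ₗ[A] Y₁) + Module.finrank K (X₀ →ₗ[A] Y₀) := by
  have := finite_hom (K := K) (A := A) (X₁ := X₁) (Y₁ := Y₁)
  have := finite_hom (K := K) (A := A) (X₁ := X₀) (Y₁ := Y₀)
  rw [← Module.finrank_prod]
  exact LinearMap.finrank_le_finrank_of_surjective (homotopyMap_surjective h)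

lemma exists_equiv_line [Module.Finite K X₁] [Module.Finite K X₀] {d : X₁ →ₗ[A] X₀}
    (h : ∀ w : X₁ →ₗ[A] X₀, ∃ (g : X₀ →ₗ[A] X₀) (g' : X₁ →ₗ[A] X₁), w = g.comp d + d.comp g')
    (v : X₁ →ₗ[A] X₀) :
    ∃ Z : Finset K, ∀ t ∉ Z, ∃ (e₁ : X₁ ≃ₗ[A] X₁) (e₀ : X₀ ≃ₗ[A] X₀),
      ∀ x, e₀ (d x) = (d + t • v) (e₁ x) := by
  have : Module.Finite K (Module.End A X₁) := finite_hom (K := K) (A := A) (X₁ := X₁) (Y₁ := X₁)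
  have : Module.Finite K (Module.End A X₀) := finite_hom (K := K) (A := A) (X₁ := X₀) (Y₁ := X₀)
  have := finite_hom (K := K) (A := A) (X₁ := X₁) (Y₁ := X₀)
  let f : (Module.End A X₁ × Module.End A X₀) →ₗ[K] (X₁ →ₗ[A] X₀) := homotopyMap K d d
  let g : (Module.End A X₁ × Module.End A X₀) →ₗ[K] (X₁ →ₗ[A] X₀) := -homotopyMap K 0 v
  obtain ⟨Z, hZ⟩ := exists_finset_isUnit f g (homotopyMap_surjective h) (by
    ext x; simp [f, homotopyMap])
  refine ⟨Z, fun t ht => ?_⟩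
  obtain ⟨p, hp, hfg⟩ := hZ t ht
  rw [Prod.isUnit_iff, Module.End.isUnit_iff, Module.End.isUnit_iff] at hp
  refine ⟨LinearEquiv.ofBijective p.1 hp.1, LinearEquiv.ofBijective p.2 hp.2, fun x => ?_⟩
  have := LinearMap.congr_fun hfg x
  simp only [f, g, homotopyMap, LinearMap.coe_mk, AddHom.coe_mk, LinearMap.sub_apply,
    LinearMap.comp_apply, LinearMap.neg_apply, LinearMap.smul_apply, LinearMap.zero_apply,
    map_zero, zero_sub, neg_neg, sub_eq_iff_eq_add] at this
  simp [this, add_comm]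

/-- Two presilting differentials between the same modules are conjugate. -/
lemma exists_equiv_of_presilting [Infinite K] [Module.Finite K X₁] [Module.Finite K X₀]
    {d d' : X₁ →ₗ[A] X₀}
    (h : ∀ w : X₁ →ₗ[A] X₀, ∃ (g : X₀ →ₗ[A] X₀) (g' : X₁ →ₗ[A] X₁), w = g.comp d + d.comp g')
    (h' : ∀ w : X₁ →ₗ[A] X₀, ∃ (g : X₀ →ₗ[A] X₀) (g' : X₁ →ₗ[A] X₁), w = g.comp d' + d'.comp g') :
    ∃ (e₁ : X₁ ≃ₗ[A] X₁) (e₀ : X₀ ≃ₗ[A] X₀), ∀ x, e₀ (d x) = d' (e₁ x) := by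
  classical
  obtain ⟨Z, hZ⟩ := exists_equiv_line (K := K) h (d' - d)
  obtain ⟨Z', hZ'⟩ := exists_equiv_line (K := K) h' (d - d')
  obtain ⟨t, ht⟩ := Infinite.exists_notMem_finset (Z ∪ Z'.image fun s => 1 - s)
  rw [Finset.mem_union, not_or] at ht
  obtain ⟨e₁, e₀, he⟩ := hZ t ht.1
  obtain ⟨f₁, f₀, hf⟩ := hZ' (1 - t) fun hm =>
    ht.2 (Finset.mem_image.mpr ⟨1 - t, hm, by ring⟩)
  have hl : d + t • (d' - d) = d' + (1 - t) • (d - d') := by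
    ext x
    simp only [LinearMap.add_apply, LinearMap.smul_apply, LinearMap.sub_apply]
    module
  refine ⟨e₁.trans f₁.symm, e₀.trans f₀.symm, fun x => ?_⟩
  rw [LinearEquiv.trans_apply, he, hl, LinearEquiv.symm_apply_eq, hf]
  simp

end Dimension

end TwoPoint

namespace TwoPoint

/-! ### Pairs of indecomposable projectives with the Hom spaces of `Γ₂` -/

/-- Projective modules `P`, `Q` over `A` with `A ≅ P ⊕ Q`, `End P = K`, `Hom(P, Q) = 0`,
`End Q = K[ψ]/(ψ³)` and `Hom(Q, P) = φ · End Q` free over `End Q`. -/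
structure Frame (K A P Q : Type) [Field K] [Ring A] [Algebra K A]
    [AddCommGroup P] [Module A P] [Module K P] [IsScalarTower K A P]
    [AddCommGroup Q] [Module A Q] [Module K Q] [IsScalarTower K A Q] where
  φ : Q →ₗ[A] P
  ψ : Module.End A Q
  psi_cube : ψ ^ 3 = 0
  nontrivial_P : Nontrivial P
  endP : ∀ f : P →ₗ[A] P, ∃ c : K, f = c • LinearMap.id
  homPQ : ∀ f : P →ₗ[A] Q, f = 0
  homQP : ∀ f : Q →ₗ[A] P, ∃ c : Fin 3 → K, f = φ.comp (c 0 • 1 + c 1 • ψ + c 2 • ψ ^ 2)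
  homQQ : ∀ f : Module.End A Q, ∃ c : Fin 3 → K, f = c 0 • 1 + c 1 • ψ + c 2 • ψ ^ 2
  inj : ∀ c : Fin 3 → K, φ.comp (c 0 • 1 + c 1 • ψ + c 2 • ψ ^ 2) = 0 → c = 0
  reg : Nonempty (A ≃ₗ[A] P × Q)

/-- The module `P^a ⊕ Q^b`. -/
abbrev Std (P Q : Type) (a b : ℕ) : Type := (Fin a → P) × (Fin b → Q)

/-- `X ≅ P^a ⊕ Q^b`. -/
def HasMult (A P Q : Type) [Ring A] [AddCommGroup P] [Module A P] [AddCommGroup Q] [Module A Q]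
    (X : Type) [AddCommGroup X] [Module A X] (a b : ℕ) : Prop :=
  Nonempty (X ≃ₗ[A] Std P Q a b)

section HomDim

variable {K A : Type} [Field K] [Ring A] [Algebra K A]
  {X Y Z : Type}
  [AddCommGroup X] [Module A X] [Module K X] [IsScalarTower K A X] [Module.Finite K X]
  [AddCommGroup Y] [Module A Y] [Module K Y] [IsScalarTower K A Y] [Module.Finite K Y]
  [AddCommGroup Z] [Module A Z] [Module K Z] [IsScalarTower K A Z] [Module.Finite K Z]

/-- The dimension of a space of homomorphisms. -/
def homDim (K A X Y : Type) [Field K] [Ring A] [Algebra K A]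
    [AddCommGroup X] [Module A X]
    [AddCommGroup Y] [Module A Y] [Module K Y] [IsScalarTower K A Y] : ℕ :=
  Module.finrank K (X →ₗ[A] Y)

variable (K A X Y Z)

lemma homDim_prod_left : homDim K A (X × Y) Z = homDim K A X Z + homDim K A Y Z := by
  have := finite_hom (K := K) (A := A) (X₁ := X) (Y₁ := Z)
  have := finite_hom (K := K) (A := A) (X₁ := Y) (Y₁ := Z)
  unfold homDim
  rw [← Module.finrank_prod]
  exact (LinearMap.coprodEquiv K).symm.finrank_eq

lemma homDim_prod_right : homDim K A X (Y × Z) = homDim K A X Y + homDim K A X Z := by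
  have := finite_hom (K := K) (A := A) (X₁ := X) (Y₁ := Y)
  have := finite_hom (K := K) (A := A) (X₁ := X) (Y₁ := Z)
  unfold homDim
  rw [← Module.finrank_prod]
  exact (LinearMap.prodEquiv K).symm.finrank_eq

lemma homDim_pi_left (n : ℕ) : homDim K A (Fin n → X) Y = n * homDim K A X Y := by
  have := finite_hom (K := K) (A := A) (X₁ := X) (Y₁ := Y)
  have h := (LinearMap.lsum A (fun _ : Fin n => X) (M := Y) K).finrank_eq
  rw [Module.finrank_pi_fintype] at h
  simpa [homDim] using h.symm

lemma homDim_pi_right (n : ℕ) : homDim K A X (Fin n → Y) = n * homDim K A X Y := by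
  have := finite_hom (K := K) (A := A) (X₁ := X) (Y₁ := Y)
  let e : (Fin n → X →ₗ[A] Y) ≃ₗ[K] (X →ₗ[A] (Fin n → Y)) :=
    { toFun := fun f => LinearMap.pi f
      invFun := fun f i => (LinearMap.proj i).comp f
      map_add' := fun _ _ => rfl
      map_smul' := fun _ _ => rfl
      left_inv := fun _ => rfl
      right_inv := fun _ => rfl }
  have h := e.finrank_eq
  rw [Module.finrank_pi_fintype] at h
  simpa [homDim] using h.symm

end HomDim

section Mult

variable {A P Q : Type} [Ring A]
  [AddCommGroup P] [Module A P] [AddCommGroup Q] [Module A Q]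
  {X Y : Type} [AddCommGroup X] [Module A X] [AddCommGroup Y] [Module A Y]

lemma HasMult.of_equiv {a b : ℕ} (e : X ≃ₗ[A] Y) (h : HasMult A P Q Y a b) :
    HasMult A P Q X a b := ⟨e.trans h.some⟩

lemma HasMult.nonempty_equiv {a b : ℕ} (h : HasMult A P Q X a b) (h' : HasMult A P Q Y a b) :
    Nonempty (X ≃ₗ[A] Y) := ⟨h.some.trans h'.some.symm⟩

lemma hasMult_of_subsingleton [Subsingleton X] : HasMult A P Q X 0 0 :=
  ⟨{ toFun := fun _ => 0, invFun := fun _ => 0, map_add' := fun _ _ => by simp,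
     map_smul' := fun _ _ => by simp, left_inv := fun _ => Subsingleton.elim _ _,
     right_inv := fun _ => Subsingleton.elim _ _ }⟩

lemma HasMult.subsingleton (h : HasMult A P Q X 0 0) : Subsingleton X :=
  h.some.toEquiv.subsingleton

lemma hasMult_P : HasMult A P Q P 1 0 :=
  ⟨(LinearEquiv.funUnique (Fin 1) A P).symm.trans LinearEquiv.prodUnique.symm⟩

lemma hasMult_Q : HasMult A P Q Q 0 1 :=
  ⟨(LinearEquiv.funUnique (Fin 1) A Q).symm.trans LinearEquiv.uniqueProd.symm⟩

lemma hasMult_piP (a : ℕ) : HasMult A P Q (Fin a → P) a 0 := ⟨LinearEquiv.prodUnique.symm⟩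

lemma hasMult_piQ (b : ℕ) : HasMult A P Q (Fin b → Q) 0 b := ⟨LinearEquiv.uniqueProd.symm⟩

/-- Concatenation of tuples. -/
def finAppendEquiv (A M : Type) [Ring A] [AddCommGroup M] [Module A M] (m n : ℕ) :
    ((Fin m → M) × (Fin n → M)) ≃ₗ[A] (Fin (m + n) → M) :=
  (LinearEquiv.sumArrowLequivProdArrow (Fin m) (Fin n) A M).symm.trans
    (LinearEquiv.funCongrLeft A M finSumFinEquiv.symm)

lemma HasMult.prod {a b c d : ℕ} (h : HasMult A P Q X a b) (h' : HasMult A P Q Y c d) :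
    HasMult A P Q (X × Y) (a + c) (b + d) :=
  ⟨(h.some.prodCongr h'.some).trans ((LinearEquiv.prodProdProdComm A _ _ _ _).trans
    ((finAppendEquiv A P a c).prodCongr (finAppendEquiv A Q b d)))⟩

end Mult

namespace Frame

variable {K A P Q : Type} [Field K] [Ring A] [Algebra K A]
    [AddCommGroup P] [Module A P] [Module K P] [IsScalarTower K A P]
    [AddCommGroup Q] [Module A Q] [Module K Q] [IsScalarTower K A Q]
    (F : Frame K A P Q)

/-- The endomorphism of `Q` with coefficients `c`. -/
def q (c : Fin 3 → K) : Module.End A Q := c 0 • 1 + c 1 • F.ψ + c 2 • F.ψ ^ 2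

/-- Multiplication of truncated polynomials. -/
def mulc (c g : Fin 3 → K) : Fin 3 → K :=
  ![c 0 * g 0, c 0 * g 1 + c 1 * g 0, c 0 * g 2 + c 1 * g 1 + c 2 * g 0]

lemma q_mul (c g : Fin 3 → K) : F.q c * F.q g = F.q (mulc c g) := by
  have h3 := F.psi_cube
  have h4 : F.ψ ^ 4 = 0 := by rw [pow_succ, h3, zero_mul]
  have e1 : F.ψ * F.ψ = F.ψ ^ 2 := (sq _).symm
  have e2 : F.ψ * F.ψ ^ 2 = 0 := by rw [← pow_succ', h3]
  have e3 : F.ψ ^ 2 * F.ψ = 0 := by rw [← pow_succ, h3]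
  have e4 : F.ψ ^ 2 * F.ψ ^ 2 = 0 := by rw [← pow_add, h4]
  simp only [q, mulc, mul_add, add_mul, smul_mul_assoc, mul_smul_comm, one_mul, mul_one, e1, e2,
    e3, e4, smul_zero, Matrix.cons_val_zero, Matrix.cons_val_one, Matrix.cons_val]
  module

lemma q_add (c g : Fin 3 → K) : F.q (c + g) = F.q c + F.q g := by
  simp only [q, Pi.add_apply, add_smul]; abel

lemma q_smul (t : K) (c : Fin 3 → K) : F.q (t • c) = t • F.q c := by
  simp only [q, Pi.smul_apply, smul_eq_mul, mul_smul, smul_add]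

/-- Coordinates on `Hom(Q, P)`. -/
def qpEquiv : (Fin 3 → K) ≃ₗ[K] (Q →ₗ[A] P) :=
  LinearEquiv.ofBijective
    { toFun := fun c => F.φ.comp (F.q c)
      map_add' := fun c g => by rw [q_add, LinearMap.comp_add]
      map_smul' := fun t c => by
        rw [q_smul]; ext x
        exact F.φ.map_smul_of_tower t (F.q c x) } (by
    constructor
    · rw [injective_iff_map_eq_zero]
      exact fun c hc => F.inj c hc
    · intro f
      obtain ⟨c, rfl⟩ := F.homQP f
      exact ⟨c, rfl⟩)

/-- Coordinates on `End Q`. -/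
def qqEquiv : (Fin 3 → K) ≃ₗ[K] (Q →ₗ[A] Q) :=
  LinearEquiv.ofBijective
    { toFun := fun c => F.q c
      map_add' := fun c g => F.q_add c g
      map_smul' := fun t c => F.q_smul t c } (by
    constructor
    · rw [injective_iff_map_eq_zero]
      intro c hc
      apply F.inj
      change F.φ.comp (F.q c) = 0
      change F.q c = 0 at hc
      rw [hc, LinearMap.comp_zero]
    · intro f
      obtain ⟨c, rfl⟩ := F.homQQ f
      exact ⟨c, rfl⟩)

include F

lemma homDim_QP : homDim K A Q P = 3 := by
  simpa [homDim] using F.qpEquiv.finrank_eq.symm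

lemma homDim_QQ : homDim K A Q Q = 3 := by
  simpa [homDim] using F.qqEquiv.finrank_eq.symm

lemma homDim_PQ : homDim K A P Q = 0 := by
  have : Subsingleton (P →ₗ[A] Q) := ⟨fun f g => by rw [F.homPQ f, F.homPQ g]⟩
  exact Module.finrank_zero_of_subsingleton

lemma homDim_PP : homDim K A P P = 1 := by
  have := F.nontrivial_P
  have : Nontrivial (P →ₗ[A] P) := inferInstanceAs (Nontrivial (Module.End A P))
  refine finrank_eq_one (LinearMap.id : P →ₗ[A] P) one_ne_zero fun f => ?_
  obtain ⟨c, rfl⟩ := F.endP f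
  exact ⟨c, rfl⟩

variable [Module.Finite K P] [Module.Finite K Q]

lemma homDim_std (a b c d : ℕ) :
    homDim K A (Std P Q a b) (Std P Q c d) = a * c + 3 * b * c + 3 * b * d := by
  rw [homDim_prod_left, homDim_prod_right, homDim_prod_right]
  simp only [homDim_pi_left, homDim_pi_right, F.homDim_PP, F.homDim_PQ, F.homDim_QP, F.homDim_QQ]
  ring

lemma mult_unique {X : Type} [AddCommGroup X] [Module A X] {a b c d : ℕ}
    (h : HasMult A P Q X a b) (h' : HasMult A P Q X c d) : a = c ∧ b = d := by
  have e : Std P Q a b ≃ₗ[A] Std P Q c d := h.some.symm.trans h'.some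
  have key : ∀ m n : ℕ, homDim K A (Std P Q a b) (Std P Q m n) =
      homDim K A (Std P Q c d) (Std P Q m n) := fun m n =>
    LinearEquiv.finrank_eq
      { toFun := fun f => f.comp e.symm.toLinearMap
        invFun := fun f => f.comp e.toLinearMap
        map_add' := fun _ _ => rfl
        map_smul' := fun _ _ => rfl
        left_inv := fun f => by ext x <;> simp
        right_inv := fun f => by ext x <;> simp }
  have h1 := key 1 0
  have h2 := key 0 1
  rw [F.homDim_std, F.homDim_std] at h1 h2
  omega

/-- The dimension inequality forced by the vanishing of `Hom(X, Y[1])`. -/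
lemma mult_le {X₁ X₀ Y₁ Y₀ : Type} [AddCommGroup X₁] [Module A X₁] [AddCommGroup X₀] [Module A X₀]
    [AddCommGroup Y₁] [Module A Y₁] [AddCommGroup Y₀] [Module A Y₀]
    {d : X₁ →ₗ[A] X₀} {d' : Y₁ →ₗ[A] Y₀} {a₁ b₁ a₀ b₀ a₁' b₁' a₀' b₀' : ℕ}
    (hX₁ : HasMult A P Q X₁ a₁ b₁) (hX₀ : HasMult A P Q X₀ a₀ b₀)
    (hY₁ : HasMult A P Q Y₁ a₁' b₁') (hY₀ : HasMult A P Q Y₀ a₀' b₀')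
    (h : ∀ w : X₁ →ₗ[A] Y₀, ∃ (g : X₀ →ₗ[A] Y₀) (g' : X₁ →ₗ[A] Y₁), w = g.comp d + d'.comp g') :
    a₁ * a₀' + 3 * b₁ * a₀' + 3 * b₁ * b₀' ≤
      (a₁ * a₁' + 3 * b₁ * a₁' + 3 * b₁ * b₁') + (a₀ * a₀' + 3 * b₀ * a₀' + 3 * b₀ * b₀') := by
  obtain ⟨x₁⟩ := hX₁
  obtain ⟨x₀⟩ := hX₀
  obtain ⟨y₁⟩ := hY₁
  obtain ⟨y₀⟩ := hY₀
  have := finrank_hom_le (K := K) (A := A)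
    (d := (x₀.toLinearMap.comp d).comp x₁.symm.toLinearMap)
    (d' := (y₀.toLinearMap.comp d').comp y₁.symm.toLinearMap) (fun w => by
      obtain ⟨g, g', hg⟩ := h ((y₀.symm.toLinearMap.comp w).comp x₁.toLinearMap)
      refine ⟨(y₀.toLinearMap.comp g).comp x₀.symm.toLinearMap,
        (y₁.toLinearMap.comp g').comp x₁.symm.toLinearMap, LinearMap.ext fun x => ?_⟩
      have := congrArg y₀ (LinearMap.congr_fun hg (x₁.symm x))
      simpa using this)
  change homDim K A _ _ ≤ homDim K A _ _ + homDim K A _ _ at this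
  rwa [F.homDim_std, F.homDim_std, F.homDim_std] at this

end Frame

end TwoPoint

namespace TwoPoint

namespace Frame

variable {K A P Q : Type} [Field K] [Ring A] [Algebra K A]
    [AddCommGroup P] [Module A P] [Module K P] [IsScalarTower K A P]
    [AddCommGroup Q] [Module A Q] [Module K Q] [IsScalarTower K A Q]
    (F : Frame K A P Q)

include F

lemma isNilpotent_psi : IsNilpotent F.ψ := ⟨3, F.psi_cube⟩

lemma nontrivial_Q : Nontrivial Q := by
  by_contra h
  rw [not_nontrivial_iff_subsingleton] at h
  have := F.inj (fun _ => 1) (LinearMap.ext fun x => by rw [Subsingleton.elim x 0]; simp)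
  exact one_ne_zero (congrFun this 0)

lemma isIndecModule_P : IsIndecModule A P := by
  have := F.nontrivial_P
  refine isIndecModule_of_end fun f hf => ?_
  obtain ⟨c, rfl⟩ := F.endP f
  obtain ⟨x, hx⟩ := exists_ne (0 : P)
  have h := LinearMap.congr_fun hf x
  simp only [LinearMap.comp_apply, LinearMap.smul_apply, LinearMap.id_apply] at h
  rw [smul_smul, ← sub_eq_zero, ← sub_smul, smul_eq_zero] at h
  rcases h with h | h
  · have h' : c * (c - 1) = 0 := by linear_combination h
    rcases mul_eq_zero.mp h' with h' | h'
    · left; rw [h', zero_smul]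
    · right; rw [sub_eq_zero.mp h', one_smul]
  · exact absurd h hx

lemma q_isUnit_or_isNilpotent (f : Module.End A Q) : IsUnit f ∨ IsNilpotent f := by
  obtain ⟨c, rfl⟩ := F.homQQ f
  have hc : Commute (c 1 • (1 : Module.End A Q)) (F.ψ) :=
    (Commute.one_left _).smul_left _
  have hn : IsNilpotent (c 1 • F.ψ + c 2 • F.ψ ^ 2) := by
    have : c 1 • F.ψ + c 2 • F.ψ ^ 2 = F.ψ * (c 1 • 1 + c 2 • F.ψ) := by
      simp [mul_add, sq]
    rw [this]
    refine Commute.isNilpotent_mul_right ?_ F.isNilpotent_psi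
    exact ((Commute.one_right _).smul_right _).add_right ((Commute.refl _).smul_right _)
  by_cases h0 : c 0 = 0
  · right; rwa [h0, zero_smul, zero_add]
  · left
    rw [add_assoc]
    have hu : IsUnit (c 0 • (1 : Module.End A Q)) := by
      refine ⟨⟨c 0 • 1, (c 0)⁻¹ • 1, ?_, ?_⟩, rfl⟩ <;> simp [h0]
    exact hn.isUnit_add_left_of_commute hu
      (((Commute.one_right _).smul_right _))

lemma isIndecModule_Q : IsIndecModule A Q := by
  have := F.nontrivial_Q
  refine isIndecModule_of_end fun f hf => ?_
  have hf' : IsIdempotentElem (f : Module.End A Q) := hf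
  rcases F.q_isUnit_or_isNilpotent f with h | h
  · right
    exact (h.mul_left_cancel (hf'.eq.trans (mul_one _).symm))
  · left
    obtain ⟨n, hn⟩ := h
    rcases n with _ | n
    · rw [pow_zero] at hn
      exact absurd hn one_ne_zero
    · rwa [hf'.pow_succ_eq] at hn

variable [Module.Finite K P] [Module.Finite K Q]

lemma finite_reg : Module.Finite K A :=
  Module.Finite.equiv (F.reg.some.restrictScalars K).symm

lemma exists_mult_aux (n : ℕ) : ∀ (X : Type) [AddCommGroup X] [Module A X] [Module K X]
    [IsScalarTower K A X] [Module.Finite K X] [Module.Projective A X],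
    Module.finrank K X ≤ n → ∃ a b, HasMult A P Q X a b := by
  have := F.finite_reg
  induction n with
  | zero =>
    intro X _ _ _ _ _ _ hX
    have : Subsingleton X := Module.finrank_zero_iff.mp (Nat.le_zero.mp hX)
    exact ⟨0, 0, hasMult_of_subsingleton⟩
  | succ n ih =>
    intro X _ _ _ _ _ _ hX
    rcases subsingleton_or_nontrivial X with h | h
    · exact ⟨0, 0, hasMult_of_subsingleton⟩
    by_cases hi : IsIndecModule A X
    · have hN : IsNoetherian A X := isNoetherian_of_tower K inferInstance
      have hA : IsArtinian A X := isArtinian_of_tower K inferInstance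
      obtain ⟨m, f, hf⟩ := Module.Finite.exists_fin' A X
      obtain ⟨g, hg⟩ := Module.projective_lifting_property f LinearMap.id hf
      obtain ⟨-, hr⟩ := hi.isRetract_pi ⟨g, f, hg⟩
      rcases hi.isRetract_prod (hr.trans (IsRetract.of_equiv F.reg.some)) with hr | hr
      · exact ⟨1, 0, hasMult_P.of_equiv (hr.nonempty_equiv F.isIndecModule_P).some⟩
      · exact ⟨0, 1, hasMult_Q.of_equiv (hr.nonempty_equiv F.isIndecModule_Q).some⟩
    · simp only [IsIndecModule, not_and, not_forall, not_or] at hi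
      obtain ⟨N₁, N₂, hc, h1, h2⟩ := hi h
      let e := Submodule.prodEquivOfIsCompl N₁ N₂ hc
      have hp : Module.Projective A (N₁ × N₂) := Module.Projective.of_equiv e.symm
      have p1 : Module.Projective A N₁ :=
        Module.Projective.of_split (LinearMap.inl A N₁ N₂) (LinearMap.fst A N₁ N₂) rfl
      have p2 : Module.Projective A N₂ :=
        Module.Projective.of_split (LinearMap.inr A N₁ N₂) (LinearMap.snd A N₁ N₂) rfl
      have f1 : Module.Finite K N₁ :=
        Module.Finite.of_injective (N₁.subtype.restrictScalars K) N₁.injective_subtype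
      have f2 : Module.Finite K N₂ :=
        Module.Finite.of_injective (N₂.subtype.restrictScalars K) N₂.injective_subtype
      have hd := (e.restrictScalars K).finrank_eq
      rw [Module.finrank_prod] at hd
      have := (Submodule.nontrivial_iff_ne_bot).mpr h1
      have := (Submodule.nontrivial_iff_ne_bot).mpr h2
      have q1 : 0 < Module.finrank K N₁ := Module.finrank_pos
      have q2 : 0 < Module.finrank K N₂ := Module.finrank_pos
      obtain ⟨a, b, hab⟩ := ih N₁ (by omega)
      obtain ⟨c, d, hcd⟩ := ih N₂ (by omega)
      exact ⟨a + c, b + d, (hab.prod hcd).of_equiv e.symm⟩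

lemma exists_mult (X : Type) [AddCommGroup X] [Module A X] [Module.Finite A X]
    [Module.Projective A X] : ∃ a b, HasMult A P Q X a b := by
  have := F.finite_reg
  let : Module K X := Module.compHom X (algebraMap K A)
  have : IsScalarTower K A X := ⟨fun k a x => by
    rw [Algebra.smul_def, mul_smul]; rfl⟩
  have : Module.Finite K X := Module.Finite.trans A X
  exact F.exists_mult_aux _ X le_rfl

end Frame

end TwoPoint

namespace TwoPoint

namespace Frame

open TwoTerm

variable {K Λ P Q : Type} [Field K] [Ring Λ] [Algebra K Λ]
    [AddCommGroup P] [Module Λᵐᵒᵖ P] [Module K P] [IsScalarTower K Λᵐᵒᵖ P]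
    [AddCommGroup Q] [Module Λᵐᵒᵖ Q] [Module K Q] [IsScalarTower K Λᵐᵒᵖ Q]
    (F : Frame K Λᵐᵒᵖ P Q)

/-- The complex `Q^b → P^a` with a given matrix of coefficients. -/
def cx {a b : ℕ} (c : Fin b → Fin a → Fin 3 → K) : TwoTerm Λ where
  P₁ := ModuleCat.of Λᵐᵒᵖ (Fin b → Q)
  P₀ := ModuleCat.of Λᵐᵒᵖ (Fin a → P)
  d := LinearMap.pi fun i => ∑ j, (F.qpEquiv (c j i)).comp (LinearMap.proj j)

lemma cx_d_apply {a b : ℕ} (c : Fin b → Fin a → Fin 3 → K) (x : Fin b → Q) (i : Fin a) :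
    ((F.cx c).d x : Fin a → P) i = ∑ j, F.qpEquiv (c j i) (x j) := by
  change (∑ j, (F.qpEquiv (c j i)).comp (LinearMap.proj j)) x = _
  rw [LinearMap.sum_apply]
  rfl

lemma cx_d_single {a b : ℕ} (c : Fin b → Fin a → Fin 3 → K) (j : Fin b) (x : Q) (i : Fin a) :
    ((F.cx c).d (Pi.single j x : Fin b → Q) : Fin a → P) i = F.qpEquiv (c j i) x := by
  rw [cx_d_apply, Finset.sum_eq_single j]
  · rw [Pi.single_eq_same]
  · intro l _ hl
    rw [Pi.single_eq_of_ne hl, map_zero]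
  · simp

lemma qpEquiv_q (c g : Fin 3 → K) (x : Q) :
    F.qpEquiv c (F.q g x) = F.qpEquiv (mulc c g) x := by
  change F.φ ((F.q c * F.q g) x) = F.φ (F.q (mulc c g) x)
  rw [q_mul]

/-- A coefficientwise criterion for the vanishing of `Hom(T, S[1])`. -/
lemma orth_cx {a b a' b' : ℕ} {c : Fin b → Fin a → Fin 3 → K} {c' : Fin b' → Fin a' → Fin 3 → K}
    (h : ∀ W : Fin b → Fin a' → Fin 3 → K, ∃ (H : Fin a → Fin a' → K)
      (G : Fin b → Fin b' → Fin 3 → K), ∀ j i,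
        W j i = ∑ l, H l i • c j l + ∑ l, mulc (c' l i) (G j l)) :
    Orth (F.cx c) (F.cx c') := by
  intro w
  let w' : (Fin b → Q) →ₗ[Λᵐᵒᵖ] (Fin a' → P) := w
  obtain ⟨H, G, hHG⟩ := h fun j i =>
    F.qpEquiv.symm ((LinearMap.proj i).comp (w'.comp (LinearMap.single Λᵐᵒᵖ (fun _ => Q) j)))
  let g : (Fin a → P) →ₗ[Λᵐᵒᵖ] (Fin a' → P) :=
    LinearMap.pi fun i => ∑ l, H l i • LinearMap.proj l
  let g' : (Fin b → Q) →ₗ[Λᵐᵒᵖ] (Fin b' → Q) :=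
    LinearMap.pi fun l => ∑ j, (F.q (G j l)).comp (LinearMap.proj j)
  refine ⟨g, g', ?_⟩
  let D : (Fin b → Q) →ₗ[Λᵐᵒᵖ] (Fin a → P) := (F.cx c).d
  let D' : (Fin b' → Q) →ₗ[Λᵐᵒᵖ] (Fin a' → P) := (F.cx c').d
  change w' = g.comp D + D'.comp g'
  refine LinearMap.pi_ext fun j x => funext fun i => ?_
  have hW : w' (Pi.single j x) i =
      F.qpEquiv (∑ l, H l i • c j l + ∑ l, mulc (c' l i) (G j l)) x := by
    rw [← hHG, LinearEquiv.apply_symm_apply]; rfl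
  have hgy : ∀ y, g y i = ∑ l, H l i • y l := by
    intro y
    change (∑ l, H l i • (LinearMap.proj l : (Fin a → P) →ₗ[Λᵐᵒᵖ] P)) y = _
    rw [LinearMap.sum_apply]
    rfl
  have hg : g (D (Pi.single j x)) i = ∑ l, H l i • F.qpEquiv (c j l) x := by
    rw [hgy]
    exact Finset.sum_congr rfl fun l _ => congrArg (H l i • ·) (F.cx_d_single c j x l)
  have hD' : ∀ y, D' y i = ∑ l, F.qpEquiv (c' l i) (y l) := fun y => F.cx_d_apply c' y i
  have hg' : ∀ l, g' (Pi.single j x) l = F.q (G j l) x := by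
    intro l
    change (∑ j, (F.q (G j l)).comp (LinearMap.proj j)) (Pi.single j x) = _
    rw [LinearMap.sum_apply, Finset.sum_eq_single j]
    · simp
    · intro k _ hk
      simp [Pi.single_eq_of_ne hk]
    · simp
  rw [hW]
  change _ = g (D (Pi.single j x)) i + D' (g' (Pi.single j x)) i
  rw [hg, hD', map_add, map_sum, map_sum, LinearMap.add_apply, LinearMap.sum_apply,
    LinearMap.sum_apply]
  congr 1
  · refine Finset.sum_congr rfl fun l _ => ?_
    rw [map_smul]; rfl
  · refine Finset.sum_congr rfl fun l _ => ?_
    rw [hg', qpEquiv_q]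

/-- Coefficient matrix of the ray at position `2` of the silting fan. -/
def coef2 (K : Type) [Field K] : Fin 1 → Fin 3 → Fin 3 → K :=
  ![![![1, 0, 0], ![0, 1, 0], ![0, 0, 1]]]

/-- Coefficient matrix of the ray at position `3`. -/
def coef3 (K : Type) [Field K] : Fin 1 → Fin 2 → Fin 3 → K :=
  ![![![1, 0, 0], ![0, 1, 0]]]

/-- Coefficient matrix of the ray at position `4`. -/
def coef4 (K : Type) [Field K] : Fin 2 → Fin 3 → Fin 3 → K :=
  ![![![1, 0, 0], ![0, 0, 0], ![0, 1, 0]], ![![0, 0, 0], ![1, 0, 0], ![0, 0, 1]]]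

/-- Coefficient matrix of the ray at position `5`. -/
def coef5 (K : Type) [Field K] : Fin 1 → Fin 1 → Fin 3 → K :=
  ![![![1, 0, 0]]]

lemma orth_coef2_left {a' b' : ℕ} (c' : Fin b' → Fin a' → Fin 3 → K) :
    Orth (F.cx (coef2 K)) (F.cx c') := by
  refine F.orth_cx fun W => ⟨fun l i => W 0 i l, 0, fun j i => ?_⟩
  obtain rfl := Subsingleton.elim j 0
  funext k
  fin_cases k <;> simp [coef2, mulc, Fin.sum_univ_succ]

lemma orth_coef5_right {a b : ℕ} (c : Fin b → Fin a → Fin 3 → K) :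
    Orth (F.cx c) (F.cx (coef5 K)) := by
  refine F.orth_cx fun W => ⟨0, fun j _ => W j 0, fun j i => ?_⟩
  obtain rfl := Subsingleton.elim i 0
  funext k
  fin_cases k <;> simp [coef5, mulc]

lemma orth_coef3_coef2 : Orth (F.cx (coef3 K)) (F.cx (coef2 K)) := by
  refine F.orth_cx fun W => ⟨![![W 0 0 0 - W 0 2 2, W 0 1 0, W 0 2 0],
    ![W 0 0 1 - W 0 1 2, W 0 1 1 - W 0 2 2, W 0 2 1]],
    ![![![W 0 2 2, W 0 1 2, W 0 0 2]]], fun j i => ?_⟩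
  funext k
  fin_cases j; fin_cases i <;> fin_cases k <;> simp [coef2, coef3, mulc, Fin.sum_univ_succ]

lemma orth_coef3_coef3 : Orth (F.cx (coef3 K)) (F.cx (coef3 K)) := by
  refine F.orth_cx fun W => ⟨![![W 0 0 0, W 0 1 0], ![W 0 0 1 - W 0 1 2, W 0 1 1]],
    ![![![0, W 0 1 2, W 0 0 2]]], fun j i => ?_⟩
  funext k
  fin_cases j; fin_cases i <;> fin_cases k <;> simp [coef3, mulc, Fin.sum_univ_succ]

lemma orth_coef3_coef4 : Orth (F.cx (coef3 K)) (F.cx (coef4 K)) := by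
  refine F.orth_cx fun W => ⟨![![W 0 0 0, W 0 1 0 - W 0 2 2, W 0 2 0],
    ![W 0 0 1, W 0 1 1, W 0 2 1]],
    ![![![0, 0, W 0 0 2], ![W 0 2 2, 0, W 0 1 2]]], fun j i => ?_⟩
  funext k
  fin_cases j; fin_cases i <;> fin_cases k <;> simp [coef3, coef4, mulc, Fin.sum_univ_succ]

lemma orth_coef4_coef3 : Orth (F.cx (coef4 K)) (F.cx (coef3 K)) := by
  refine F.orth_cx fun W =>
    ⟨![![W 0 0 0 - (W 0 1 1 - (W 1 1 2 - W 1 0 1)), W 0 1 0],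
      ![W 1 0 0 - W 1 1 1, W 1 1 0],
      ![W 0 0 1 - W 0 1 2, W 1 1 2 - W 1 0 1]],
    ![![![W 0 1 1 - (W 1 1 2 - W 1 0 1), W 0 1 2, W 0 0 2]],
      ![![W 1 1 1, W 1 0 1, W 1 0 2 - (W 0 0 1 - W 0 1 2)]]], fun j i => ?_⟩
  funext k
  fin_cases j <;> fin_cases i <;> fin_cases k <;> simp [coef3, coef4, mulc, Fin.sum_univ_succ]

lemma orth_coef4_coef4 : Orth (F.cx (coef4 K)) (F.cx (coef4 K)) := by
  refine F.orth_cx fun W =>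
    ⟨![![W 0 0 0 - W 0 2 1, W 0 1 0 - (W 0 2 2 - W 0 0 1), W 0 2 0],
      ![W 1 0 0 - W 1 2 1, W 1 1 0 - (W 1 2 2 - W 1 0 1), W 1 2 0], ![0, 0, 0]],
    fun j => ![![W j 2 1, W j 0 1, W j 0 2], ![W j 2 2 - W j 0 1, W j 1 1, W j 1 2]],
    fun j i => ?_⟩
  funext k
  fin_cases j <;> fin_cases i <;> fin_cases k <;> simp [coef4, mulc, Fin.sum_univ_succ]

lemma orth_coef5_coef4 : Orth (F.cx (coef5 K)) (F.cx (coef4 K)) := by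
  refine F.orth_cx fun W =>
    ⟨![![W 0 0 0 - W 0 2 1, W 0 1 0 - (W 0 2 2 - W 0 0 1), W 0 2 0]],
    fun j => ![![W j 2 1, W j 0 1, W j 0 2], ![W j 2 2 - W j 0 1, W j 1 1, W j 1 2]],
    fun j i => ?_⟩
  funext k
  fin_cases j; fin_cases i <;> fin_cases k <;> simp [coef4, coef5, mulc, Fin.sum_univ_succ]

/-- The indecomposable two-term presilting complexes, in cyclic order. -/
def ray : Fin 8 → TwoTerm Λ
  | 0 => ⟨ModuleCat.of _ (Fin 0 → Q), ModuleCat.of _ Q, 0⟩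
  | 1 => F.cx (a := 1) (b := 0) 0
  | 2 => F.cx (coef2 K)
  | 3 => F.cx (coef3 K)
  | 4 => F.cx (coef4 K)
  | 5 => F.cx (coef5 K)
  | 6 => F.cx (a := 0) (b := 1) 0
  | 7 => ⟨ModuleCat.of _ P, ModuleCat.of _ (Fin 0 → P), 0⟩

/-- Multiplicities of `P` in degree `-1` of the rays. -/
def rp₁ : Fin 8 → ℕ := ![0, 0, 0, 0, 0, 0, 0, 1]
/-- Multiplicities of `Q` in degree `-1` of the rays. -/
def rq₁ : Fin 8 → ℕ := ![0, 0, 1, 1, 2, 1, 1, 0]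
/-- Multiplicities of `P` in degree `0` of the rays. -/
def rp₀ : Fin 8 → ℕ := ![0, 1, 3, 2, 3, 1, 0, 0]
/-- Multiplicities of `Q` in degree `0` of the rays. -/
def rq₀ : Fin 8 → ℕ := ![1, 0, 0, 0, 0, 0, 0, 0]

lemma hasMult_ray₁ (i : Fin 8) : HasMult Λᵐᵒᵖ P Q (F.ray i).P₁ (rp₁ i) (rq₁ i) := by
  fin_cases i
  exacts [hasMult_piQ 0, hasMult_piQ 0, hasMult_piQ 1, hasMult_piQ 1, hasMult_piQ 2, hasMult_piQ 1,
    hasMult_piQ 1, hasMult_P]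

lemma hasMult_ray₀ (i : Fin 8) : HasMult Λᵐᵒᵖ P Q (F.ray i).P₀ (rp₀ i) (rq₀ i) := by
  fin_cases i
  exacts [hasMult_Q, hasMult_piP 1, hasMult_piP 3, hasMult_piP 2, hasMult_piP 3, hasMult_piP 1,
    hasMult_piP 0, hasMult_piP 0]

/-- Adjacency in the cyclic order. -/
abbrev Adj (i j : Fin 8) : Prop := i = j ∨ j = i + 1 ∨ i = j + 1

lemma orth_ray {i j : Fin 8} (h : Adj i j) : Orth (F.ray i) (F.ray j) := by
  have h70 : Orth (F.ray 7) (F.ray 0) := fun w =>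
    ⟨0, 0, (F.homPQ w).trans (by rw [LinearMap.zero_comp, LinearMap.comp_zero, add_zero]; rfl)⟩
  have l0 : ∀ S, Orth (F.ray 0) S := fun S =>
    orth_of_subsingleton_left (inferInstanceAs (Subsingleton (Fin 0 → Q)))
  have l1 : ∀ S, Orth (F.ray 1) S := fun S =>
    orth_of_subsingleton_left (inferInstanceAs (Subsingleton (Fin 0 → Q)))
  have r6 : ∀ S, Orth S (F.ray 6) := fun S =>
    orth_of_subsingleton_right (inferInstanceAs (Subsingleton (Fin 0 → P)))
  have r7 : ∀ S, Orth S (F.ray 7) := fun S =>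
    orth_of_subsingleton_right (inferInstanceAs (Subsingleton (Fin 0 → P)))
  fin_cases i <;> fin_cases j <;> first
    | exact absurd h (by decide)
    | exact l0 _
    | exact l1 _
    | exact r6 _
    | exact r7 _
    | exact h70
    | exact F.orth_coef2_left _
    | exact F.orth_coef5_right _
    | exact F.orth_coef3_coef2
    | exact F.orth_coef3_coef3
    | exact F.orth_coef3_coef4
    | exact F.orth_coef4_coef3
    | exact F.orth_coef4_coef4
    | exact F.orth_coef5_coef4

/-- The numerical obstruction to `Hom(T, S[1]) = 0`, for rays. -/
abbrev Fail (i j : Fin 8) : Prop :=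
  (rp₁ i * rp₁ j + 3 * rq₁ i * rp₁ j + 3 * rq₁ i * rq₁ j) +
    (rp₀ i * rp₀ j + 3 * rq₀ i * rp₀ j + 3 * rq₀ i * rq₀ j) <
  rp₁ i * rp₀ j + 3 * rq₁ i * rp₀ j + 3 * rq₁ i * rq₀ j

lemma adj_of_not_fail : ∀ i j : Fin 8, ¬ Fail i j → ¬ Fail j i → Adj i j := by decide

section

variable [Module.Finite K P] [Module.Finite K Q]

lemma not_fail_of_orth {i j : Fin 8} (h : Orth (F.ray i) (F.ray j)) : ¬ Fail i j :=
  not_lt.mpr (F.mult_le (F.hasMult_ray₁ i) (F.hasMult_ray₀ i) (F.hasMult_ray₁ j)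
    (F.hasMult_ray₀ j) h)

lemma adj_of_orth {i j : Fin 8} (h : Orth (F.ray i) (F.ray j)) (h' : Orth (F.ray j) (F.ray i)) :
    Adj i j :=
  adj_of_not_fail i j (F.not_fail_of_orth h) (F.not_fail_of_orth h')

end

end Frame

end TwoPoint

namespace TwoPoint

namespace TwoTerm

variable {Λ : Type} [Ring Λ]

lemma orth_of_bijective_left {T S : TwoTerm Λ} (h : Function.Bijective T.d) : Orth T S :=
  (orth_of_subsingleton_left (inferInstanceAs (Subsingleton PUnit))).congr_left
    (hIso_zero_iff.mpr h).symm

lemma orth_of_bijective_right {T S : TwoTerm Λ} (h : Function.Bijective S.d) : Orth T S :=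
  (orth_of_subsingleton_right (inferInstanceAs (Subsingleton PUnit))).congr_right
    (hIso_zero_iff.mpr h).symm

lemma bijective_d_dsum {T S : TwoTerm Λ} (h : Function.Bijective T.d)
    (h' : Function.Bijective S.d) : Function.Bijective (dsum T S).d :=
  h.prodMap h'

lemma sumList_append (l l' : List (TwoTerm Λ)) :
    HIso (sumList (l ++ l')) (dsum (sumList l) (sumList l')) := by
  induction l with
  | nil => exact (zero_dsum _).symm
  | cons x xs ih =>
    exact ((HIso.refl x).dsum_congr ih).trans
      (HIso.of_equiv (T := dsum x (dsum (sumList xs) (sumList l')))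
        (S := dsum (dsum x (sumList xs)) (sumList l'))
        (LinearEquiv.prodAssoc Λᵐᵒᵖ x.P₁ (sumList xs).P₁ (sumList l').P₁).symm
        (LinearEquiv.prodAssoc Λᵐᵒᵖ x.P₀ (sumList xs).P₀ (sumList l').P₀).symm fun _ => rfl)

/-- A contractible complex. -/
def cone (M : RMod Λ) : TwoTerm Λ := ⟨M, M, LinearMap.id⟩

lemma hasMult_replicate₁ {P Q : Type} [AddCommGroup P] [Module Λᵐᵒᵖ P] [AddCommGroup Q]
    [Module Λᵐᵒᵖ Q] {T : TwoTerm Λ} {a b : ℕ} (h : HasMult Λᵐᵒᵖ P Q T.P₁ a b) (n : ℕ) :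
    HasMult Λᵐᵒᵖ P Q (sumList (List.replicate n T)).P₁ (n * a) (n * b) := by
  induction n with
  | zero =>
    rw [zero_mul, zero_mul]
    have : Subsingleton (sumList (List.replicate 0 T)).P₁ := inferInstanceAs (Subsingleton PUnit)
    exact hasMult_of_subsingleton
  | succ n ih =>
    rw [Nat.succ_mul, Nat.succ_mul, add_comm _ a, add_comm _ b]
    exact h.prod ih

lemma hasMult_replicate₀ {P Q : Type} [AddCommGroup P] [Module Λᵐᵒᵖ P] [AddCommGroup Q]
    [Module Λᵐᵒᵖ Q] {T : TwoTerm Λ} {a b : ℕ} (h : HasMult Λᵐᵒᵖ P Q T.P₀ a b) (n : ℕ) :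
    HasMult Λᵐᵒᵖ P Q (sumList (List.replicate n T)).P₀ (n * a) (n * b) := by
  induction n with
  | zero =>
    rw [zero_mul, zero_mul]
    have : Subsingleton (sumList (List.replicate 0 T)).P₀ := inferInstanceAs (Subsingleton PUnit)
    exact hasMult_of_subsingleton
  | succ n ih =>
    rw [Nat.succ_mul, Nat.succ_mul, add_comm _ a, add_comm _ b]
    exact h.prod ih

end TwoTerm

namespace Frame

open TwoTerm

variable {K Λ P Q : Type} [Field K] [Ring Λ] [Algebra K Λ]
    [AddCommGroup P] [Module Λᵐᵒᵖ P] [Module K P] [IsScalarTower K Λᵐᵒᵖ P]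
    [AddCommGroup Q] [Module Λᵐᵒᵖ Q] [Module K Q] [IsScalarTower K Λᵐᵒᵖ Q]
    (F : Frame K Λᵐᵒᵖ P Q)

/-- Every dimension vector lies in the cone of two consecutive rays, up to contractibles. -/
lemma exists_cone (a₁ b₁ a₀ b₀ : ℕ) : ∃ (i : Fin 8) (m n k l : ℕ),
    a₁ = k + (m * rp₁ i + n * rp₁ (i + 1)) ∧ b₁ = l + (m * rq₁ i + n * rq₁ (i + 1)) ∧
    a₀ = k + (m * rp₀ i + n * rp₀ (i + 1)) ∧ b₀ = l + (m * rq₀ i + n * rq₀ (i + 1)) := by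
  have key : ∀ i : Fin 8, (∃ m n : ℕ,
      a₁ = min a₁ a₀ + (m * rp₁ i + n * rp₁ (i + 1)) ∧
      b₁ = min b₁ b₀ + (m * rq₁ i + n * rq₁ (i + 1)) ∧
      a₀ = min a₁ a₀ + (m * rp₀ i + n * rp₀ (i + 1)) ∧
      b₀ = min b₁ b₀ + (m * rq₀ i + n * rq₀ (i + 1))) → ∃ (i : Fin 8) (m n k l : ℕ),
    a₁ = k + (m * rp₁ i + n * rp₁ (i + 1)) ∧ b₁ = l + (m * rq₁ i + n * rq₁ (i + 1)) ∧
    a₀ = k + (m * rp₀ i + n * rp₀ (i + 1)) ∧ b₀ = l + (m * rq₀ i + n * rq₀ (i + 1)) :=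
    fun i ⟨m, n, h⟩ => ⟨i, m, n, _, _, h⟩
  rcases le_or_gt b₁ b₀ with hy | hy
  · rcases le_or_gt a₁ a₀ with hx | hx
    · refine key 0 ⟨b₀ - b₁, a₀ - a₁, ?_⟩
      simp [rp₁, rq₁, rp₀, rq₀]; omega
    · refine key 7 ⟨a₁ - a₀, b₀ - b₁, ?_⟩
      simp [rp₁, rq₁, rp₀, rq₀]; omega
  · rcases lt_or_ge a₀ a₁ with hx | hx
    · refine key 6 ⟨b₁ - b₀, a₁ - a₀, ?_⟩
      simp [rp₁, rq₁, rp₀, rq₀]; omega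
    · obtain ⟨x, rfl⟩ := Nat.exists_eq_add_of_le hx
      obtain ⟨z, rfl⟩ := Nat.exists_eq_add_of_le hy.le
      by_cases h1 : 3 * z ≤ x
      · refine key 1 ⟨x - 3 * z, z, ?_⟩
        simp [rp₁, rq₁, rp₀, rq₀]; omega
      by_cases h2 : 2 * z ≤ x
      · refine key 2 ⟨x - 2 * z, 3 * z - x, ?_⟩
        simp [rp₁, rq₁, rp₀, rq₀]; omega
      by_cases h3 : 3 * z ≤ 2 * x
      · refine key 3 ⟨2 * x - 3 * z, 2 * z - x, ?_⟩
        simp [rp₁, rq₁, rp₀, rq₀]; omega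
      by_cases h4 : z ≤ x
      · refine key 4 ⟨x - z, 3 * z - 2 * x, ?_⟩
        simp [rp₁, rq₁, rp₀, rq₀]; omega
      · refine key 5 ⟨x, z - x, ?_⟩
        simp [rp₁, rq₁, rp₀, rq₀]; omega

variable [Module.Finite K P] [Module.Finite K Q]

omit F in
/-- Presilting complexes with the same terms are isomorphic. -/
lemma hIso_of_mult [Infinite K] {T S : TwoTerm Λ} (hT : IsPresilting T) (hS : IsPresilting S)
    {a₁ b₁ a₀ b₀ : ℕ}
    (hT₁ : HasMult Λᵐᵒᵖ P Q T.P₁ a₁ b₁) (hT₀ : HasMult Λᵐᵒᵖ P Q T.P₀ a₀ b₀)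
    (hS₁ : HasMult Λᵐᵒᵖ P Q S.P₁ a₁ b₁) (hS₀ : HasMult Λᵐᵒᵖ P Q S.P₀ a₀ b₀) : HIso T S := by
  obtain ⟨t₁⟩ := hT₁
  obtain ⟨t₀⟩ := hT₀
  obtain ⟨s₁⟩ := hS₁
  obtain ⟨s₀⟩ := hS₀
  have tr : ∀ {U : TwoTerm Λ}, IsPresilting U → ∀ (u₁ : U.P₁ ≃ₗ[Λᵐᵒᵖ] Std P Q a₁ b₁)
      (u₀ : U.P₀ ≃ₗ[Λᵐᵒᵖ] Std P Q a₀ b₀) (w : Std P Q a₁ b₁ →ₗ[Λᵐᵒᵖ] Std P Q a₀ b₀),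
      ∃ (g : Std P Q a₀ b₀ →ₗ[Λᵐᵒᵖ] Std P Q a₀ b₀) (g' : Std P Q a₁ b₁ →ₗ[Λᵐᵒᵖ] Std P Q a₁ b₁),
        w = g.comp ((u₀.toLinearMap.comp U.d).comp u₁.symm.toLinearMap) +
          ((u₀.toLinearMap.comp U.d).comp u₁.symm.toLinearMap).comp g' := by
    intro U hU u₁ u₀ w
    obtain ⟨g, g', hg⟩ := hU ((u₀.symm.toLinearMap.comp w).comp u₁.toLinearMap)
    refine ⟨(u₀.toLinearMap.comp g).comp u₀.symm.toLinearMap,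
      (u₁.toLinearMap.comp g').comp u₁.symm.toLinearMap, LinearMap.ext fun x => ?_⟩
    have := congrArg u₀ (LinearMap.congr_fun hg (u₁.symm x))
    simpa using this
  obtain ⟨e₁, e₀, he⟩ := exists_equiv_of_presilting (K := K) (tr hT t₁ t₀) (tr hS s₁ s₀)
  refine HIso.of_equiv ((t₁.trans e₁).trans s₁.symm) ((t₀.trans e₀).trans s₀.symm) fun x => ?_
  have := he (t₁ x)
  simp only [LinearMap.comp_apply, LinearEquiv.coe_coe, LinearEquiv.symm_apply_apply] at this
  simp [this]

/-- A two-term presilting complex is a sum of copies of two consecutive rays. -/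
lemma exists_hIso_rays [Infinite K] {T : TwoTerm Λ} (hP : IsProj T) (hT : IsPresilting T) :
    ∃ (i : Fin 8) (l : List (TwoTerm Λ)), (∀ x ∈ l, x = F.ray i ∨ x = F.ray (i + 1)) ∧
      HIso T (sumList l) := by
  obtain ⟨f₁, p₁, f₀, p₀⟩ := hP
  obtain ⟨a₁, b₁, h₁⟩ := F.exists_mult T.P₁
  obtain ⟨a₀, b₀, h₀⟩ := F.exists_mult T.P₀
  obtain ⟨i, m, n, k, l, e1, e2, e3, e4⟩ := exists_cone a₁ b₁ a₀ b₀
  let C : TwoTerm Λ := dsum (cone (ModuleCat.of _ (Fin k → P))) (cone (ModuleCat.of _ (Fin l → Q)))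
  let R : TwoTerm Λ := dsum (sumList (List.replicate m (F.ray i)))
    (sumList (List.replicate n (F.ray (i + 1))))
  have hC : Function.Bijective C.d :=
    bijective_d_dsum (T := cone _) (S := cone _) Function.bijective_id Function.bijective_id
  have hR : Orth R R := by
    have o1 := F.orth_ray (i := i) (j := i) (Or.inl rfl)
    have o2 := F.orth_ray (i := i) (j := i + 1) (Or.inr (Or.inl rfl))
    have o3 := F.orth_ray (i := i + 1) (j := i) (Or.inr (Or.inr rfl))
    have o4 := F.orth_ray (i := i + 1) (j := i + 1) (Or.inl rfl)
    simp only [R, orth_dsum_left, orth_dsum_right, orth_sumList_left, orth_sumList_right,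
      List.mem_replicate]
    refine ⟨?_, ?_⟩ <;> rintro _ ⟨-, rfl⟩ <;> refine ⟨?_, ?_⟩ <;> rintro _ ⟨-, rfl⟩ <;> assumption
  have hS : IsPresilting (dsum C R) := by
    rw [isPresilting_iff]
    exact orth_dsum_left.mpr ⟨orth_of_bijective_left hC,
      orth_dsum_right.mpr ⟨orth_of_bijective_right hC, hR⟩⟩
  have m₁ : HasMult Λᵐᵒᵖ P Q (dsum C R).P₁ a₁ b₁ := by
    have := ((hasMult_piP (A := Λᵐᵒᵖ) (P := P) (Q := Q) k).prod (hasMult_piQ l)).prod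
      ((hasMult_replicate₁ (F.hasMult_ray₁ i) m).prod
        (hasMult_replicate₁ (F.hasMult_ray₁ (i + 1)) n))
    rwa [add_zero, zero_add, ← e1, ← e2] at this
  have m₀ : HasMult Λᵐᵒᵖ P Q (dsum C R).P₀ a₀ b₀ := by
    have := ((hasMult_piP (A := Λᵐᵒᵖ) (P := P) (Q := Q) k).prod (hasMult_piQ l)).prod
      ((hasMult_replicate₀ (F.hasMult_ray₀ i) m).prod
        (hasMult_replicate₀ (F.hasMult_ray₀ (i + 1)) n))
    rwa [add_zero, zero_add, ← e3, ← e4] at this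
  refine ⟨i, List.replicate m (F.ray i) ++ List.replicate n (F.ray (i + 1)), ?_, ?_⟩
  · intro x hx
    rcases List.mem_append.mp hx with h | h
    · exact Or.inl (List.eq_of_mem_replicate h)
    · exact Or.inr (List.eq_of_mem_replicate h)
  · refine (hIso_of_mult (K := K) hT hS h₁ h₀ m₁ m₀).trans ?_
    refine (((hIso_zero_iff.mpr hC).dsum_congr (HIso.refl R)).trans (zero_dsum R)).trans ?_
    exact (sumList_append _ _).symm

end Frame

end TwoPoint

namespace TwoPoint

namespace TwoTerm

variable {Λ : Type} [Ring Λ]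

/-- If the identity of `U` factors up to homotopy as `a ∘ b` with `b ∘ a = 0`, then `U` is
contractible. -/
lemma bijective_of_factor {T U : TwoTerm Λ}
    {a₁ : T.P₁ →ₗ[Λᵐᵒᵖ] U.P₁} {a₀ : T.P₀ →ₗ[Λᵐᵒᵖ] U.P₀}
    {b₁ : U.P₁ →ₗ[Λᵐᵒᵖ] T.P₁} {b₀ : U.P₀ →ₗ[Λᵐᵒᵖ] T.P₀} {h : U.P₀ →ₗ[Λᵐᵒᵖ] U.P₁}
    (h1 : ∀ x, a₁ (b₁ x) = x + h (U.d x)) (h0 : ∀ x, a₀ (b₀ x) = x + U.d (h x))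
    (z1 : ∀ x, b₁ (a₁ x) = 0) (z0 : ∀ x, b₀ (a₀ x) = 0) : Function.Bijective U.d := by
  constructor
  · rw [injective_iff_map_eq_zero]
    intro x hx
    have e := h1 x
    rw [hx, map_zero, add_zero] at e
    have := congrArg (fun y => a₁ (b₁ y)) e
    simp only [z1, map_zero] at this
    rw [← e, ← this]
  · intro y
    have e := h0 (a₀ (b₀ y))
    rw [z0, map_zero] at e
    rw [h0 y] at e
    refine ⟨-(h y + h (y + U.d (h y))), ?_⟩
    rw [map_neg, map_add]
    rw [eq_comm, eq_neg_iff_add_eq_zero, ← add_assoc]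
    exact e.symm

/-- A complex without maps `P₀ → P₁` and without nontrivial idempotent endomorphisms is
indecomposable in the homotopy category. -/
lemma isIndec_of_idem {T : TwoTerm Λ} (hd : ¬ Function.Bijective T.d)
    (hz : ∀ h : T.P₀ →ₗ[Λᵐᵒᵖ] T.P₁, h = 0)
    (hi : ∀ (e₁ : T.P₁ →ₗ[Λᵐᵒᵖ] T.P₁) (e₀ : T.P₀ →ₗ[Λᵐᵒᵖ] T.P₀), e₀.comp T.d = T.d.comp e₁ →
      e₁.comp e₁ = e₁ → e₀.comp e₀ = e₀ →
      (e₁ = 0 ∧ e₀ = 0) ∨ (e₁ = LinearMap.id ∧ e₀ = LinearMap.id)) : IsIndec T := by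
  refine ⟨fun h => hd (hIso_zero_iff.mp h), fun U V hUV => ?_⟩
  obtain ⟨u₁, u₀, v₁, v₀, hu, hv, ⟨k, k1, k0⟩, ⟨h, h1, h0⟩⟩ := hUV
  rw [hz k, LinearMap.zero_comp, sub_eq_zero] at k1
  rw [hz k, LinearMap.comp_zero, sub_eq_zero] at k0
  let U₁ : T.P₁ →ₗ[Λᵐᵒᵖ] (U.P₁ × V.P₁) := u₁
  let U₀ : T.P₀ →ₗ[Λᵐᵒᵖ] (U.P₀ × V.P₀) := u₀
  let V₁ : (U.P₁ × V.P₁) →ₗ[Λᵐᵒᵖ] T.P₁ := v₁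
  let V₀ : (U.P₀ × V.P₀) →ₗ[Λᵐᵒᵖ] T.P₀ := v₀
  let H : (U.P₀ × V.P₀) →ₗ[Λᵐᵒᵖ] (U.P₁ × V.P₁) := h
  have hu' : ∀ x, U₀ (T.d x) = (U.d (U₁ x).1, V.d (U₁ x).2) := LinearMap.congr_fun hu
  have hv' : ∀ x : U.P₁ × V.P₁, V₀ (U.d x.1, V.d x.2) = T.d (V₁ x) := LinearMap.congr_fun hv
  have k1' : ∀ x, V₁ (U₁ x) = x := LinearMap.congr_fun k1
  have k0' : ∀ x, V₀ (U₀ x) = x := LinearMap.congr_fun k0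
  have h1' : ∀ x : U.P₁ × V.P₁, U₁ (V₁ x) = x + H (U.d x.1, V.d x.2) := fun x =>
    sub_eq_iff_eq_add'.mp (LinearMap.congr_fun h1 x)
  have h0' : ∀ x : U.P₀ × V.P₀, U₀ (V₀ x) = x + (U.d (H x).1, V.d (H x).2) := fun x =>
    sub_eq_iff_eq_add'.mp (LinearMap.congr_fun h0 x)
  let a₁ : T.P₁ →ₗ[Λᵐᵒᵖ] U.P₁ := (LinearMap.fst _ _ _).comp U₁
  let a₀ : T.P₀ →ₗ[Λᵐᵒᵖ] U.P₀ := (LinearMap.fst _ _ _).comp U₀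
  let b₁ : U.P₁ →ₗ[Λᵐᵒᵖ] T.P₁ := V₁.comp (LinearMap.inl _ _ _)
  let b₀ : U.P₀ →ₗ[Λᵐᵒᵖ] T.P₀ := V₀.comp (LinearMap.inl _ _ _)
  let c₁ : T.P₁ →ₗ[Λᵐᵒᵖ] V.P₁ := (LinearMap.snd _ _ _).comp U₁
  let c₀ : T.P₀ →ₗ[Λᵐᵒᵖ] V.P₀ := (LinearMap.snd _ _ _).comp U₀
  let d₁ : V.P₁ →ₗ[Λᵐᵒᵖ] T.P₁ := V₁.comp (LinearMap.inr _ _ _)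
  let d₀ : V.P₀ →ₗ[Λᵐᵒᵖ] T.P₀ := V₀.comp (LinearMap.inr _ _ _)
  let p : U.P₀ →ₗ[Λᵐᵒᵖ] U.P₁ := (LinearMap.fst _ _ _).comp (H.comp (LinearMap.inl _ _ _))
  let r : V.P₀ →ₗ[Λᵐᵒᵖ] V.P₁ := (LinearMap.snd _ _ _).comp (H.comp (LinearMap.inr _ _ _))
  have ab1 : ∀ x, a₁ (b₁ x) = x + p (U.d x) := fun x => by
    have := h1' (x, 0)
    simp only [map_zero] at this
    exact congrArg Prod.fst this
  have ab0 : ∀ x, a₀ (b₀ x) = x + U.d (p x) := fun x =>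
    congrArg Prod.fst (h0' (x, 0))
  have cd1 : ∀ x, c₁ (d₁ x) = x + r (V.d x) := fun x => by
    have := h1' (0, x)
    simp only [map_zero] at this
    exact congrArg Prod.snd this
  have cd0 : ∀ x, c₀ (d₀ x) = x + V.d (r x) := fun x =>
    congrArg Prod.snd (h0' (0, x))
  have ad : ∀ x, a₀ (T.d x) = U.d (a₁ x) := fun x => congrArg Prod.fst (hu' x)
  have bd : ∀ x, b₀ (U.d x) = T.d (b₁ x) := fun x => by
    have := hv' (x, 0)
    simp only [map_zero] at this
    exact this
  have s1 : ∀ x, b₁ (a₁ x) + d₁ (c₁ x) = x := fun x => by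
    change V₁ ((U₁ x).1, 0) + V₁ (0, (U₁ x).2) = x
    rw [← map_add]
    simpa using k1' x
  have s0 : ∀ x, b₀ (a₀ x) + d₀ (c₀ x) = x := fun x => by
    change V₀ ((U₀ x).1, 0) + V₀ (0, (U₀ x).2) = x
    rw [← map_add]
    simpa using k0' x
  have hbpa : ∀ x, b₁ (p (a₀ x)) = 0 := fun x =>
    LinearMap.congr_fun (hz (b₁.comp (p.comp a₀))) x
  have i1 : (b₀.comp a₀).comp T.d = T.d.comp (b₁.comp a₁) := LinearMap.ext fun x => by
    simp only [LinearMap.comp_apply, ad, bd]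
  have i2 : (b₁.comp a₁).comp (b₁.comp a₁) = b₁.comp a₁ := LinearMap.ext fun x => by
    simp only [LinearMap.comp_apply, ab1, map_add, ← ad, hbpa, add_zero]
  have i3 : (b₀.comp a₀).comp (b₀.comp a₀) = b₀.comp a₀ := LinearMap.ext fun x => by
    simp only [LinearMap.comp_apply, ab0, map_add, bd, hbpa, map_zero, add_zero]
  rcases hi (b₁.comp a₁) (b₀.comp a₀) i1 i2 i3 with ⟨z1, z0⟩ | ⟨z1, z0⟩
  · left
    exact hIso_zero_iff.mpr (bijective_of_factor ab1 ab0 (LinearMap.congr_fun z1)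
      (LinearMap.congr_fun z0))
  · right
    refine hIso_zero_iff.mpr (bijective_of_factor cd1 cd0 (fun x => ?_) (fun x => ?_))
    · have e := s1 x
      have e' : b₁ (a₁ x) = x := LinearMap.congr_fun z1 x
      rwa [e', add_eq_left] at e
    · have e := s0 x
      have e' : b₀ (a₀ x) = x := LinearMap.congr_fun z0 x
      rwa [e', add_eq_left] at e

/-- The image of an endomorphism. -/
def image {T : TwoTerm Λ} (e₁ : T.P₁ →ₗ[Λᵐᵒᵖ] T.P₁) (e₀ : T.P₀ →ₗ[Λᵐᵒᵖ] T.P₀)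
    (h : e₀.comp T.d = T.d.comp e₁) : TwoTerm Λ where
  P₁ := ModuleCat.of Λᵐᵒᵖ (LinearMap.range e₁)
  P₀ := ModuleCat.of Λᵐᵒᵖ (LinearMap.range e₀)
  d := T.d.restrict (by
    rintro _ ⟨x, rfl⟩
    exact ⟨T.d x, LinearMap.congr_fun h x⟩)

lemma Orth.image {T : TwoTerm Λ} (hT : Orth T T)
    {e₁ : T.P₁ →ₗ[Λᵐᵒᵖ] T.P₁} {e₀ : T.P₀ →ₗ[Λᵐᵒᵖ] T.P₀} (h : e₀.comp T.d = T.d.comp e₁)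
    {f₁ : T.P₁ →ₗ[Λᵐᵒᵖ] T.P₁} {f₀ : T.P₀ →ₗ[Λᵐᵒᵖ] T.P₀} (h' : f₀.comp T.d = T.d.comp f₁)
    (he₁ : e₁.comp e₁ = e₁) (hf₀ : f₀.comp f₀ = f₀) :
    Orth (TwoTerm.image e₁ e₀ h) (TwoTerm.image f₁ f₀ h') := by
  intro w
  let w' : LinearMap.range e₁ →ₗ[Λᵐᵒᵖ] LinearMap.range f₀ := w
  obtain ⟨g, g', hg⟩ := hT ((LinearMap.range f₀).subtype.comp (w'.comp e₁.rangeRestrict))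
  let G : LinearMap.range e₀ →ₗ[Λᵐᵒᵖ] LinearMap.range f₀ :=
    f₀.rangeRestrict.comp (g.comp (LinearMap.range e₀).subtype)
  let G' : LinearMap.range e₁ →ₗ[Λᵐᵒᵖ] LinearMap.range f₁ :=
    f₁.rangeRestrict.comp (g'.comp (LinearMap.range e₁).subtype)
  refine ⟨G, G', LinearMap.ext fun x => ?_⟩
  let y : LinearMap.range e₁ := x
  refine Subtype.ext ?_
  change (w' y : T.P₀) = f₀ (g (T.d y)) + T.d (f₁ (g' y))
  have e := LinearMap.congr_fun hg y
  have hy : e₁.rangeRestrict y = y := by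
    obtain ⟨z, hz⟩ := y.2
    refine Subtype.ext ?_
    change e₁ (y : T.P₁) = y
    rw [← hz]
    exact LinearMap.congr_fun he₁ z
  have hw : f₀ (w' y : T.P₀) = w' y := by
    obtain ⟨z, hz⟩ := (w' y).2
    rw [← hz]
    exact LinearMap.congr_fun hf₀ z
  have e' : (w' y : T.P₀) = g (T.d y) + T.d (g' y) := by
    rw [← hy]
    exact e.trans (by rw [hy]; rfl)
  have hc : f₀ (T.d (g' y)) = T.d (f₁ (g' y)) := LinearMap.congr_fun h' _
  rw [← hc, ← map_add, ← e', hw]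

end TwoTerm

lemma exists_splitEquiv {R M : Type} [Ring R] [AddCommGroup M] [Module R M] {e : M →ₗ[R] M}
    (he : e.comp e = e) : Nonempty (M ≃ₗ[R]
      LinearMap.range e × LinearMap.range (LinearMap.id - e)) := by
  have he' : ∀ x, e (e x) = e x := LinearMap.congr_fun he
  refine ⟨LinearEquiv.ofLinearMap (e.rangeRestrict.prod (LinearMap.id - e).rangeRestrict)
    ((LinearMap.range e).subtype.coprod (LinearMap.range (LinearMap.id - e)).subtype) ?_ ?_⟩
  · refine LinearMap.ext ?_
    rintro ⟨⟨_, x, rfl⟩, ⟨_, y, rfl⟩⟩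
    simp [Prod.ext_iff, Subtype.ext_iff, he']
  · refine LinearMap.ext fun x => ?_
    simp

end TwoPoint

namespace TwoPoint

namespace TwoTerm

variable {Λ : Type} [Ring Λ]

/-- If the idempotent chain endomorphisms of a complex of projectives are trivial, then its
cokernel is zero or indecomposable. -/
lemma isIndecModule_ck {T : TwoTerm Λ} (hP : IsProj T)
    [IsNoetherian Λᵐᵒᵖ T.P₁] [IsArtinian Λᵐᵒᵖ T.P₁] [IsNoetherian Λᵐᵒᵖ T.P₀] [IsArtinian Λᵐᵒᵖ T.P₀]
    (hn : Nontrivial (ck T))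
    (hi : ∀ (e₁ : T.P₁ →ₗ[Λᵐᵒᵖ] T.P₁) (e₀ : T.P₀ →ₗ[Λᵐᵒᵖ] T.P₀), e₀.comp T.d = T.d.comp e₁ →
      e₁.comp e₁ = e₁ → e₀.comp e₀ = e₀ →
      (e₁ = 0 ∧ e₀ = 0) ∨ (e₁ = LinearMap.id ∧ e₀ = LinearMap.id)) :
    IsIndecModule Λᵐᵒᵖ (ck T) := by
  have p1 := hP.2.1
  have p0 := hP.2.2.2
  refine isIndecModule_of_end fun f hf => ?_
  obtain ⟨u₀, hu₀⟩ := Module.projective_lifting_property (toCk T) (f.comp (toCk T))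
    (toCk_surjective T)
  have hu : ∀ x, toCk T (u₀ x) = f (toCk T x) := LinearMap.congr_fun hu₀
  have hr : ∀ x, (u₀.comp T.d) x ∈ LinearMap.range T.d := fun x => by
    rw [← ker_toCk, LinearMap.mem_ker, LinearMap.comp_apply, hu, toCk_d, map_zero]
  obtain ⟨u₁, hu₁⟩ := Module.projective_lifting_property T.d.rangeRestrict
    ((u₀.comp T.d).codRestrict _ hr) T.d.surjective_rangeRestrict
  have hd : ∀ x, T.d (u₁ x) = u₀ (T.d x) := fun x =>
    congrArg Subtype.val (LinearMap.congr_fun hu₁ x)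
  let v₁ : Module.End Λᵐᵒᵖ T.P₁ := u₁
  let v₀ : Module.End Λᵐᵒᵖ T.P₀ := u₀
  obtain ⟨k₁, hk₁⟩ := Filter.eventually_atTop.mp v₁.eventually_isCompl_ker_pow_range_pow
  obtain ⟨k₀, hk₀⟩ := Filter.eventually_atTop.mp v₀.eventually_isCompl_ker_pow_range_pow
  let n := k₁ + k₀ + 1
  have c₁ := (hk₁ n (by omega)).symm
  have c₀ := (hk₀ n (by omega)).symm
  have hdn : ∀ (m : ℕ) x, T.d ((v₁ ^ m) x) = (v₀ ^ m) (T.d x) := by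
    intro m
    induction m with
    | zero => intro x; rfl
    | succ m ih =>
      intro x
      rw [pow_succ', pow_succ', Module.End.mul_apply, Module.End.mul_apply, ← ih]
      exact hd _
  have hfn : ∀ (m : ℕ) x, toCk T ((v₀ ^ (m + 1)) x) = f (toCk T x) := by
    intro m
    induction m with
    | zero => intro x; rw [zero_add, pow_one]; exact hu x
    | succ m ih =>
      intro x
      rw [pow_succ', Module.End.mul_apply]
      refine (hu _).trans ?_
      rw [ih]
      exact LinearMap.congr_fun hf _
  let e₁ := Submodule.projection _ _ c₁
  let e₀ := Submodule.projection _ _ c₀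
  have hcomm : e₀.comp T.d = T.d.comp e₁ := by
    refine LinearMap.ext fun x => ?_
    have hx : x ∈ LinearMap.range (v₁ ^ n) ⊔ LinearMap.ker (v₁ ^ n) := by
      rw [c₁.sup_eq_top]; trivial
    obtain ⟨_, ⟨y, rfl⟩, z, hz, rfl⟩ := Submodule.mem_sup.mp hx
    have a1 : e₁ ((v₁ ^ n) y) = (v₁ ^ n) y := by simp [e₁]
    have a2 : e₁ z = 0 := by
      simpa [e₁] using hz
    have a3 : e₀ (T.d ((v₁ ^ n) y)) = T.d ((v₁ ^ n) y) := by
      rw [hdn]; simp [e₀]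
    have a4 : e₀ (T.d z) = 0 := by
      have : (v₀ ^ n) (T.d z) = 0 := by rw [← hdn, LinearMap.mem_ker.mp hz, map_zero]
      simpa [e₀] using this
    simp only [LinearMap.comp_apply, map_add, a1, a2, a3, a4, map_zero]
  have i₁ : e₁.comp e₁ = e₁ := by ext x; simp [e₁]
  have i₀ : e₀.comp e₀ = e₀ := by ext x; simp [e₀]
  rcases hi e₁ e₀ hcomm i₁ i₀ with ⟨-, h⟩ | ⟨-, h⟩
  · left
    refine LinearMap.ext fun x => ?_
    obtain ⟨x, rfl⟩ := toCk_surjective T x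
    rw [← hfn (k₁ + k₀)]
    have : e₀ ((v₀ ^ n) x) = (v₀ ^ n) x := by simp [e₀]
    rw [h] at this
    change toCk T ((v₀ ^ n) x) = 0
    rw [← this, LinearMap.zero_apply, map_zero]
  · right
    refine LinearMap.ext fun x => ?_
    obtain ⟨x, rfl⟩ := toCk_surjective T x
    have : e₀ x ∈ LinearMap.range (v₀ ^ n) := by simp [e₀]
    rw [h] at this
    obtain ⟨y, hy⟩ := this
    have hy' : x = (v₀ ^ n) y := hy.symm
    rw [hy', hfn]
    exact LinearMap.congr_fun hf _

end TwoTerm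

namespace Frame

open TwoTerm

variable {K Λ P Q : Type} [Field K] [Ring Λ] [Algebra K Λ]
    [AddCommGroup P] [Module Λᵐᵒᵖ P] [Module K P] [IsScalarTower K Λᵐᵒᵖ P]
    [AddCommGroup Q] [Module Λᵐᵒᵖ Q] [Module K Q] [IsScalarTower K Λᵐᵒᵖ Q]
    (F : Frame K Λᵐᵒᵖ P Q)

include F

lemma proj_P : Module.Finite Λᵐᵒᵖ P ∧ Module.Projective Λᵐᵒᵖ P := by
  obtain ⟨e⟩ := F.reg
  refine ⟨Module.Finite.of_surjective ((LinearMap.fst _ P Q).comp e.toLinearMap)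
    (Prod.fst_surjective.comp e.surjective), ?_⟩
  refine Module.Projective.of_split (e.symm.toLinearMap.comp (LinearMap.inl _ P Q))
    ((LinearMap.fst _ P Q).comp e.toLinearMap) ?_
  ext x; simp

lemma proj_Q : Module.Finite Λᵐᵒᵖ Q ∧ Module.Projective Λᵐᵒᵖ Q := by
  obtain ⟨e⟩ := F.reg
  refine ⟨Module.Finite.of_surjective ((LinearMap.snd _ P Q).comp e.toLinearMap)
    (Prod.snd_surjective.comp e.surjective), ?_⟩
  refine Module.Projective.of_split (e.symm.toLinearMap.comp (LinearMap.inr _ P Q))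
    ((LinearMap.snd _ P Q).comp e.toLinearMap) ?_
  ext x; simp

lemma proj_of_hasMult {X : Type} [AddCommGroup X] [Module Λᵐᵒᵖ X] {a b : ℕ}
    (h : HasMult Λᵐᵒᵖ P Q X a b) : Module.Finite Λᵐᵒᵖ X ∧ Module.Projective Λᵐᵒᵖ X := by
  obtain ⟨e⟩ := h
  obtain ⟨_, _⟩ := F.proj_P
  obtain ⟨_, _⟩ := F.proj_Q
  have : Module.Projective Λᵐᵒᵖ (Fin a → P) :=
    Module.Projective.of_equiv (DirectSum.linearEquivFunOnFintype Λᵐᵒᵖ (Fin a) (fun _ => P))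
  have : Module.Projective Λᵐᵒᵖ (Fin b → Q) :=
    Module.Projective.of_equiv (DirectSum.linearEquivFunOnFintype Λᵐᵒᵖ (Fin b) (fun _ => Q))
  exact ⟨Module.Finite.equiv e.symm, Module.Projective.of_equiv e.symm⟩

lemma isProj_ray (i : Fin 8) : IsProj (F.ray i) :=
  ⟨(F.proj_of_hasMult (F.hasMult_ray₁ i)).1, (F.proj_of_hasMult (F.hasMult_ray₁ i)).2,
    (F.proj_of_hasMult (F.hasMult_ray₀ i)).1, (F.proj_of_hasMult (F.hasMult_ray₀ i)).2⟩

omit F in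
/-- Nonvanishing of `Hom(U, V[1])` or `Hom(V, U[1])` for a splitting of dimension vectors. -/
abbrev SplitFail (i : Fin 8) (a₁ b₁ a₀ b₀ : ℕ) : Prop :=
  (a₁ * (rp₁ i - a₁) + 3 * b₁ * (rp₁ i - a₁) + 3 * b₁ * (rq₁ i - b₁)) +
      (a₀ * (rp₀ i - a₀) + 3 * b₀ * (rp₀ i - a₀) + 3 * b₀ * (rq₀ i - b₀)) <
    a₁ * (rp₀ i - a₀) + 3 * b₁ * (rp₀ i - a₀) + 3 * b₁ * (rq₀ i - b₀) ∨
  ((rp₁ i - a₁) * a₁ + 3 * (rq₁ i - b₁) * a₁ + 3 * (rq₁ i - b₁) * b₁) +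
      ((rp₀ i - a₀) * a₀ + 3 * (rq₀ i - b₀) * a₀ + 3 * (rq₀ i - b₀) * b₀) <
    (rp₁ i - a₁) * a₀ + 3 * (rq₁ i - b₁) * a₀ + 3 * (rq₁ i - b₁) * b₀

omit F in
lemma splitFail : ∀ (i : Fin 8) (a₁ : Fin (rp₁ i + 1)) (b₁ : Fin (rq₁ i + 1))
    (a₀ : Fin (rp₀ i + 1)) (b₀ : Fin (rq₀ i + 1)), SplitFail i a₁ b₁ a₀ b₀ ∨
    (a₁.val = 0 ∧ b₁.val = 0 ∧ a₀.val = 0 ∧ b₀.val = 0) ∨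
      (rp₁ i - a₁ = 0 ∧ rq₁ i - b₁ = 0 ∧ rp₀ i - a₀ = 0 ∧ rq₀ i - b₀ = 0) := by
  decide

section

variable [Module.Finite K P] [Module.Finite K Q]

lemma idem_ray (i : Fin 8) (e₁ : (F.ray i).P₁ →ₗ[Λᵐᵒᵖ] (F.ray i).P₁)
    (e₀ : (F.ray i).P₀ →ₗ[Λᵐᵒᵖ] (F.ray i).P₀) (h : e₀.comp (F.ray i).d = (F.ray i).d.comp e₁)
    (h₁ : e₁.comp e₁ = e₁) (h₀ : e₀.comp e₀ = e₀) :
    (e₁ = 0 ∧ e₀ = 0) ∨ (e₁ = LinearMap.id ∧ e₀ = LinearMap.id) := by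
  let f₁ := LinearMap.id - e₁
  let f₀ := LinearMap.id - e₀
  have hf : f₀.comp (F.ray i).d = (F.ray i).d.comp f₁ := by
    simp only [f₁, f₀, LinearMap.sub_comp, LinearMap.comp_sub, LinearMap.id_comp, LinearMap.comp_id,
      h]
  have hf₁ : f₁.comp f₁ = f₁ := by
    simp only [f₁, LinearMap.sub_comp, LinearMap.comp_sub, LinearMap.id_comp, LinearMap.comp_id,
      h₁, sub_self, sub_zero]
  have hf₀ : f₀.comp f₀ = f₀ := by
    simp only [f₀, LinearMap.sub_comp, LinearMap.comp_sub, LinearMap.id_comp, LinearMap.comp_id,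
      h₀, sub_self, sub_zero]
  have hT := F.orth_ray (i := i) (j := i) (Or.inl rfl)
  obtain ⟨_, _, _, _⟩ := F.isProj_ray i
  have key : ∀ {M : Type} [AddCommGroup M] [Module Λᵐᵒᵖ M] [Module.Finite Λᵐᵒᵖ M]
      [Module.Projective Λᵐᵒᵖ M] (e : M →ₗ[Λᵐᵒᵖ] M), e.comp e = e →
      ∃ a b, HasMult Λᵐᵒᵖ P Q (LinearMap.range e) a b := by
    intro M _ _ _ _ e he
    have hs : e.rangeRestrict.comp (LinearMap.range e).subtype = LinearMap.id := by
      refine LinearMap.ext ?_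
      rintro ⟨_, x, rfl⟩
      exact Subtype.ext (LinearMap.congr_fun he x)
    have : Module.Projective Λᵐᵒᵖ (LinearMap.range e) := Module.Projective.of_split _ _ hs
    exact F.exists_mult _
  obtain ⟨a₁, b₁, m₁⟩ := key e₁ h₁
  obtain ⟨a₀, b₀, m₀⟩ := key e₀ h₀
  obtain ⟨c₁, d₁, n₁⟩ := key f₁ hf₁
  obtain ⟨c₀, d₀, n₀⟩ := key f₀ hf₀
  obtain ⟨s1, s2⟩ := F.mult_unique
    ((m₁.prod n₁).of_equiv (exists_splitEquiv h₁).some) (F.hasMult_ray₁ i)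
  obtain ⟨s3, s4⟩ := F.mult_unique
    ((m₀.prod n₀).of_equiv (exists_splitEquiv h₀).some) (F.hasMult_ray₀ i)
  have o1 := F.mult_le m₁ m₀ n₁ n₀ (hT.image h hf h₁ hf₀)
  have o2 := F.mult_le n₁ n₀ m₁ m₀ (hT.image hf h hf₁ h₀)
  have z : ∀ {M : Type} [AddCommGroup M] [Module Λᵐᵒᵖ M] (e : M →ₗ[Λᵐᵒᵖ] M),
      HasMult Λᵐᵒᵖ P Q (LinearMap.range e) 0 0 → e = 0 := by
    intro M _ _ e he
    have := he.subsingleton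
    refine LinearMap.ext fun x => ?_
    exact congrArg Subtype.val (Subsingleton.elim (e.rangeRestrict x) 0)
  obtain rfl : c₁ = rp₁ i - a₁ := by omega
  obtain rfl : d₁ = rq₁ i - b₁ := by omega
  obtain rfl : c₀ = rp₀ i - a₀ := by omega
  obtain rfl : d₀ = rq₀ i - b₀ := by omega
  rcases splitFail i ⟨a₁, by omega⟩ ⟨b₁, by omega⟩ ⟨a₀, by omega⟩ ⟨b₀, by omega⟩ with
    (h | h) | ⟨z1, z2, z3, z4⟩ | ⟨z1, z2, z3, z4⟩
  · exact absurd o1 (not_le.mpr h)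
  · exact absurd o2 (not_le.mpr h)
  · dsimp only at z1 z2 z3 z4
    subst z1 z2 z3 z4
    exact Or.inl ⟨z _ m₁, z _ m₀⟩
  · dsimp only at z1 z2 z3 z4
    rw [z1, z2] at n₁
    rw [z3, z4] at n₀
    exact Or.inr ⟨(sub_eq_zero.mp (z _ n₁)).symm, (sub_eq_zero.mp (z _ n₀)).symm⟩

lemma not_bijective_ray (i : Fin 8) : ¬ Function.Bijective (F.ray i).d := by
  intro h
  obtain ⟨h1, h2⟩ := F.mult_unique (F.hasMult_ray₁ i)
    ((F.hasMult_ray₀ i).of_equiv (LinearEquiv.ofBijective _ h))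
  clear h
  revert i
  decide

omit [Module.Finite K P] [Module.Finite K Q] in
lemma hom_ray_eq_zero (i : Fin 8) (h : (F.ray i).P₀ →ₗ[Λᵐᵒᵖ] (F.ray i).P₁) : h = 0 := by
  have pq : ∀ (a b : ℕ) (h : (Fin a → P) →ₗ[Λᵐᵒᵖ] (Fin b → Q)), h = 0 := by
    intro a b h
    refine LinearMap.pi_ext' fun j => LinearMap.ext fun x => funext fun k => ?_
    exact LinearMap.congr_fun
      (F.homPQ ((LinearMap.proj k).comp (h.comp (LinearMap.single _ (fun _ => P) j)))) x
  have s : Subsingleton (Fin 0 → Q) ∧ Subsingleton (Fin 0 → P) := ⟨inferInstance, inferInstance⟩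
  obtain ⟨s1, s2⟩ := s
  fin_cases i
  · exact LinearMap.ext fun x => Subsingleton.elim (α := Fin 0 → Q) _ _
  · exact pq 1 0 h
  · exact pq 3 1 h
  · exact pq 2 1 h
  · exact pq 3 2 h
  · exact pq 1 1 h
  · exact pq 0 1 h
  · refine LinearMap.ext fun x => ?_
    have hx : x = 0 := Subsingleton.elim (α := Fin 0 → P) x 0
    exact (congrArg h hx).trans (map_zero h)

lemma isIndec_ray (i : Fin 8) : IsIndec (F.ray i) :=
  isIndec_of_idem (F.not_bijective_ray i) (F.hom_ray_eq_zero i) (F.idem_ray i)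

lemma isNoetherian_isArtinian (X : Type) [AddCommGroup X] [Module Λᵐᵒᵖ X] [Module.Finite Λᵐᵒᵖ X] :
    IsNoetherian Λᵐᵒᵖ X ∧ IsArtinian Λᵐᵒᵖ X := by
  have := F.finite_reg
  have : IsNoetherianRing Λᵐᵒᵖ := IsNoetherianRing.of_finite K Λᵐᵒᵖ
  have : IsArtinianRing Λᵐᵒᵖ := IsArtinianRing.of_finite K Λᵐᵒᵖ
  exact ⟨inferInstance, inferInstance⟩

lemma isIndecModule_ck_ray {i : Fin 8} (hi : i ≠ 6 ∧ i ≠ 7) :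
    IsIndecModule Λᵐᵒᵖ (ck (F.ray i)) := by
  have hP := F.isProj_ray i
  obtain ⟨_, _, _, _⟩ := id hP
  obtain ⟨_, _⟩ := F.isNoetherian_isArtinian (F.ray i).P₁
  obtain ⟨_, _⟩ := F.isNoetherian_isArtinian (F.ray i).P₀
  refine isIndecModule_ck hP ?_ (F.idem_ray i)
  by_contra hs
  rw [not_nontrivial_iff_subsingleton] at hs
  have hsurj : Function.Surjective (F.ray i).d := fun x =>
    toCk_eq_zero.mp (Subsingleton.elim _ _)
  obtain ⟨s, hs⟩ := Module.projective_lifting_property (F.ray i).d LinearMap.id hsurj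
  rw [F.hom_ray_eq_zero i s, LinearMap.comp_zero] at hs
  have : Subsingleton (F.ray i).P₀ := ⟨fun x y => by
    have hx := LinearMap.congr_fun hs x
    have hy := LinearMap.congr_fun hs y
    exact hx.symm.trans hy⟩
  obtain ⟨h1, h2⟩ := F.mult_unique (F.hasMult_ray₀ i) hasMult_of_subsingleton
  have key : ∀ i : Fin 8, i ≠ 6 ∧ i ≠ 7 → rp₀ i = 0 → rq₀ i ≠ 0 := by decide
  exact key i hi h1 h2

omit [Module.Finite K P] [Module.Finite K Q] in
lemma subsingleton_ck_ray {i : Fin 8} (hi : i = 6 ∨ i = 7) : Subsingleton (ck (F.ray i)) := by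
  have s : Subsingleton (Fin 0 → P) := inferInstance
  have : Subsingleton (F.ray i).P₀ := by
    rcases hi with rfl | rfl
    · exact s
    · exact s
  exact (toCk_surjective (F.ray i)).subsingleton

end

end Frame

end TwoPoint

namespace TwoPoint

namespace TwoTerm

variable {Λ : Type} [Ring Λ]

lemma IsProj.dsum {T S : TwoTerm Λ} (hT : IsProj T) (hS : IsProj S) : IsProj (dsum T S) := by
  obtain ⟨_, _, _, _⟩ := hT
  obtain ⟨_, _, _, _⟩ := hS
  exact ⟨inferInstanceAs (Module.Finite Λᵐᵒᵖ (T.P₁ × S.P₁)),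
    inferInstanceAs (Module.Projective Λᵐᵒᵖ (T.P₁ × S.P₁)),
    inferInstanceAs (Module.Finite Λᵐᵒᵖ (T.P₀ × S.P₀)),
    inferInstanceAs (Module.Projective Λᵐᵒᵖ (T.P₀ × S.P₀))⟩

lemma sumList_pair (T S : TwoTerm Λ) : HIso (sumList [T, S]) (dsum T S) :=
  (HIso.refl T).dsum_congr (dsum_zero S)

lemma sumList_ofFn_two (L : Fin 2 → TwoTerm Λ) :
    HIso (sumList (List.ofFn L)) (dsum (L 0) (L 1)) :=
  sumList_pair _ _

end TwoTerm

namespace Frame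

open TwoTerm

variable {K Λ P Q : Type} [Field K] [Ring Λ] [Algebra K Λ]
    [AddCommGroup P] [Module Λᵐᵒᵖ P] [Module K P] [IsScalarTower K Λᵐᵒᵖ P]
    [AddCommGroup Q] [Module Λᵐᵒᵖ Q] [Module K Q] [IsScalarTower K Λᵐᵒᵖ Q]
    (F : Frame K Λᵐᵒᵖ P Q)

/-- The silting complexes: sums of two consecutive rays. -/
def sil (i : Fin 8) : TwoTerm Λ := dsum (F.ray i) (F.ray (i + 1))

include F

lemma isProj_sil (i : Fin 8) : IsProj (F.sil i) := (F.isProj_ray _).dsum (F.isProj_ray _)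

lemma orth_sil_ray {i j : Fin 8} (h : Adj i j) (h' : Adj (i + 1) j) :
    Orth (F.sil i) (F.ray j) ∧ Orth (F.ray j) (F.sil i) := by
  have sym : ∀ i j : Fin 8, Adj i j → Adj j i := by decide
  exact ⟨orth_dsum_left.mpr ⟨F.orth_ray h, F.orth_ray h'⟩,
    orth_dsum_right.mpr ⟨F.orth_ray (sym _ _ h), F.orth_ray (sym _ _ h')⟩⟩

lemma isPresilting_sil (i : Fin 8) : IsPresilting (F.sil i) := by
  rw [isPresilting_iff]
  have h1 : ∀ i : Fin 8, Adj i i ∧ Adj (i + 1) i ∧ Adj i (i + 1) ∧ Adj (i + 1) (i + 1) := by decide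
  obtain ⟨a, b, c, d⟩ := h1 i
  exact orth_dsum_right.mpr ⟨(F.orth_sil_ray a b).1, (F.orth_sil_ray c d).1⟩

lemma isEmpty_equiv : IsEmpty (P ≃ₗ[Λᵐᵒᵖ] Q) := by
  refine ⟨fun e => ?_⟩
  have := F.nontrivial_P
  obtain ⟨x, hx⟩ := exists_ne (0 : P)
  exact hx (e.map_eq_zero_iff.mp (LinearMap.congr_fun (F.homPQ e.toLinearMap) x))

lemma hasBasicDecomp_reg : HasBasicDecomp Λᵐᵒᵖ Λᵐᵒᵖ 2 :=
  hasBasicDecomp_two F.reg.some F.isIndecModule_P F.isIndecModule_Q F.isEmpty_equiv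

variable [Module.Finite K P] [Module.Finite K Q]

lemma eq_of_hIso_ray {i j : Fin 8} (h : HIso (F.ray i) (F.ray j)) : i = j := by
  have key : ∀ i j : Fin 8, (∀ k, Adj i k → Adj j k) → i = j := by decide
  have sym : ∀ i j : Fin 8, Adj i j → Adj j i := by decide
  exact key i j fun k hk => F.adj_of_orth ((F.orth_ray hk).congr_left h)
    ((F.orth_ray (sym _ _ hk)).congr_right h)

lemma eq_of_hIso_sil {i j : Fin 8} (h : HIso (F.sil i) (F.sil j)) : i = j := by
  have h1 : ∀ i : Fin 8, Adj i i ∧ Adj (i + 1) i ∧ Adj i (i + 1) ∧ Adj (i + 1) (i + 1) := by decide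
  have key : ∀ i j : Fin 8, Adj i j → Adj i (j + 1) → Adj (i + 1) j → Adj (i + 1) (j + 1) →
    i = j := by decide
  obtain ⟨a, b, c, d⟩ := h1 j
  have o1 := F.orth_sil_ray a b
  have o2 := F.orth_sil_ray c d
  have x1 := orth_dsum_left.mp (o1.1.congr_left h.symm)
  have x2 := orth_dsum_right.mp (o1.2.congr_right h.symm)
  have x3 := orth_dsum_left.mp (o2.1.congr_left h.symm)
  have x4 := orth_dsum_right.mp (o2.2.congr_right h.symm)
  exact key i j (F.adj_of_orth x1.1 x2.1) (F.adj_of_orth x3.1 x4.1)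
    (F.adj_of_orth x1.2 x2.2) (F.adj_of_orth x3.2 x4.2)

lemma exists_hIso_ray [Infinite K] {T : TwoTerm Λ} (hi : IsIndec T) (hP : IsProj T)
    (hT : IsPresilting T) : ∃ i, HIso T (F.ray i) := by
  obtain ⟨i, l, hl, h⟩ := F.exists_hIso_rays hP hT
  obtain ⟨x, hx, hxT⟩ := hi.exists_mem_hIso l h
  rcases hl x hx with rfl | rfl
  · exact ⟨i, hxT⟩
  · exact ⟨i + 1, hxT⟩

lemma isBasicSilting_sil (i : Fin 8) : IsBasicSilting (F.sil i) := by
  refine ⟨F.isProj_sil i, F.isPresilting_sil i, 2, fun j => F.ray (i + ![0, 1] j),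
    fun j => ⟨F.isIndec_ray _, F.isProj_ray _⟩, ?_, ?_,
    HasBasicDecomp.count (M := ModuleCat.of Λᵐᵒᵖ Λᵐᵒᵖ) F.hasBasicDecomp_reg⟩
  · have := (sumList_ofFn_two (fun j => F.ray (i + ![0, 1] j))).symm
    simp only [Matrix.cons_val_zero, Matrix.cons_val_one, add_zero] at this
    exact this
  · intro j k hjk h
    have h' := F.eq_of_hIso_ray h
    rw [add_right_inj] at h'
    have key : ∀ j k : Fin 2, (![0, 1] j : Fin 8) = ![0, 1] k → j = k := by decide
    exact hjk (key j k h')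

lemma exists_hIso_sil [Infinite K] {T : TwoTerm Λ} (hT : IsBasicSilting T) :
    ∃ i, HIso T (F.sil i) := by
  obtain ⟨hP, hT, k, L, hL, hTL, hne, hk⟩ := hT
  have := F.finite_reg
  have hN : IsNoetherianRing Λᵐᵒᵖ := IsNoetherianRing.of_finite K Λᵐᵒᵖ
  have hA : IsArtinianRing Λᵐᵒᵖ := IsArtinianRing.of_finite K Λᵐᵒᵖ
  have : IsNoetherian Λᵐᵒᵖ (ModuleCat.of Λᵐᵒᵖ Λᵐᵒᵖ) := hN
  have : IsArtinian Λᵐᵒᵖ (ModuleCat.of Λᵐᵒᵖ Λᵐᵒᵖ) := hA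
  obtain rfl : 2 = k :=
    HasBasicDecomp.count_unique (M := ModuleCat.of Λᵐᵒᵖ Λᵐᵒᵖ) F.hasBasicDecomp_reg hk
  have h := hTL.trans (sumList_ofFn_two L)
  have hT' := isPresilting_iff.mp hT
  have o := (hT'.congr_left h).congr_right h
  obtain ⟨o0, o1⟩ := orth_dsum_left.mp o
  obtain ⟨o00, o01⟩ := orth_dsum_right.mp o0
  obtain ⟨o10, o11⟩ := orth_dsum_right.mp o1
  obtain ⟨i, hi⟩ := F.exists_hIso_ray (hL 0).1 (hL 0).2 (isPresilting_iff.mpr o00)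
  obtain ⟨j, hj⟩ := F.exists_hIso_ray (hL 1).1 (hL 1).2 (isPresilting_iff.mpr o11)
  have hadj : Adj i j := F.adj_of_orth ((o01.congr_left hi).congr_right hj)
    ((o10.congr_left hj).congr_right hi)
  have h' := h.trans (hi.dsum_congr hj)
  rcases hadj with rfl | rfl | rfl
  · exact absurd (hi.trans hj.symm) (hne 0 1 (by decide))
  · exact ⟨i, h'⟩
  · exact ⟨j, h'.trans (dsum_comm _ _)⟩

lemma twoTermSiltingCount [Infinite K] : TwoTermSiltingCount Λ 8 :=
  ⟨F.sil, F.isBasicSilting_sil, fun _ _ => F.eq_of_hIso_sil, fun _ => F.exists_hIso_sil⟩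

end Frame

end TwoPoint

namespace TwoPoint

namespace TwoTerm

variable {Λ : Type} [Ring Λ] {T S S' : TwoTerm Λ}

lemma finite_ck (hT : IsProj T) : Module.Finite Λᵐᵒᵖ (ck T) :=
  have := hT.2.2.1
  Module.Finite.of_surjective (toCk T) (toCk_surjective T)

lemma isTauRigid_ck (hT : IsProj T) (h : IsPresilting T) : IsTauRigidCat Λᵐᵒᵖ (ck T) :=
  ⟨finite_ck hT, T.P₁, T.P₀, T.d, toCk T, hT.1, hT.2.1, hT.2.2.1, hT.2.2.2, toCk_surjective T,
    (ker_toCk T).symm, (orth_iff_ck hT).mp (isPresilting_iff.mp h)⟩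

lemma Orth.of_ck_equiv (hT : IsProj T) (e : ck S ≃ₗ[Λᵐᵒᵖ] ck S') (h : Orth T S) : Orth T S' := by
  rw [orth_iff_ck hT] at h ⊢
  intro f
  obtain ⟨g, hg⟩ := h (e.symm.toLinearMap.comp f)
  refine ⟨e.toLinearMap.comp g, ?_⟩
  rw [LinearMap.comp_assoc, ← hg]
  ext x
  simp

lemma orth_iff_of_subsingleton (hT : IsProj T) (h : Subsingleton T.P₀) :
    Orth T S ↔ ∀ f : T.P₁ →ₗ[Λᵐᵒᵖ] ck S, f = 0 := by
  rw [orth_iff_ck hT]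
  refine forall_congr' fun f => ⟨?_, fun hf => ⟨0, by simp [hf]⟩⟩
  rintro ⟨g, rfl⟩
  ext x
  simp [Subsingleton.elim (T.d x) 0]

/-- A `τ`-rigid module is the cokernel of a presilting complex. -/
lemma exists_presilting_of_isTauRigid {M : RMod Λ} (hM : IsTauRigidCat Λᵐᵒᵖ M) :
    ∃ T : TwoTerm Λ, IsProj T ∧ IsPresilting T ∧ Nonempty (M ≃ₗ[Λᵐᵒᵖ] ck T) := by
  obtain ⟨-, P₁, P₀, f, g, h1, h2, h3, h4, hg, hfg, h⟩ := hM
  let T : TwoTerm Λ := ⟨P₁, P₀, f⟩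
  have hP : IsProj T := ⟨h1, h2, h3, h4⟩
  let e : (P₀ ⧸ LinearMap.range f) ≃ₗ[Λᵐᵒᵖ] M :=
    (Submodule.quotEquivOfEq _ _ hfg).trans (g.quotKerEquivOfSurjective hg)
  let e' : ck T ≃ₗ[Λᵐᵒᵖ] M := e
  refine ⟨T, hP, ?_, ⟨e'.symm⟩⟩
  rw [isPresilting_iff, orth_iff_ck hP]
  intro u
  obtain ⟨u', hu'⟩ := h (e'.toLinearMap.comp u)
  refine ⟨e'.symm.toLinearMap.comp u', ?_⟩
  change u = e'.symm.toLinearMap.comp (u'.comp f)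
  rw [← hu']
  ext x
  simp

end TwoTerm

namespace Frame

open TwoTerm

variable {K Λ P Q : Type} [Field K] [Ring Λ] [Algebra K Λ]
    [AddCommGroup P] [Module Λᵐᵒᵖ P] [Module K P] [IsScalarTower K Λᵐᵒᵖ P]
    [AddCommGroup Q] [Module Λᵐᵒᵖ Q] [Module K Q] [IsScalarTower K Λᵐᵒᵖ Q]
    (F : Frame K Λᵐᵒᵖ P Q)

include F

lemma orth_ray_seven_iff {S : TwoTerm Λ} :
    Orth (F.ray 7) S ↔ ∀ f : P →ₗ[Λᵐᵒᵖ] ck S, f = 0 :=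
  orth_iff_of_subsingleton (F.isProj_ray 7) (inferInstanceAs (Subsingleton (Fin 0 → P)))

lemma orth_ray_six_iff {S : TwoTerm Λ} :
    Orth (F.ray 6) S ↔ ∀ f : Q →ₗ[Λᵐᵒᵖ] ck S, f = 0 := by
  refine (orth_iff_of_subsingleton (F.isProj_ray 6)
    (inferInstanceAs (Subsingleton (Fin 0 → P)))).trans ?_
  change (∀ f : (Fin 1 → Q) →ₗ[Λᵐᵒᵖ] ck S, f = 0) ↔ _
  constructor
  · intro h f
    have := h (f.comp (LinearMap.proj 0))
    ext x
    exact LinearMap.congr_fun this fun _ => x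
  · intro h f
    refine LinearMap.pi_ext' fun i => ?_
    rw [h (f.comp _), LinearMap.zero_comp]

variable [Module.Finite K P] [Module.Finite K Q]

lemma isEmpty_ck_ray_equiv (i : Fin 8) (hi : i ≤ 4) :
    IsEmpty (ck (F.ray i) ≃ₗ[Λᵐᵒᵖ] ck (F.ray (i + 1))) := by
  have key : ∀ i : Fin 8, i ≤ 4 → Adj (i + 2) (i + 1) ∧ Fail (i + 2) i := by decide
  refine ⟨fun e => ?_⟩
  exact F.not_fail_of_orth ((F.orth_ray (key i hi).1).of_ck_equiv (F.isProj_ray _) e.symm)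
    (key i hi).2

/-- The number of indecomposable summands of the cokernel of `F.sil i`. -/
lemma hasBasicDecomp_ck_sil (i : Fin 8) :
    HasBasicDecomp Λᵐᵒᵖ (ck (F.sil i)) ((![2, 2, 2, 2, 2, 1, 0, 1] : Fin 8 → ℕ) i) := by
  have e := ckDsum (F.ray i) (F.ray (i + 1))
  by_cases hi : i ≤ 4
  · have key : ∀ i : Fin 8, i ≤ 4 → (![2, 2, 2, 2, 2, 1, 0, 1] : Fin 8 → ℕ) i = 2 ∧
      (i ≠ 6 ∧ i ≠ 7) ∧ (i + 1 ≠ 6 ∧ i + 1 ≠ 7) := by decide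
    obtain ⟨h1, h2, h3⟩ := key i hi
    rw [h1]
    exact hasBasicDecomp_two e (F.isIndecModule_ck_ray h2) (F.isIndecModule_ck_ray h3)
      (F.isEmpty_ck_ray_equiv i hi)
  · have key : ∀ i : Fin 8, ¬ i ≤ 4 → i = 5 ∨ i = 6 ∨ i = 7 := by decide
    have s6 := F.subsingleton_ck_ray (Or.inl rfl)
    have s7 := F.subsingleton_ck_ray (Or.inr rfl)
    rcases key i hi with rfl | rfl | rfl
    · have : Unique (ck (F.ray (5 + 1))) := @Unique.mk' _ ⟨0⟩ s6
      exact hasBasicDecomp_one ((F.isIndecModule_ck_ray (i := 5) (by decide)).of_equiv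
        (e.trans LinearEquiv.prodUnique).symm)
    · have : Subsingleton (ck (F.ray (6 + 1))) := s7
      have : Subsingleton (ck (F.sil 6)) := e.toEquiv.subsingleton
      exact hasBasicDecomp_zero
    · have : Unique (ck (F.ray 7)) := @Unique.mk' _ ⟨0⟩ s7
      exact hasBasicDecomp_one ((F.isIndecModule_ck_ray (i := 7 + 1) (by decide)).of_equiv
        (e.trans LinearEquiv.uniqueProd).symm)

lemma isBasicSupportTauTilting_ck_sil (i : Fin 8) : IsBasicSupportTauTilting Λ (ck (F.sil i)) := by
  have hd := F.hasBasicDecomp_ck_sil i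
  refine ⟨⟨isTauRigid_ck (F.isProj_sil i) (F.isPresilting_sil i), ?_⟩, hd.isBasic⟩
  have hr : HasIndecClassCount Λᵐᵒᵖ (ModuleCat.of Λᵐᵒᵖ Λᵐᵒᵖ) 2 :=
    HasBasicDecomp.count (M := ModuleCat.of Λᵐᵒᵖ Λᵐᵒᵖ) F.hasBasicDecomp_reg
  have hQ : ∀ S, Orth (F.ray 6) S → ∀ f : Q →ₗ[Λᵐᵒᵖ] ck S, f = 0 := fun S => F.orth_ray_six_iff.mp
  have hP : ∀ S, Orth (F.ray 7) S → ∀ f : P →ₗ[Λᵐᵒᵖ] ck S, f = 0 :=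
    fun S => F.orth_ray_seven_iff.mp
  have key : ∀ i : Fin 8, (![2, 2, 2, 2, 2, 1, 0, 1] : Fin 8 → ℕ) i = 2 ∨ i = 5 ∨ i = 6 ∨ i = 7 := by
    decide
  rcases key i with h | rfl | rfl | rfl
  · rw [h] at hd
    exact ⟨ModuleCat.of Λᵐᵒᵖ PUnit, 2, 0, 2, inferInstanceAs (Module.Finite Λᵐᵒᵖ PUnit),
      inferInstanceAs (Module.Projective Λᵐᵒᵖ PUnit), fun f => LinearMap.ext fun x => by
        rw [Subsingleton.elim (α := PUnit) x 0]; exact map_zero f, hd.count,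
      HasBasicDecomp.count (M := ModuleCat.of Λᵐᵒᵖ PUnit) (hasBasicDecomp_zero (M := PUnit)), hr,
      rfl⟩
  · exact ⟨ModuleCat.of Λᵐᵒᵖ Q, 1, 1, 2, F.proj_Q.1, F.proj_Q.2,
      hQ _ (F.orth_sil_ray (j := 6) (by decide) (by decide)).2, hd.count,
      HasBasicDecomp.count (M := ModuleCat.of Λᵐᵒᵖ Q) (hasBasicDecomp_one F.isIndecModule_Q), hr,
      rfl⟩
  · refine ⟨ModuleCat.of Λᵐᵒᵖ Λᵐᵒᵖ, 0, 2, 2, inferInstanceAs (Module.Finite Λᵐᵒᵖ Λᵐᵒᵖ),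
      inferInstanceAs (Module.Projective Λᵐᵒᵖ Λᵐᵒᵖ), fun f => LinearMap.ext fun x => ?_, hd.count, hr,
      hr, rfl⟩
    have s6 := F.subsingleton_ck_ray (Or.inl rfl)
    have : Subsingleton (ck (F.ray (6 + 1))) := F.subsingleton_ck_ray (Or.inr rfl)
    have : Subsingleton (ck (F.sil 6)) := (ckDsum (F.ray 6) (F.ray (6 + 1))).toEquiv.subsingleton
    exact Subsingleton.elim _ _
  · exact ⟨ModuleCat.of Λᵐᵒᵖ P, 1, 1, 2, F.proj_P.1, F.proj_P.2,
      hP _ (F.orth_sil_ray (j := 7) (by decide) (by decide)).2, hd.count,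
      HasBasicDecomp.count (M := ModuleCat.of Λᵐᵒᵖ P) (hasBasicDecomp_one F.isIndecModule_P), hr,
      rfl⟩

end Frame

end TwoPoint

namespace TwoPoint

section

variable {R : Type} [Ring R] {M N : Type} [AddCommGroup M] [Module R M]
  [AddCommGroup N] [Module R N]

lemma IsRetract.subsingleton [Subsingleton M] (h : IsRetract R N M) : Subsingleton N := by
  obtain ⟨i, p, h⟩ := h
  exact Function.Injective.subsingleton (f := i)
    (Function.LeftInverse.injective (g := p) (LinearMap.congr_fun h))

lemma HasIndecClassCount.nontrivial {M : ModuleCat.{0} R} (h : HasIndecClassCount R M 1) :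
    Nontrivial M := by
  obtain ⟨k, N, -, hN, c, hc, -⟩ := h
  obtain ⟨j, -⟩ := hc 0
  have := (hN j).1
  exact (N j).subtype_injective.nontrivial

end

namespace TwoTerm

lemma exists_isRetract_ck {Λ : Type} [Ring Λ] {N : Type} [AddCommGroup N] [Module Λᵐᵒᵖ N]
    [IsNoetherian Λᵐᵒᵖ N] [IsArtinian Λᵐᵒᵖ N] (hN : IsIndecModule Λᵐᵒᵖ N) (l : List (TwoTerm Λ))
    (h : IsRetract Λᵐᵒᵖ N (ck (sumList l))) : ∃ x ∈ l, IsRetract Λᵐᵒᵖ N (ck x) := by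
  induction l with
  | nil =>
    have : Subsingleton (ck (zero Λ)) := (toCk_surjective (zero Λ)).subsingleton (α := PUnit)
    have : Subsingleton (ck (sumList ([] : List (TwoTerm Λ)))) := this
    have := hN.1
    exact absurd h.subsingleton (not_subsingleton N)
  | cons x l ih =>
    rcases hN.isRetract_prod (h.trans (IsRetract.of_equiv (ckDsum x (sumList l)))) with h | h
    · exact ⟨x, List.mem_cons_self, h⟩
    · obtain ⟨y, hy, hN⟩ := ih h
      exact ⟨y, List.mem_cons_of_mem _ hy, hN⟩

end TwoTerm

namespace Frame

open TwoTerm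

variable {K Λ P Q : Type} [Field K] [Ring Λ] [Algebra K Λ]
    [AddCommGroup P] [Module Λᵐᵒᵖ P] [Module K P] [IsScalarTower K Λᵐᵒᵖ P]
    [AddCommGroup Q] [Module Λᵐᵒᵖ Q] [Module K Q] [IsScalarTower K Λᵐᵒᵖ Q]
    (F : Frame K Λᵐᵒᵖ P Q)

include F

omit F in
lemma HasMult.hom_eq_zero {X M : Type} [AddCommGroup X] [Module Λᵐᵒᵖ X] [AddCommGroup M]
    [Module Λᵐᵒᵖ M] {a b : ℕ} (hX : HasMult Λᵐᵒᵖ P Q X a b) [Nontrivial X]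
    (h : ∀ f : X →ₗ[Λᵐᵒᵖ] M, f = 0) :
    (∀ f : P →ₗ[Λᵐᵒᵖ] M, f = 0) ∨ (∀ f : Q →ₗ[Λᵐᵒᵖ] M, f = 0) := by
  obtain ⟨e⟩ := id hX
  rcases a with _ | a
  · rcases b with _ | b
    · exact absurd hX.subsingleton (not_subsingleton X)
    · refine Or.inr fun f => LinearMap.ext fun x => ?_
      have := LinearMap.congr_fun (h (f.comp ((LinearMap.proj 0).comp
        ((LinearMap.snd _ _ _).comp e.toLinearMap)))) (e.symm (0, fun _ => x))
      simpa using this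
  · refine Or.inl fun f => LinearMap.ext fun x => ?_
    have := LinearMap.congr_fun (h (f.comp ((LinearMap.proj 0).comp
      ((LinearMap.fst _ _ _).comp e.toLinearMap)))) (e.symm (fun _ => x, 0))
    simpa using this

variable [Module.Finite K P] [Module.Finite K Q]

/-- The indecomposable summands of a `τ`-rigid module are cokernels of two consecutive rays. -/
lemma exists_summands [Infinite K] {M : RMod Λ} (hM : IsTauRigidCat Λᵐᵒᵖ M) : ∃ i : Fin 8,
    ∀ (N : Submodule Λᵐᵒᵖ M), IsIndecModule Λᵐᵒᵖ N → IsRetract Λᵐᵒᵖ N M →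
      ∃ m : Fin 8, (m = i ∨ m = i + 1) ∧ (m ≠ 6 ∧ m ≠ 7) ∧ Nonempty (N ≃ₗ[Λᵐᵒᵖ] ck (F.ray m)) := by
  have := hM.1
  obtain ⟨_, _⟩ := F.isNoetherian_isArtinian M
  obtain ⟨T, hP, hT, ⟨e⟩⟩ := exists_presilting_of_isTauRigid hM
  obtain ⟨i, l, hl, h⟩ := F.exists_hIso_rays hP hT
  obtain ⟨e'⟩ := h.ck_equiv
  refine ⟨i, fun N hN hr => ?_⟩
  have := hN.1
  obtain ⟨x, hx, hNx⟩ := exists_isRetract_ck hN l (hr.trans (IsRetract.of_equiv (e.trans e')))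
  have hm : ∃ m : Fin 8, (m = i ∨ m = i + 1) ∧ x = F.ray m := by
    rcases hl x hx with h | h
    · exact ⟨i, Or.inl rfl, h⟩
    · exact ⟨i + 1, Or.inr rfl, h⟩
  obtain ⟨m, hm, rfl⟩ := hm
  have hm' : m ≠ 6 ∧ m ≠ 7 := by
    rw [← not_or]
    intro h
    have := F.subsingleton_ck_ray h
    exact absurd hNx.subsingleton (not_subsingleton N)
  exact ⟨m, hm, hm', hNx.nonempty_equiv (F.isIndecModule_ck_ray hm')⟩

omit [Module.Finite K P] [Module.Finite K Q] in
lemma nonempty_equiv_ck_sil_six {M : Type} [AddCommGroup M] [Module Λᵐᵒᵖ M] [Subsingleton M] :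
    Nonempty (M ≃ₗ[Λᵐᵒᵖ] ck (F.sil 6)) := by
  have := F.subsingleton_ck_ray (i := 6) (Or.inl rfl)
  have : Subsingleton (ck (F.ray (6 + 1))) := F.subsingleton_ck_ray (Or.inr rfl)
  have : Subsingleton (ck (F.sil 6)) := (ckDsum (F.ray 6) (F.ray (6 + 1))).toEquiv.subsingleton
  exact ⟨LinearEquiv.ofSubsingleton _ _⟩

omit [Module.Finite K P] [Module.Finite K Q] in
lemma nonempty_ck_sil_five : Nonempty (ck (F.ray 5) ≃ₗ[Λᵐᵒᵖ] ck (F.sil 5)) := by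
  have : Unique (ck (F.ray (5 + 1))) := @Unique.mk' _ ⟨0⟩ (F.subsingleton_ck_ray (Or.inl rfl))
  exact ⟨((ckDsum (F.ray 5) (F.ray (5 + 1))).trans LinearEquiv.prodUnique).symm⟩

omit [Module.Finite K P] [Module.Finite K Q] in
lemma nonempty_ck_sil_seven : Nonempty (ck (F.ray 0) ≃ₗ[Λᵐᵒᵖ] ck (F.sil 7)) := by
  have : Unique (ck (F.ray 7)) := @Unique.mk' _ ⟨0⟩ (F.subsingleton_ck_ray (Or.inr rfl))
  exact ⟨((ckDsum (F.ray 7) (F.ray (7 + 1))).trans LinearEquiv.uniqueProd).symm⟩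

lemma exists_equiv_ck_sil [Infinite K] {M : RMod Λ} (hM : IsBasicSupportTauTilting Λ M) :
    ∃ i, Nonempty (M ≃ₗ[Λᵐᵒᵖ] ck (F.sil i)) := by
  obtain ⟨⟨hM, X, p, q, r, hX, hX', hXM, hp, hq, hr, hpq⟩, k, N, hinternal, hN, hne⟩ := hM
  have := hM.1
  obtain ⟨_, _⟩ := F.isNoetherian_isArtinian M
  obtain ⟨_, _⟩ := F.isNoetherian_isArtinian Λᵐᵒᵖ
  obtain rfl : k = p := HasBasicDecomp.count_unique ⟨N, hinternal, hN, hne⟩ hp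
  obtain rfl : 2 = r := by
    have : IsNoetherian Λᵐᵒᵖ (ModuleCat.of Λᵐᵒᵖ Λᵐᵒᵖ) := ‹IsNoetherian Λᵐᵒᵖ Λᵐᵒᵖ›
    have : IsArtinian Λᵐᵒᵖ (ModuleCat.of Λᵐᵒᵖ Λᵐᵒᵖ) := ‹IsArtinian Λᵐᵒᵖ Λᵐᵒᵖ›
    exact HasBasicDecomp.count_unique (M := ModuleCat.of Λᵐᵒᵖ Λᵐᵒᵖ) F.hasBasicDecomp_reg hr
  obtain ⟨i, hi⟩ := F.exists_summands hM
  have h := fun j => hi (N j) (hN j) (isRetract_of_internal hinternal j)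
  choose m hm hm' e using h
  have e0 := internalEquiv hinternal
  match k, hpq with
  | 0, _ =>
    have : Subsingleton M := e0.toEquiv.subsingleton
    exact ⟨6, F.nonempty_equiv_ck_sil_six⟩
  | 1, hpq =>
    obtain rfl : q = 1 := by omega
    have := hq.nontrivial
    obtain ⟨a, b, hab⟩ := F.exists_mult X
    obtain ⟨e⟩ := e 0
    have e1 : M ≃ₗ[Λᵐᵒᵖ] ck (F.ray (m 0)) :=
      (e0.trans (LinearEquiv.piUnique Λᵐᵒᵖ fun j => N j)).trans e
    have hz : ∀ f : X →ₗ[Λᵐᵒᵖ] ck (F.ray (m 0)), f = 0 := fun f => by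
      have := hXM (e1.symm.toLinearMap.comp f)
      ext x
      simpa using LinearMap.congr_fun this x
    have key7 : ∀ m : Fin 8, m ≠ 6 ∧ m ≠ 7 → ¬ Fail 7 m → m = 0 := by decide
    have key6 : ∀ m : Fin 8, m ≠ 6 ∧ m ≠ 7 → ¬ Fail 6 m → m = 5 := by decide
    rcases HasMult.hom_eq_zero hab hz with h | h
    · have h0 := key7 _ (hm' 0) (F.not_fail_of_orth (F.orth_ray_seven_iff.mpr h))
      rw [h0] at e1
      obtain ⟨e2⟩ := F.nonempty_ck_sil_seven
      exact ⟨7, ⟨e1.trans e2⟩⟩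
    · have h0 := key6 _ (hm' 0) (F.not_fail_of_orth (F.orth_ray_six_iff.mpr h))
      rw [h0] at e1
      obtain ⟨e2⟩ := F.nonempty_ck_sil_five
      exact ⟨5, ⟨e1.trans e2⟩⟩
  | 2, _ =>
    obtain ⟨f0⟩ := e 0
    obtain ⟨f1⟩ := e 1
    have e1 : M ≃ₗ[Λᵐᵒᵖ] (ck (F.ray (m 0)) × ck (F.ray (m 1))) :=
      (e0.trans (LinearEquiv.piFinTwo Λᵐᵒᵖ fun j => N j)).trans (f0.prodCongr f1)
    have hm01 : m 0 ≠ m 1 := fun h => by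
      rw [h] at f0
      exact (hne 0 1 (by decide)).false (f0.trans f1.symm)
    have e2 : ck (F.sil i) ≃ₗ[Λᵐᵒᵖ] (ck (F.ray i) × ck (F.ray (i + 1))) := ckDsum _ _
    have hcase : (m 0 = i ∧ m 1 = i + 1) ∨ (m 0 = i + 1 ∧ m 1 = i) := by
      rcases hm 0 with h | h <;> rcases hm 1 with h' | h'
      · exact absurd (h.trans h'.symm) hm01
      · exact Or.inl ⟨h, h'⟩
      · exact Or.inr ⟨h, h'⟩
      · exact absurd (h.trans h'.symm) hm01
    refine ⟨i, ?_⟩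
    rcases hcase with ⟨h, h'⟩ | ⟨h, h'⟩ <;> rw [h, h'] at e1
    · exact ⟨e1.trans e2.symm⟩
    · exact ⟨(e1.trans (LinearEquiv.prodComm _ _ _)).trans e2.symm⟩
  | (k + 3), hpq => omega

end Frame

end TwoPoint

namespace TwoPoint

section Gen

variable {R : Type} [Ring R] {L M N : Type} [AddCommGroup L] [Module R L] [AddCommGroup M]
  [Module R M] [AddCommGroup N] [Module R N]

/-- `M` is generated by `N`: it is a quotient of a finite direct sum of copies of `N`. -/
def Gen (R N M : Type) [Ring R] [AddCommGroup N] [Module R N] [AddCommGroup M] [Module R M] :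
    Prop :=
  ∃ (k : ℕ) (f : (Fin k → N) →ₗ[R] M), Function.Surjective f

lemma gen_of_fintype {ι : Type} [Fintype ι] (f : (ι → N) →ₗ[R] M) (hf : Function.Surjective f) :
    Gen R N M :=
  ⟨Fintype.card ι, f.comp (LinearEquiv.funCongrLeft R N (Fintype.equivFin ι)).toLinearMap,
    hf.comp (LinearEquiv.surjective _)⟩

lemma gen_of_surjective (f : N →ₗ[R] M) (hf : Function.Surjective f) : Gen R N M :=
  gen_of_fintype (ι := Unit) (f.comp (LinearMap.proj ())) fun y =>
    (hf y).imp' (fun x _ => x) fun _ h => h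

lemma Gen.comp_surjective (h : Gen R N M) (f : M →ₗ[R] L) (hf : Function.Surjective f) :
    Gen R N L := by
  obtain ⟨k, g, hg⟩ := h
  exact ⟨k, f.comp g, hf.comp hg⟩

lemma Gen.trans (h : Gen R N M) (h' : Gen R M L) : Gen R N L := by
  obtain ⟨k, f, hf⟩ := h
  obtain ⟨l, g, hg⟩ := h'
  refine gen_of_fintype (ι := Fin l × Fin k)
    (g.comp ((LinearMap.pi fun i => f.comp (LinearMap.proj i)).comp
      (LinearEquiv.curry R N (Fin l) (Fin k)).toLinearMap)) ?_
  have hs : Function.Surjective (LinearMap.pi (R := R) (φ := fun _ : Fin l => M) fun i =>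
      f.comp (LinearMap.proj (φ := fun _ : Fin l => Fin k → N) i)) := fun y => by
    choose x hx using fun i => hf (y i)
    exact ⟨x, funext hx⟩
  exact hg.comp (hs.comp (LinearEquiv.surjective _))

lemma Gen.prod (h : Gen R N M) (h' : Gen R N L) : Gen R N (M × L) := by
  obtain ⟨k, f, hf⟩ := h
  obtain ⟨l, g, hg⟩ := h'
  exact gen_of_fintype (ι := Fin k ⊕ Fin l)
    ((f.prodMap g).comp (LinearEquiv.sumArrowLequivProdArrow (Fin k) (Fin l) R N).toLinearMap)
    ((Function.Surjective.prodMap hf hg).comp (LinearEquiv.surjective _))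

lemma gen_of_subsingleton [Subsingleton M] : Gen R N M :=
  ⟨0, 0, fun _ => ⟨0, Subsingleton.elim _ _⟩⟩

lemma gen_of_finite [Module.Finite R M] : Gen R R M := Module.Finite.exists_fin' R M

lemma facLE_iff {Λ : Type} [Ring Λ] {M N : RMod Λ} : FacLE Λ M N ↔ Gen Λᵐᵒᵖ N M :=
  ⟨fun h => h M (gen_of_surjective LinearMap.id Function.surjective_id), fun h _ hX => h.trans hX⟩

end Gen

namespace TwoTerm

variable {Λ : Type} [Ring Λ] {T S : TwoTerm Λ}

lemma Orth.of_gen (hT : IsProj T) (h : IsPresilting T) (hg : Gen Λᵐᵒᵖ (ck T) (ck S)) :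
    Orth T S := by
  have h' := (orth_iff_ck hT).mp (isPresilting_iff.mp h)
  rw [orth_iff_ck hT]
  intro f
  obtain ⟨k, g, hg⟩ := hg
  have := hT.2.1
  obtain ⟨w, hw⟩ := Module.projective_lifting_property g f hg
  choose u hu using fun i => h' ((LinearMap.proj i).comp w)
  refine ⟨g.comp (LinearMap.pi u), ?_⟩
  rw [LinearMap.comp_assoc, ← hw]
  congr 1
  ext x i
  exact LinearMap.congr_fun (hu i) x

end TwoTerm

namespace Frame

open TwoTerm

variable {K Λ P Q : Type} [Field K] [Ring Λ] [Algebra K Λ]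
    [AddCommGroup P] [Module Λᵐᵒᵖ P] [Module K P] [IsScalarTower K Λᵐᵒᵖ P]
    [AddCommGroup Q] [Module Λᵐᵒᵖ Q] [Module K Q] [IsScalarTower K Λᵐᵒᵖ Q]
    (F : Frame K Λᵐᵒᵖ P Q)

include F

lemma gen_cx {a b a' b' : ℕ} {c : Fin b → Fin a → Fin 3 → K} {c' : Fin b' → Fin a' → Fin 3 → K}
    (s : Fin a' → Fin a) (hs : Function.Injective s) (G : Fin b → Fin b' → Fin 3 → K)
    (h : ∀ j i, c j (s i) = ∑ l, mulc (c' l i) (G j l)) :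
    Gen Λᵐᵒᵖ (ck (F.cx c)) (ck (F.cx c')) := by
  let g : (Fin a → P) →ₗ[Λᵐᵒᵖ] (Fin a' → P) := LinearMap.funLeft Λᵐᵒᵖ P s
  let g' : (Fin b → Q) →ₗ[Λᵐᵒᵖ] (Fin b' → Q) :=
    LinearMap.pi fun l => ∑ j, (F.q (G j l)).comp (LinearMap.proj j)
  let D : (Fin b → Q) →ₗ[Λᵐᵒᵖ] (Fin a → P) := (F.cx c).d
  let D' : (Fin b' → Q) →ₗ[Λᵐᵒᵖ] (Fin a' → P) := (F.cx c').d
  have hcomm : g.comp D = D'.comp g' := by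
    refine LinearMap.pi_ext fun j x => funext fun i => ?_
    have hD' : ∀ y, D' y i = ∑ l, F.qpEquiv (c' l i) (y l) := fun y => F.cx_d_apply c' y i
    have hg' : ∀ l, g' (Pi.single j x) l = F.q (G j l) x := by
      intro l
      change (∑ j, (F.q (G j l)).comp (LinearMap.proj j)) (Pi.single j x) = _
      rw [LinearMap.sum_apply, Finset.sum_eq_single j]
      · simp
      · intro k _ hk
        simp [Pi.single_eq_of_ne hk]
      · simp
    have hl : D (Pi.single j x) (s i) = F.qpEquiv (c j (s i)) x := F.cx_d_single c j x (s i)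
    change D (Pi.single j x) (s i) = D' (g' (Pi.single j x)) i
    rw [hl, hD', h, map_sum, LinearMap.sum_apply]
    refine Finset.sum_congr rfl fun l _ => ?_
    rw [hg', qpEquiv_q]
  exact gen_of_surjective (ckMap (T := F.cx c) (S := F.cx c') g' g hcomm)
    (ckMap_surjective _ _ _ (LinearMap.funLeft_surjective_of_injective Λᵐᵒᵖ P s hs))

lemma gen_two_three : Gen Λᵐᵒᵖ (ck (F.ray 2)) (ck (F.ray 3)) := by
  refine F.gen_cx (c := coef2 K) (c' := coef3 K) ![0, 1] (by decide) ![![![1, 0, 0]]] ?_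
  intro j i
  funext k
  fin_cases j; fin_cases i <;> fin_cases k <;> simp [coef2, coef3, mulc]

lemma gen_two_four : Gen Λᵐᵒᵖ (ck (F.ray 2)) (ck (F.ray 4)) := by
  refine F.gen_cx (c := coef2 K) (c' := coef4 K) ![0, 2, 1] (by decide)
    ![![![1, 0, 0], ![0, 0, 1]]] ?_
  intro j i
  funext k
  fin_cases j; fin_cases i <;> fin_cases k <;> simp [coef2, coef4, mulc]

lemma gen_four_five : Gen Λᵐᵒᵖ (ck (F.ray 4)) (ck (F.ray 5)) := by
  refine F.gen_cx (c := coef4 K) (c' := coef5 K) ![0] (by decide)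
    ![![![1, 0, 0]], ![![0, 0, 0]]] ?_
  intro j i
  funext k
  fin_cases i; fin_cases j <;> fin_cases k <;> simp [coef4, coef5, mulc]

omit F in
lemma gen_ck_dsum_left (T S : TwoTerm Λ) : Gen Λᵐᵒᵖ (ck (dsum T S)) (ck T) :=
  gen_of_surjective ((LinearMap.fst _ _ _).comp (ckDsum T S).toLinearMap)
    (Prod.fst_surjective.comp (ckDsum T S).surjective)

omit F in
lemma gen_ck_dsum_right (T S : TwoTerm Λ) : Gen Λᵐᵒᵖ (ck (dsum T S)) (ck S) :=
  gen_of_surjective ((LinearMap.snd _ _ _).comp (ckDsum T S).toLinearMap)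
    (Prod.snd_surjective.comp (ckDsum T S).surjective)

lemma gen_sil {i : Fin 8} {M : Type} [AddCommGroup M] [Module Λᵐᵒᵖ M]
    (h : Gen Λᵐᵒᵖ M (ck (F.ray i)))
    (h' : Gen Λᵐᵒᵖ M (ck (F.ray (i + 1)))) : Gen Λᵐᵒᵖ M (ck (F.sil i)) :=
  (h.prod h').comp_surjective (ckDsum _ _).symm.toLinearMap (ckDsum _ _).symm.surjective

lemma gen_sil_succ (i : Fin 8) (hi : 1 ≤ i ∧ i ≤ 4) :
    Gen Λᵐᵒᵖ (ck (F.sil i)) (ck (F.sil (i + 1))) := by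
  have l : Gen Λᵐᵒᵖ (ck (F.sil i)) (ck (F.ray i)) := gen_ck_dsum_left _ _
  have r : Gen Λᵐᵒᵖ (ck (F.sil i)) (ck (F.ray (i + 1))) := gen_ck_dsum_right _ _
  refine F.gen_sil r ?_
  have key : ∀ i : Fin 8, 1 ≤ i ∧ i ≤ 4 → i = 1 ∨ i = 2 ∨ i = 3 ∨ i = 4 := by decide
  rcases key i hi with rfl | rfl | rfl | rfl
  · exact r.trans F.gen_two_three
  · exact l.trans F.gen_two_four
  · exact r.trans F.gen_four_five
  · have : Subsingleton (ck (F.ray (4 + 1 + 1))) := F.subsingleton_ck_ray (i := 6) (Or.inl rfl)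
    exact gen_of_subsingleton

lemma gen_sil_zero (M : Type) [AddCommGroup M] [Module Λᵐᵒᵖ M] [Module.Finite Λᵐᵒᵖ M] :
    Gen Λᵐᵒᵖ (ck (F.sil 0)) M := by
  have hz : ∀ T : TwoTerm Λ, T.d = 0 → Gen Λᵐᵒᵖ (ck T) T.P₀ := fun T hT =>
    gen_of_surjective (Submodule.quotEquivOfEqBot _ (by rw [hT, LinearMap.range_zero])).toLinearMap
      (LinearEquiv.surjective _)
  have h0 : Gen Λᵐᵒᵖ (ck (F.ray 0)) Q := hz (F.ray 0) rfl
  have s1 : Subsingleton (F.ray 1).P₁ := inferInstanceAs (Subsingleton (Fin 0 → Q))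
  have h1 : Gen Λᵐᵒᵖ (ck (F.ray 1)) (Fin 1 → P) := hz (F.ray 1) (LinearMap.ext fun x => by
    rw [Subsingleton.elim x 0, map_zero, map_zero])
  have g1 : Gen Λᵐᵒᵖ (ck (F.sil 0)) P := (gen_ck_dsum_right _ _).trans
    (h1.comp_surjective (LinearMap.proj 0) fun x => ⟨fun _ => x, rfl⟩)
  have g0 : Gen Λᵐᵒᵖ (ck (F.sil 0)) Q := (gen_ck_dsum_left _ _).trans h0
  obtain ⟨e⟩ := F.reg
  exact ((g1.prod g0).comp_surjective e.symm.toLinearMap e.symm.surjective).trans gen_of_finite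

/-- The order of the support `τ`-tilting modules. -/
abbrev Le (k l : Fin 8) : Prop := l = 0 ∨ k = 6 ∨ k = l ∨ (1 ≤ l ∧ l ≤ k ∧ k ≤ 5)

lemma gen_sil_chain (n : ℕ) : ∀ l : Fin 8, 1 ≤ l → l.val + n ≤ 5 →
    Gen Λᵐᵒᵖ (ck (F.sil l)) (ck (F.sil (l + Fin.ofNat 8 n))) := by
  induction n with
  | zero =>
    intro l _ _
    have h : l + Fin.ofNat 8 0 = l := add_zero l
    rw [h]
    exact gen_of_surjective LinearMap.id Function.surjective_id
  | succ n ih =>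
    intro l hl hn
    have h1 : (l + 1).val = l.val + 1 := Fin.val_add_one_of_lt' (by omega)
    have h2 : 1 ≤ l + 1 := by rw [Fin.le_def, h1]; simp
    have ih := ih (l + 1) h2 (by omega)
    have h3 : l + 1 + Fin.ofNat 8 n = l + Fin.ofNat 8 (n + 1) := by
      apply Fin.ext; simp [Fin.val_add, Fin.ofNat]; omega
    rw [h3] at ih
    exact (F.gen_sil_succ l ⟨hl, by rw [Fin.le_def]; simp; omega⟩).trans ih

variable [Module.Finite K P] [Module.Finite K Q]

lemma facLE_sil_iff (k l : Fin 8) : FacLE Λ (ck (F.sil k)) (ck (F.sil l)) ↔ Le k l := by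
  rw [facLE_iff]
  constructor
  · intro h
    have key : ∀ k l : Fin 8, ¬ Fail l k → ¬ Fail l (k + 1) → ¬ Fail (l + 1) k →
      ¬ Fail (l + 1) (k + 1) → Le k l := by decide
    have o := Orth.of_gen (F.isProj_sil l) (F.isPresilting_sil l) h
    obtain ⟨o1, o2⟩ := orth_dsum_left.mp o
    obtain ⟨o11, o12⟩ := orth_dsum_right.mp o1
    obtain ⟨o21, o22⟩ := orth_dsum_right.mp o2
    exact key k l (F.not_fail_of_orth o11) (F.not_fail_of_orth o12) (F.not_fail_of_orth o21)
      (F.not_fail_of_orth o22)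
  · rintro (rfl | rfl | rfl | ⟨h1, h2, h3⟩)
    · have := finite_ck (F.isProj_sil k)
      exact F.gen_sil_zero _
    · obtain ⟨e⟩ := F.nonempty_equiv_ck_sil_six (M := PUnit)
      have := e.symm.toEquiv.subsingleton
      exact gen_of_subsingleton
    · exact gen_of_surjective LinearMap.id Function.surjective_id
    · have h2' : l.val ≤ k.val := h2
      have h3' : k.val ≤ 5 := h3
      have h := F.gen_sil_chain (k.val - l.val) l h1 (by omega)
      have h4 : l + Fin.ofNat 8 (k.val - l.val) = k := by
        apply Fin.ext; simp [Fin.val_add, Fin.ofNat]; omega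
      rwa [h4] at h

lemma eq_of_equiv_ck_sil {k l : Fin 8} (h : Nonempty (ck (F.sil k) ≃ₗ[Λᵐᵒᵖ] ck (F.sil l))) :
    k = l := by
  obtain ⟨e⟩ := h
  have key : ∀ k l : Fin 8, Le k l → Le l k → k = l := by decide
  exact key k l
    ((F.facLE_sil_iff k l).mp (facLE_iff.mpr (gen_of_surjective e.symm.toLinearMap e.symm.surjective)))
    ((F.facLE_sil_iff l k).mp (facLE_iff.mpr (gen_of_surjective e.toLinearMap e.surjective)))

lemma supportTauTiltingCount [Infinite K] : SupportTauTiltingCount Λ 8 :=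
  ⟨fun i => ck (F.sil i), F.isBasicSupportTauTilting_ck_sil, fun _ _ => F.eq_of_equiv_ck_sil,
    fun _ => F.exists_equiv_ck_sil⟩

lemma isTauTiltingFinite [Infinite K] : IsTauTiltingFinite Λ :=
  ⟨8, fun i => ck (F.sil i), fun _ => F.exists_equiv_ck_sil⟩

omit F in
/-- The position of the silting complexes in the Hasse quiver. -/
def hasseIndex : WithTop (WithBot (Fin 1 ⊕ Fin 5)) → Fin 8
  | none => 0
  | some none => 6
  | some (some (.inl _)) => 7
  | some (some (.inr i)) => 5 - i.castLE (by omega)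

omit F in
lemma hasseIndex_surjective : ∀ k, ∃ x, hasseIndex x = k := by
  intro k
  fin_cases k
  exacts [⟨none, rfl⟩, ⟨some (some (.inr 4)), rfl⟩, ⟨some (some (.inr 3)), rfl⟩,
    ⟨some (some (.inr 2)), rfl⟩, ⟨some (some (.inr 1)), rfl⟩, ⟨some (some (.inr 0)), rfl⟩,
    ⟨some none, rfl⟩, ⟨some (some (.inl 0)), rfl⟩]

omit F in
lemma le_iff_hasseIndex (x y : WithTop (WithBot (Fin 1 ⊕ Fin 5))) :
    x ≤ y ↔ Le (hasseIndex x) (hasseIndex y) := by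
  have r1 : ∀ i j : Fin 5, i ≤ j ↔ Le (5 - i.castLE (by omega)) (5 - j.castLE (by omega)) := by
    decide
  have r3 : ∀ i : Fin 1, hasseIndex (some (some (.inl i))) = 7 := fun _ => rfl
  have r2 : ∀ i : Fin 5, Le (5 - i.castLE (by omega)) 0 ∧ ¬ Le (5 - i.castLE (by omega)) 6 ∧
    ¬ Le (5 - i.castLE (by omega)) 7 ∧ ¬ Le 0 (5 - i.castLE (by omega)) ∧
    Le 6 (5 - i.castLE (by omega)) ∧ ¬ Le 7 (5 - i.castLE (by omega)) := by decide
  match x, y with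
  | none, none => exact iff_of_true le_rfl (by decide)
  | some none, none => exact iff_of_true le_top (by decide)
  | some (some (.inl i)), none => exact iff_of_true le_top (by rw [r3 i]; decide)
  | some (some (.inr i)), none => exact iff_of_true le_top (r2 i).1
  | none, some none => exact iff_of_false (WithTop.not_top_le_coe _) (by decide)
  | none, some (some (.inl i)) => exact iff_of_false (WithTop.not_top_le_coe _) (by rw [r3 i]; decide)
  | none, some (some (.inr i)) => exact iff_of_false (WithTop.not_top_le_coe _) (r2 i).2.2.2.1
  | some x, some y =>
    refine WithTop.coe_le_coe.trans ?_
    match x, y with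
    | none, none => exact iff_of_true le_rfl (by decide)
    | none, some (.inl i) => exact iff_of_true bot_le (by rw [r3 i]; decide)
    | none, some (.inr i) => exact iff_of_true bot_le (r2 i).2.2.2.2.1
    | some (.inl i), none => exact iff_of_false (WithBot.not_coe_le_bot _) (by rw [r3 i]; decide)
    | some (.inr i), none => exact iff_of_false (WithBot.not_coe_le_bot _) (r2 i).2.1
    | some x, some y =>
      refine WithBot.coe_le_coe.trans ?_
      match x, y with
      | .inl i, .inl j =>
        exact iff_of_true (Subsingleton.elim i j ▸ le_rfl) (by rw [r3 i, r3 j]; decide)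
      | .inl _, .inr i => exact iff_of_false Sum.not_inl_le_inr (r2 i).2.2.2.2.2
      | .inr i, .inl _ => exact iff_of_false Sum.not_inr_le_inl (r2 i).2.2.1
      | .inr i, .inr j => exact Sum.inr_le_inr_iff.trans (r1 i j)

lemma hasseType [Infinite K] : HasseType Λ 1 5 := by
  refine ⟨fun x => ck (F.sil (hasseIndex x)), fun x => F.isBasicSupportTauTilting_ck_sil _,
    fun x y h => ?_, fun M hM => ?_, fun x y => ?_⟩
  · have h := F.eq_of_equiv_ck_sil h
    refine le_antisymm ((le_iff_hasseIndex x y).mpr ?_) ((le_iff_hasseIndex y x).mpr ?_)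
    · exact Or.inr (Or.inr (Or.inl h))
    · exact Or.inr (Or.inr (Or.inl h.symm))
  · obtain ⟨i, hi⟩ := F.exists_equiv_ck_sil hM
    obtain ⟨x, rfl⟩ := hasseIndex_surjective i
    exact ⟨x, hi⟩
  · exact (le_iff_hasseIndex x y).trans (F.facLE_sil_iff _ _).symm

end Frame

end TwoPoint

namespace TwoPoint

/-! ### The algebra `Γ₂` -/

/-- Elements `e₁, e₂, μ, β` of an algebra which present it as `Γ₂`. -/
structure GammaElts (K Λ : Type) [Field K] [Ring Λ] [Algebra K Λ] where
  e₁ : Λ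
  e₂ : Λ
  μ : Λ
  β : Λ
  e₁_e₁ : e₁ * e₁ = e₁
  e₂_e₂ : e₂ * e₂ = e₂
  e₁_e₂ : e₁ * e₂ = 0
  e₂_e₁ : e₂ * e₁ = 0
  sum_eq : e₁ + e₂ = 1
  e₁_μ : e₁ * μ = μ
  μ_e₂ : μ * e₂ = μ
  e₂_β : e₂ * β = β
  β_e₂ : β * e₂ = β
  β_cube : β * (β * β) = 0
  e₁_ne_zero : e₁ ≠ 0
  span : ∀ x : Λ, ∃ (a : K) (b c : Fin 3 → K), x = a • e₁ +
    (b 0 • e₂ + b 1 • β + b 2 • (β * β)) + (c 0 • μ + c 1 • (μ * β) + c 2 • (μ * (β * β)))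
  inj : ∀ c : Fin 3 → K, c 0 • μ + c 1 • (μ * β) + c 2 • (μ * (β * β)) = 0 → c = 0

namespace GammaElts

variable {K Λ : Type} [Field K] [Ring Λ] [Algebra K Λ] (G : GammaElts K Λ)

/-- The right ideal generated by an idempotent. -/
def rightIdeal (e : Λ) : Submodule Λᵐᵒᵖ Λ where
  carrier := {x | e * x = x}
  add_mem' := fun {x y} (hx : e * x = x) (hy : e * y = y) => by
    change e * (x + y) = x + y
    rw [mul_add, hx, hy]
  zero_mem' := mul_zero e
  smul_mem' := fun a x (hx : e * x = x) => by
    change e * (x * a.unop) = x * a.unop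
    rw [← mul_assoc, hx]

/-- Left multiplication as a map between right ideals. -/
def mulLeft {e e' : Λ} (m : Λ) (hm : e' * m = m) : rightIdeal e →ₗ[Λᵐᵒᵖ] rightIdeal e' where
  toFun x := ⟨m * x.1, by change e' * (m * x.1) = m * x.1; rw [← mul_assoc, hm]⟩
  map_add' x y := Subtype.ext (mul_add m x.1 y.1)
  map_smul' a x := Subtype.ext (mul_assoc m x.1 a.unop).symm

lemma hom_apply {e e' : Λ} (he : e * e = e) (f : rightIdeal e →ₗ[Λᵐᵒᵖ] rightIdeal e') :
    ∃ m : Λ, e' * m = m ∧ m * e = m ∧ ∀ x, (f x).1 = m * x.1 := by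
  let u : rightIdeal e := ⟨e, he⟩
  have hf : ∀ x : rightIdeal e, (f x).1 = (f u).1 * x.1 := fun x => by
    have hx : x = MulOpposite.op x.1 • u := Subtype.ext x.2.symm
    conv_lhs => rw [hx, map_smul]
    rfl
  exact ⟨(f u).1, (f u).2, (hf u).symm, hf⟩

section
include G

lemma e₂_μ : G.e₂ * G.μ = 0 := by rw [← G.e₁_μ, ← mul_assoc, G.e₂_e₁, zero_mul]
lemma μ_e₁ : G.μ * G.e₁ = 0 := by rw [← G.μ_e₂, mul_assoc, G.e₂_e₁, mul_zero]
lemma e₁_β : G.e₁ * G.β = 0 := by rw [← G.e₂_β, ← mul_assoc, G.e₁_e₂, zero_mul]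
lemma β_e₁ : G.β * G.e₁ = 0 := by rw [← G.β_e₂, mul_assoc, G.e₂_e₁, mul_zero]

lemma finite : Module.Finite K Λ := by
  let f : (K × (Fin 3 → K) × (Fin 3 → K)) →ₗ[K] Λ :=
    { toFun := fun p => p.1 • G.e₁ +
        (p.2.1 0 • G.e₂ + p.2.1 1 • G.β + p.2.1 2 • (G.β * G.β)) +
        (p.2.2 0 • G.μ + p.2.2 1 • (G.μ * G.β) + p.2.2 2 • (G.μ * (G.β * G.β)))
      map_add' := fun p q => by
        simp only [Prod.fst_add, Prod.snd_add, Pi.add_apply, add_smul]; abel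
      map_smul' := fun t p => by
        simp only [Prod.smul_fst, Prod.smul_snd, Pi.smul_apply, smul_eq_mul, mul_smul, smul_add,
          RingHom.id_apply] }
  refine Module.Finite.of_surjective f fun x => ?_
  obtain ⟨a, b, c, h⟩ := G.span x
  exact ⟨(a, b, c), h.symm⟩

lemma finite_rightIdeal (e : Λ) : Module.Finite K (rightIdeal e) :=
  have := G.finite
  Module.Finite.of_injective ((rightIdeal e).subtype.restrictScalars K) Subtype.val_injective

lemma corner₁₁ {m : Λ} (h : G.e₁ * m = m) (h' : m * G.e₁ = m) : ∃ a : K, m = a • G.e₁ := by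
  obtain ⟨a, b, c, rfl⟩ := G.span m
  refine ⟨a, ?_⟩
  conv_lhs => rw [← h', ← h]
  simp [mul_add, add_mul, mul_assoc, G.e₁_e₁, G.e₁_e₂, G.e₁_β, G.β_e₁, G.μ_e₁]

lemma corner₁₂ {m : Λ} (h : G.e₁ * m = m) (h' : m * G.e₂ = m) : ∃ c : Fin 3 → K,
    m = c 0 • G.μ + c 1 • (G.μ * G.β) + c 2 • (G.μ * (G.β * G.β)) := by
  obtain ⟨a, b, c, rfl⟩ := G.span m
  refine ⟨c, ?_⟩
  conv_lhs => rw [← h', ← h]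
  have hz : ∀ z, G.e₁ * (G.β * z) = 0 := fun z => by rw [← mul_assoc, G.e₁_β, zero_mul]
  have hm : ∀ z, G.e₁ * (G.μ * z) = G.μ * z := fun z => by rw [← mul_assoc, G.e₁_μ]
  simp [mul_add, add_mul, mul_assoc, G.e₁_e₁, G.e₁_e₂, G.e₁_β, G.e₁_μ, G.β_e₂, G.μ_e₂, hz, hm]

lemma corner₂₁ {m : Λ} (h : G.e₂ * m = m) (h' : m * G.e₁ = m) : m = 0 := by
  obtain ⟨a, b, c, rfl⟩ := G.span m
  rw [← h', ← h]
  simp [mul_add, add_mul, mul_assoc, G.e₂_e₁, G.β_e₁, G.μ_e₁]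

lemma corner₂₂ {m : Λ} (h : G.e₂ * m = m) (h' : m * G.e₂ = m) : ∃ b : Fin 3 → K,
    m = b 0 • G.e₂ + b 1 • G.β + b 2 • (G.β * G.β) := by
  obtain ⟨a, b, c, rfl⟩ := G.span m
  refine ⟨b, ?_⟩
  conv_lhs => rw [← h', ← h]
  have hz : ∀ z, G.e₂ * (G.β * z) = G.β * z := fun z => by rw [← mul_assoc, G.e₂_β]
  have hm : ∀ z, G.e₂ * (G.μ * z) = 0 := fun z => by rw [← mul_assoc, G.e₂_μ, zero_mul]
  simp [mul_add, add_mul, mul_assoc, G.e₁_e₂, G.β_e₂, G.e₂_e₂, G.e₂_β, G.e₂_μ, hz, hm]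

end

/-- The decomposition of the regular module. -/
def regEquiv : Λᵐᵒᵖ ≃ₗ[Λᵐᵒᵖ] rightIdeal G.e₁ × rightIdeal G.e₂ where
  toFun a := (⟨G.e₁ * a.unop, by change G.e₁ * (G.e₁ * a.unop) = _; rw [← mul_assoc, G.e₁_e₁]⟩,
    ⟨G.e₂ * a.unop, by change G.e₂ * (G.e₂ * a.unop) = _; rw [← mul_assoc, G.e₂_e₂]⟩)
  invFun p := MulOpposite.op (p.1.1 + p.2.1)
  map_add' a b := Prod.ext (Subtype.ext (mul_add _ _ _)) (Subtype.ext (mul_add _ _ _))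
  map_smul' a b := Prod.ext (Subtype.ext (mul_assoc _ _ _).symm)
    (Subtype.ext (mul_assoc _ _ _).symm)
  left_inv a := by
    change MulOpposite.op (G.e₁ * a.unop + G.e₂ * a.unop) = a
    rw [← add_mul, G.sum_eq, one_mul, MulOpposite.op_unop]
  right_inv p := by
    obtain ⟨⟨x, hx⟩, ⟨y, hy⟩⟩ := p
    replace hx : G.e₁ * x = x := hx
    replace hy : G.e₂ * y = y := hy
    refine Prod.ext (Subtype.ext ?_) (Subtype.ext ?_)
    · change G.e₁ * (x + y) = x
      rw [mul_add, hx, ← hy, ← mul_assoc, G.e₁_e₂, zero_mul, add_zero]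
    · change G.e₂ * (x + y) = y
      rw [mul_add, hy, ← hx, ← mul_assoc, G.e₂_e₁, zero_mul, zero_add]

/-- The frame of indecomposable projectives. -/
def frame : Frame K Λᵐᵒᵖ (rightIdeal G.e₁) (rightIdeal G.e₂) where
  φ := mulLeft G.μ G.e₁_μ
  ψ := mulLeft G.β G.e₂_β
  psi_cube := by
    refine LinearMap.ext fun x => Subtype.ext ?_
    change G.β * (G.β * (G.β * x.1)) = 0
    rw [← mul_assoc, ← mul_assoc, mul_assoc G.β, G.β_cube, zero_mul]
  nontrivial_P := ⟨⟨⟨G.e₁, G.e₁_e₁⟩, 0, fun h => G.e₁_ne_zero (congrArg Subtype.val h)⟩⟩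
  endP f := by
    obtain ⟨m, h, h', hf⟩ := hom_apply G.e₁_e₁ f
    obtain ⟨a, rfl⟩ := G.corner₁₁ h h'
    refine ⟨a, LinearMap.ext fun x => Subtype.ext ?_⟩
    rw [hf]
    change a • G.e₁ * x.1 = a • x.1
    rw [smul_mul_assoc, show G.e₁ * x.1 = x.1 from x.2]
  homPQ f := by
    obtain ⟨m, h, h', hf⟩ := hom_apply G.e₁_e₁ f
    obtain rfl := G.corner₂₁ h h'
    refine LinearMap.ext fun x => Subtype.ext ?_
    rw [hf, zero_mul]
    rfl
  homQP f := by
    obtain ⟨m, h, h', hf⟩ := hom_apply G.e₂_e₂ f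
    obtain ⟨c, rfl⟩ := G.corner₁₂ h h'
    refine ⟨c, LinearMap.ext fun x => Subtype.ext ?_⟩
    rw [hf]
    change _ = G.μ * (c 0 • x.1 + c 1 • (G.β * x.1) + c 2 • (G.β * (G.β * x.1)))
    simp only [mul_add, add_mul, mul_smul_comm, smul_mul_assoc, mul_assoc]
  homQQ f := by
    obtain ⟨m, h, h', hf⟩ := hom_apply G.e₂_e₂ f
    obtain ⟨c, rfl⟩ := G.corner₂₂ h h'
    refine ⟨c, LinearMap.ext fun x => Subtype.ext ?_⟩
    rw [hf]
    change _ = c 0 • x.1 + c 1 • (G.β * x.1) + c 2 • (G.β * (G.β * x.1))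
    simp only [add_mul, smul_mul_assoc, mul_assoc, show G.e₂ * x.1 = x.1 from x.2]
  inj c h := by
    refine G.inj c ?_
    have := congrArg Subtype.val (LinearMap.congr_fun h ⟨G.e₂, G.e₂_e₂⟩)
    change G.μ * (c 0 • G.e₂ + c 1 • (G.β * G.e₂) + c 2 • (G.β * (G.β * G.e₂))) = 0 at this
    simpa only [mul_add, mul_smul_comm, G.β_e₂, G.μ_e₂] using this
  reg := ⟨G.regEquiv⟩

end GammaElts

section Gamma2

variable (K : Type) [Field K]

/-- The matrices of the generators of `Γ₂` acting on the projective module at the vertex `1`. -/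
def gammaMat : TPGen (Fin 2) → Matrix (Fin 4) (Fin 4) K
  | .v i => ![!![1, 0, 0, 0; 0, 0, 0, 0; 0, 0, 0, 0; 0, 0, 0, 0],
      !![0, 0, 0, 0; 0, 1, 0, 0; 0, 0, 1, 0; 0, 0, 0, 1]] i
  | .ar a => ![!![0, 1, 0, 0; 0, 0, 0, 0; 0, 0, 0, 0; 0, 0, 0, 0],
      !![0, 0, 0, 0; 0, 0, 1, 0; 0, 0, 0, 1; 0, 0, 0, 0]] a

lemma gammaMat_rel ⦃x y : FreeAlgebra K (TPGen (Fin 2))⦄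
    (h : QuivRel K (Fin 2) QA.s QA.t {(QA.be K ^ 3, 0)} x y) :
    FreeAlgebra.lift K (gammaMat K) x = FreeAlgebra.lift K (gammaMat K) y := by
  cases h with
  | idem i =>
    simp only [vtx, map_mul, FreeAlgebra.lift_ι_apply, gammaMat]
    fin_cases i <;> ext i j <;> fin_cases i <;> fin_cases j <;>
      simp [Matrix.mul_apply, Fin.sum_univ_succ]
  | orth i j hij =>
    simp only [vtx, map_mul, map_zero, FreeAlgebra.lift_ι_apply, gammaMat]
    fin_cases i <;> fin_cases j <;> first
      | exact absurd rfl hij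
      | (ext i j; fin_cases i <;> fin_cases j <;> simp [Matrix.mul_apply, Fin.sum_univ_succ])
  | vsum =>
    simp only [vtx, map_add, map_one, FreeAlgebra.lift_ι_apply, gammaMat]
    ext i j; fin_cases i <;> fin_cases j <;> simp
  | src a =>
    simp only [vtx, arr, map_mul, FreeAlgebra.lift_ι_apply, gammaMat, QA.s]
    fin_cases a <;> ext i j <;> fin_cases i <;> fin_cases j <;>
      simp [Matrix.mul_apply, Fin.sum_univ_succ]
  | tgt a =>
    simp only [vtx, arr, map_mul, FreeAlgebra.lift_ι_apply, gammaMat, QA.t]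
    fin_cases a <;> ext i j <;> fin_cases i <;> fin_cases j <;>
      simp [Matrix.mul_apply, Fin.sum_univ_succ]
  | rel p hp =>
    obtain rfl := hp
    change FreeAlgebra.lift K (gammaMat K) (QA.be K ^ 3) = FreeAlgebra.lift K (gammaMat K) 0
    rw [map_pow, map_zero, QA.be, arr, FreeAlgebra.lift_ι_apply]
    simp only [gammaMat, pow_succ, pow_zero, one_mul]
    ext i j; fin_cases i <;> fin_cases j <;> simp [Matrix.mul_apply, Fin.sum_univ_succ]

/-- The representation of `Γ₂` by `4 × 4` matrices. -/
def gammaRep : Gamma2 K →ₐ[K] Matrix (Fin 4) (Fin 4) K :=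
  RingQuot.liftAlgHom K ⟨FreeAlgebra.lift K (gammaMat K), gammaMat_rel K⟩

/-- The images of the generators in `Γ₂`. -/
def gammaGen (g : TPGen (Fin 2)) : Gamma2 K :=
  RingQuot.mkAlgHom K (QuivRel K (Fin 2) QA.s QA.t {(QA.be K ^ 3, 0)}) (FreeAlgebra.ι K g)

lemma gammaRep_gammaGen (g : TPGen (Fin 2)) : gammaRep K (gammaGen K g) = gammaMat K g := by
  rw [gammaRep, gammaGen, RingQuot.liftAlgHom_mkAlgHom_apply, FreeAlgebra.lift_ι_apply]

lemma gamma_span {e₁ e₂ μ β : Gamma2 K} (h₁ : gammaGen K (.v 0) = e₁) (h₂ : gammaGen K (.v 1) = e₂)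
    (hμ : gammaGen K (.ar 0) = μ) (hβ : gammaGen K (.ar 1) = β)
    (e₁_e₁ : e₁ * e₁ = e₁) (e₂_e₂ : e₂ * e₂ = e₂) (e₁_e₂ : e₁ * e₂ = 0) (e₂_e₁ : e₂ * e₁ = 0)
    (sum_eq : e₁ + e₂ = 1) (e₁_μ : e₁ * μ = μ) (μ_e₂ : μ * e₂ = μ) (e₂_β : e₂ * β = β)
    (β_e₂ : β * e₂ = β) (β_cube : β * (β * β) = 0) (x : Gamma2 K) :
    ∃ (a : K) (b c : Fin 3 → K), x = a • e₁ +
    (b 0 • e₂ + b 1 • β + b 2 • (β * β)) + (c 0 • μ + c 1 • (μ * β) + c 2 • (μ * (β * β))) := by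
  have e₂_μ : e₂ * μ = 0 := by rw [← e₁_μ, ← mul_assoc, e₂_e₁, zero_mul]
  have μ_e₁ : μ * e₁ = 0 := by rw [← μ_e₂, mul_assoc, e₂_e₁, mul_zero]
  have e₁_β : e₁ * β = 0 := by rw [← e₂_β, ← mul_assoc, e₁_e₂, zero_mul]
  have β_e₁ : β * e₁ = 0 := by rw [← β_e₂, mul_assoc, e₂_e₁, mul_zero]
  have μ_μ : μ * μ = 0 := by rw [← e₁_μ, ← mul_assoc, e₁_μ, μ_e₁, zero_mul]
  have β_μ : β * μ = 0 := by rw [← e₁_μ, ← mul_assoc, β_e₁, zero_mul]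
  let S : Set (Gamma2 K) := {x | ∃ (a : K) (b c : Fin 3 → K), x = a • e₁ +
    (b 0 • e₂ + b 1 • β + b 2 • (β * β)) + (c 0 • μ + c 1 • (μ * β) + c 2 • (μ * (β * β)))}
  have hadd : ∀ x ∈ S, ∀ y ∈ S, x + y ∈ S := by
    rintro _ ⟨a, b, c, rfl⟩ _ ⟨a', b', c', rfl⟩
    refine ⟨a + a', b + b', c + c', ?_⟩
    simp only [Pi.add_apply, add_smul]
    abel
  have hsmul : ∀ (t : K), ∀ x ∈ S, t • x ∈ S := by
    rintro t _ ⟨a, b, c, rfl⟩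
    refine ⟨t • a, t • b, t • c, ?_⟩
    simp only [Pi.smul_apply, smul_eq_mul, mul_smul, smul_add]
  have hgen : ∀ g, ∀ x ∈ S, gammaGen K g * x ∈ S := by
    have as : ∀ {u v w : Gamma2 K}, u * v = w → ∀ z, u * (v * z) = w * z := fun h z => by
      rw [← h, mul_assoc]
    rintro g _ ⟨a, b, c, rfl⟩
    match g with
    | .v 0 =>
      refine ⟨a, 0, c, ?_⟩
      simp [h₁, mul_add, e₁_e₁, e₁_e₂, e₁_β, e₁_μ, as e₁_β, as e₁_μ]
    | .v 1 =>
      refine ⟨0, b, 0, ?_⟩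
      simp [h₂, mul_add, e₂_e₁, e₂_e₂, e₂_β, e₂_μ, as e₂_β, as e₂_μ]
    | .ar 0 =>
      refine ⟨0, 0, b, ?_⟩
      simp [hμ, mul_add, μ_e₁, μ_e₂, μ_μ, as μ_μ]
    | .ar 1 =>
      refine ⟨0, ![0, b 0, b 1], 0, ?_⟩
      simp [hβ, mul_add, β_e₁, β_e₂, β_μ, β_cube, as β_μ]
  have hmul : ∀ z : FreeAlgebra K (TPGen (Fin 2)), ∀ x ∈ S, RingQuot.mkAlgHom K
      (QuivRel K (Fin 2) QA.s QA.t {(QA.be K ^ 3, 0)}) z * x ∈ S := by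
    intro z
    induction z using FreeAlgebra.induction with
    | grade0 t =>
      intro x hx
      rw [AlgHom.commutes, ← Algebra.smul_def]
      exact hsmul t x hx
    | grade1 g => exact hgen g
    | mul z w hz hw =>
      intro x hx
      rw [map_mul, mul_assoc]
      exact hz _ (hw x hx)
    | add z w hz hw =>
      intro x hx
      rw [map_add, add_mul]
      exact hadd _ (hz x hx) _ (hw x hx)
  obtain ⟨z, rfl⟩ := RingQuot.mkAlgHom_surjective K _ x
  have h1 : (1 : Gamma2 K) ∈ S := ⟨1, ![1, 0, 0], 0, by simp [← sum_eq]⟩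
  have := hmul z 1 h1
  rwa [mul_one] at this

/-- `Γ₂` is presented by its generators. -/
def gammaElts : GammaElts K (Gamma2 K) := by
  have hrel : ∀ {x y : FreeAlgebra K (TPGen (Fin 2))},
      QuivRel K (Fin 2) QA.s QA.t {(QA.be K ^ 3, 0)} x y →
      RingQuot.mkAlgHom K (QuivRel K (Fin 2) QA.s QA.t {(QA.be K ^ 3, 0)}) x =
        RingQuot.mkAlgHom K (QuivRel K (Fin 2) QA.s QA.t {(QA.be K ^ 3, 0)}) y :=
    fun h => RingQuot.mkAlgHom_rel K h
  have r1 := hrel (.idem 0)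
  have r2 := hrel (.idem 1)
  have r3 := hrel (.orth 0 1 (by decide))
  have r4 := hrel (.orth 1 0 (by decide))
  have r5 := hrel .vsum
  have r6 := hrel (.src 0)
  have r7 := hrel (.tgt 0)
  have r8 := hrel (.src 1)
  have r9 := hrel (.tgt 1)
  have cube : ∀ {R : Type} [Ring R] (z : R), z ^ 3 = 0 → z * (z * z) = 0 := fun z h => by
    rw [← h, pow_succ', sq]
  have r10 : gammaGen K (.ar 1) * (gammaGen K (.ar 1) * gammaGen K (.ar 1)) = 0 :=
    cube _ ((map_pow _ _ _).symm.trans ((hrel (.rel (QA.be K ^ 3, 0) rfl)).trans (map_zero _)))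
  rw [map_mul] at r1 r2 r3 r4 r6 r7 r8 r9
  rw [map_zero] at r3 r4
  rw [map_add, map_one] at r5
  exact
  { e₁ := gammaGen K (.v 0)
    e₂ := gammaGen K (.v 1)
    μ := gammaGen K (.ar 0)
    β := gammaGen K (.ar 1)
    e₁_e₁ := r1
    e₂_e₂ := r2
    e₁_e₂ := r3
    e₂_e₁ := r4
    sum_eq := r5
    e₁_μ := r6
    μ_e₂ := r7
    e₂_β := r8
    β_e₂ := r9
    β_cube := r10
    e₁_ne_zero := fun h => by
      have := congrFun (congrFun (congrArg (gammaRep K) h) 0) 0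
      simp [gammaRep_gammaGen, gammaMat] at this
    span := gamma_span K rfl rfl rfl rfl r1 r2 r3 r4 r5 r6 r7 r8 r9 r10
    inj := fun c h => by
      have h' := congrArg (gammaRep K) h
      simp only [map_add, map_smul, map_mul, map_zero, gammaRep_gammaGen] at h'
      have h1 := congrFun (congrFun h' 0) 1
      have h2 := congrFun (congrFun h' 0) 2
      have h3 := congrFun (congrFun h' 0) 3
      simp [gammaMat] at h1 h2 h3
      funext k
      fin_cases k
      · exact h1
      · exact h2
      · exact h3 }

end Gamma2

end TwoPoint

namespace TwoPoint

/-- Lemma 3.1(1).  The algebra `Γ₂` (arrow `μ : 1 → 2`, loop `β` at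
`2`, relation `β³ = 0`) is τ-tilting finite; it has exactly `8` basic two-term silting
complexes, equivalently exactly `8` basic support τ-tilting modules, and the Hasse
quiver of `sτ-tilt Γ₂` is of type `H_{1,5}`. -/
theorem gamma2_tau_tilting_finite (K : Type) [Field K] [IsAlgClosed K] :
    IsTauTiltingFinite (Gamma2 K) ∧
    TwoTermSiltingCount (Gamma2 K) 8 ∧
    SupportTauTiltingCount (Gamma2 K) 8 ∧
    HasseType (Gamma2 K) 1 5 := by
  have : Infinite K := inferInstance
  have := (gammaElts K).finite_rightIdeal (gammaElts K).e₁
  have := (gammaElts K).finite_rightIdeal (gammaElts K).e₂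
  let F := (gammaElts K).frame
  exact ⟨F.isTauTiltingFinite, F.twoTermSiltingCount, F.supportTauTiltingCount, F.hasseType⟩

end TwoPoint
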